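/- arXiv:2604.08452 — 5 statements merged into one kernel-verified Lean document; each statement's English description precedes it below -/
import Mathlib

section
/- Let D ⊂ ℂ^n be a bounded domain and let f be an automorphism of D that extends holomorphically beyond the boundary, i.e. there exist an open set U containing the closure of D and a holomorphic map F : U → ℂ^n with F = f on D. If the fixed point set Fix(f) is discrete in D, then Fix(f) is a finite set. -/
open Set Metric Filter Topology

noncomputable section

/-- `ℂ^n` with the Euclidean norm. -/
abbrev CSpace (n : ℕ) := EuclideanSpace ℂ (Fin n)

/-- `f` is an automorphism of the set `D`: a holomorphic bijection of `D` onto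
itself with a holomorphic inverse. -/
def AutOn {n : ℕ} (D : Set (CSpace n)) (f : CSpace n → CSpace n) : Prop :=
  DifferentiableOn ℂ f D ∧ Set.BijOn f D D ∧
  ∃ g : CSpace n → CSpace n, DifferentiableOn ℂ g D ∧ Set.BijOn g D D ∧
    (∀ z ∈ D, g (f z) = z) ∧ (∀ z ∈ D, f (g z) = z)

/-- The fixed point set of `f` in `D`. -/
def FixOn {n : ℕ} (D : Set (CSpace n)) (f : CSpace n → CSpace n) : Set (CSpace n) :=
  {z ∈ D | f z = z}

/-- Every point of `S` is isolated in `S`. -/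
def DiscreteIn {n : ℕ} (S : Set (CSpace n)) : Prop :=
  ∀ z ∈ S, ∃ ε > 0, ∀ w ∈ S, w ≠ z → ε ≤ dist w z

/-- `f` extends holomorphically beyond the boundary of `D`. -/
def ExtendsHolo {n : ℕ} (D : Set (CSpace n)) (f : CSpace n → CSpace n) : Prop :=
  ∃ U : Set (CSpace n), IsOpen U ∧ closure D ⊆ U ∧
    ∃ F : CSpace n → CSpace n, DifferentiableOn ℂ F U ∧ Set.EqOn F f D

/-- `H` is a compact subgroup of the automorphism group of `D`. -/
def IsCompactAutGroup {n : ℕ} (D : Set (CSpace n))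
    (H : Set (CSpace n → CSpace n)) : Prop :=
  (∀ f ∈ H, AutOn D f) ∧
  (∃ e ∈ H, ∀ z ∈ D, e z = z) ∧
  (∀ f ∈ H, ∀ g ∈ H, ∃ h ∈ H, ∀ z ∈ D, h z = f (g z)) ∧
  (∀ f ∈ H, ∃ g ∈ H, (∀ z ∈ D, g (f z) = z) ∧ (∀ z ∈ D, f (g z) = z)) ∧
  (∀ u : ℕ → (CSpace n → CSpace n), (∀ k, u k ∈ H) →
    ∃ φ : ℕ → ℕ, StrictMono φ ∧ ∃ f ∈ H, ∀ K : Set (CSpace n), K ⊆ D → IsCompact K →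
      TendstoUniformlyOn (fun k => u (φ k)) f Filter.atTop K)

/-- `f` is continuous on `U` and holomorphic along every complex line. -/
def LineHol {E : Type*} [NormedAddCommGroup E] [NormedSpace ℂ E] (f : E → ℂ) (U : Set E) :
    Prop :=
  ContinuousOn f U ∧ ∀ x v : E, DifferentiableOn ℂ (fun t : ℂ => f (x + t • v)) {t | x + t • v ∈ U}

namespace LineHol

variable {E : Type*} [NormedAddCommGroup E] [NormedSpace ℂ E]
  {E' : Type*} [NormedAddCommGroup E'] [NormedSpace ℂ E'] {f g : E → ℂ} {U V : Set E}

lemma of_differentiableOn (hf : DifferentiableOn ℂ f U) : LineHol f U :=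
  ⟨hf.continuousOn, fun x v => hf.comp (by fun_prop) fun _ ht => ht⟩

lemma mono (hf : LineHol f U) (h : V ⊆ U) : LineHol f V :=
  ⟨hf.1.mono h, fun x v => (hf.2 x v).mono fun _ ht => h ht⟩

lemma congr (hf : LineHol f U) (h : EqOn g f U) : LineHol g U :=
  ⟨hf.1.congr h, fun x v => (hf.2 x v).congr fun _ ht => h ht⟩

lemma const (c : ℂ) : LineHol (fun _ : E => c) U :=
  ⟨continuousOn_const, fun _ _ => differentiableOn_const _⟩

lemma add (hf : LineHol f U) (hg : LineHol g U) : LineHol (fun x => f x + g x) U :=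
  ⟨hf.1.add hg.1, fun x v => (hf.2 x v).add (hg.2 x v)⟩

lemma mul (hf : LineHol f U) (hg : LineHol g U) : LineHol (fun x => f x * g x) U :=
  ⟨hf.1.mul hg.1, fun x v => (hf.2 x v).mul (hg.2 x v)⟩

lemma div (hf : LineHol f U) (hg : LineHol g U) (h : ∀ x ∈ U, g x ≠ 0) :
    LineHol (fun x => f x / g x) U :=
  ⟨hf.1.div hg.1 h, fun x v => (hf.2 x v).div (hg.2 x v) fun _ ht => h _ ht⟩

lemma pow (hf : LineHol f U) (n : ℕ) : LineHol (fun x => f x ^ n) U :=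
  ⟨hf.1.pow n, fun x v => (hf.2 x v).pow n⟩

lemma sum {ι : Type*} {s : Finset ι} {f : ι → E → ℂ} (hf : ∀ i ∈ s, LineHol (f i) U) :
    LineHol (fun x => ∑ i ∈ s, f i x) U :=
  ⟨continuousOn_finsetSum s fun i hi => (hf i hi).1,
    fun x v => DifferentiableOn.fun_sum fun i hi => (hf i hi).2 x v⟩

/-- Pullback along an affine map. -/
lemma comp_affine (hf : LineHol f U) (L : E' →L[ℂ] E) (c : E) {W : Set E'}
    (h : ∀ x ∈ W, c + L x ∈ U) : LineHol (fun x => f (c + L x)) W := by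
  refine ⟨hf.1.comp (by fun_prop) h, fun x v => ?_⟩
  refine ((hf.2 (c + L x) (L v)).mono (s := _) ?_).congr ?_
  · intro t ht
    have := h _ ht
    simpa [add_assoc] using this
  · intro t _
    simp [add_assoc]

/-- Functions holomorphic along lines in `U` form a subalgebra. -/
def subalgebra (U : Set E) : Subalgebra ℂ (E → ℂ) where
  carrier := {f | LineHol f U}
  mul_mem' hf hg := hf.mul hg
  add_mem' hf hg := hf.add hg
  algebraMap_mem' c := const c

end LineHol

/-- A complex parameter integral over a circle is holomorphic. -/
lemma differentiableOn_circleIntegral_param {V : Set ℂ} (hV : IsOpen V) {r : ℝ} (hr : 0 ≤ r)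
    {k : ℂ → ℂ → ℂ} (hc : ContinuousOn (Function.uncurry k) (V ×ˢ sphere 0 r))
    (hd : ∀ ζ ∈ sphere (0 : ℂ) r, DifferentiableOn ℂ (fun t => k t ζ) V) :
    DifferentiableOn ℂ (fun t => ∮ ζ in C(0, r), k t ζ) V := by
  intro t₀ ht₀
  obtain ⟨δ, hδ, hδV⟩ := Metric.nhds_basis_closedBall.mem_iff.1 (hV.mem_nhds ht₀)
  obtain ⟨C, hC⟩ := ((isCompact_closedBall t₀ δ).prod
    (isCompact_sphere (0 : ℂ) r)).exists_bound_of_continuousOn (hc.mono (prod_mono hδV subset_rfl))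
  have hcirc : ∀ θ : ℝ, circleMap 0 r θ ∈ sphere (0 : ℂ) r := fun θ => circleMap_mem_sphere _ hr _
  have hcontk : ∀ t ∈ V, Continuous fun θ : ℝ => k t (circleMap 0 r θ) := fun t ht =>
    hc.comp_continuous (f := fun θ : ℝ => (t, circleMap 0 r θ)) (by fun_prop) fun θ => ⟨ht, hcirc θ⟩
  have hcm : Continuous fun θ : ℝ => circleMap 0 r θ * Complex.I := by fun_prop
  have hder : ∀ t ∈ ball t₀ (δ / 2), ∀ ζ ∈ sphere (0 : ℂ) r,
      HasDerivAt (fun t => k t ζ) (deriv (fun t => k t ζ) t) t := fun t ht ζ hζ =>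
    ((hd ζ hζ).differentiableAt (hV.mem_nhds (hδV (ball_subset_closedBall
      (ball_subset_ball (by linarith) ht))))).hasDerivAt
  have hseq : Tendsto (fun n : ℕ => t₀ + ((n : ℂ) + 1)⁻¹) atTop (𝓝[≠] t₀) := by
    refine tendsto_nhdsWithin_iff.2 ⟨?_, Eventually.of_forall fun n => ?_⟩
    · have := (tendsto_const_nhds (x := t₀)).add (tendsto_one_div_add_atTop_nhds_zero_nat (𝕜 := ℂ))
      simpa using this
    · simpa using Nat.cast_add_one_ne_zero (R := ℂ) n
  refine (intervalIntegral.hasDerivAt_integral_of_dominated_loc_of_deriv_le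
    (F := fun t θ => deriv (circleMap 0 r) θ • k t (circleMap 0 r θ))
    (F' := fun t θ => deriv (circleMap 0 r) θ • deriv (fun t => k t (circleMap 0 r θ)) t)
    (bound := fun _ => |r| * (C / (δ / 2)))
    (ball_mem_nhds t₀ (half_pos hδ)) ?_ ?_ ?_ ?_ ?_ ?_).2.differentiableAt.differentiableWithinAt
  · filter_upwards [hV.mem_nhds ht₀] with t ht
    refine Continuous.aestronglyMeasurable ?_
    simpa only [deriv_circleMap] using hcm.fun_smul (hcontk t ht)
  · refine Continuous.intervalIntegrable ?_ _ _
    simpa only [deriv_circleMap] using hcm.fun_smul (hcontk t₀ ht₀)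
  · have hmeas : MeasureTheory.AEStronglyMeasurable
        (fun θ : ℝ => deriv (fun t => k t (circleMap 0 r θ)) t₀)
        (MeasureTheory.volume.restrict (uIoc 0 (2 * Real.pi))) := by
      have hev : ∀ᶠ n : ℕ in atTop, t₀ + ((n : ℂ) + 1)⁻¹ ∈ V :=
        (hseq.mono_right nhdsWithin_le_nhds).eventually (hV.mem_nhds ht₀)
      obtain ⟨N, hN⟩ := eventually_atTop.1 hev
      refine aestronglyMeasurable_of_tendsto_ae (u := atTop)
        (f := fun (n : ℕ) (θ : ℝ) => slope (fun t => k t (circleMap 0 r θ)) t₀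
          (t₀ + (((n + N : ℕ) : ℂ) + 1)⁻¹)) ?_ ?_
      · intro n
        have h1 := hcontk _ (hN (n + N) (by omega))
        have h2 := hcontk t₀ ht₀
        refine Continuous.aestronglyMeasurable ?_
        simpa only [slope_def_module] using (h1.fun_sub h2).fun_const_smul _
      · refine Eventually.of_forall fun θ => ?_
        have := (hasDerivAt_iff_tendsto_slope.1
          (hder t₀ (mem_ball_self (half_pos hδ)) _ (hcirc θ))).comp hseq
        exact this.comp (tendsto_add_atTop_nat N)
    simpa only [deriv_circleMap] using hcm.aestronglyMeasurable.fun_smul hmeas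
  · refine Eventually.of_forall fun θ _ t ht => ?_
    rw [norm_smul]
    refine mul_le_mul (by simp) ?_ (norm_nonneg _) (abs_nonneg _)
    have hsub : closedBall t (δ / 2) ⊆ closedBall t₀ δ := by
      refine closedBall_subset_closedBall' ?_
      have := mem_ball.1 ht
      linarith
    refine Complex.norm_deriv_le_of_forall_mem_sphere_norm_le (half_pos hδ) ?_ ?_
    · refine DifferentiableOn.diffContOnCl (((hd _ (hcirc θ)).mono hδV).mono ?_)
      rw [closure_ball _ (half_pos hδ).ne']
      exact hsub
    · intro z hz
      exact hC (z, circleMap 0 r θ) ⟨hsub (sphere_subset_closedBall hz), hcirc θ⟩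
  · exact _root_.intervalIntegrable_const
  · refine Eventually.of_forall fun θ _ t ht => ?_
    exact (hder t ht _ (hcirc θ)).fun_const_smul _

lemma LineHol.circleIntegral {E : Type*} [NormedAddCommGroup E] [NormedSpace ℂ E] {V : Set E}
    (hV : IsOpen V) {r : ℝ} (hr : 0 ≤ r)
    {k : E → ℂ → ℂ} (hc : ContinuousOn (Function.uncurry k) (V ×ˢ sphere 0 r))
    (hd : ∀ ζ ∈ sphere (0 : ℂ) r, LineHol (fun y => k y ζ) V) :
    LineHol (fun y => ∮ ζ in C(0, r), k y ζ) V := by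
  have hcirc : ∀ θ : ℝ, circleMap 0 r θ ∈ sphere (0 : ℂ) r := fun θ => circleMap_mem_sphere _ hr _
  refine ⟨?_, fun x v => ?_⟩
  · rw [continuousOn_iff_continuous_domRestrict]
    have : Continuous fun p : V × ℝ => k p.1 (circleMap 0 r p.2) :=
      hc.comp_continuous (f := fun p : V × ℝ => ((p.1 : E), circleMap 0 r p.2)) (by fun_prop)
        fun p => ⟨p.1.2, hcirc _⟩
    refine intervalIntegral.continuous_parametric_intervalIntegral_of_continuous'
      (f := fun (y : V) θ => deriv (circleMap 0 r) θ • k y (circleMap 0 r θ)) ?_ _ _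
    have hcm : Continuous fun p : V × ℝ => circleMap 0 r p.2 * Complex.I := by fun_prop
    simpa only [deriv_circleMap, Function.uncurry_def] using hcm.fun_smul this
  · refine differentiableOn_circleIntegral_param (k := fun t ζ => k (x + t • v) ζ)
      (hV.preimage (by fun_prop)) hr ?_ fun ζ hζ => (hd ζ hζ).2 x v
    exact hc.comp (f := fun p : ℂ × ℂ => (x + p.1 • v, p.2)) (by fun_prop) fun p hp => ⟨hp.1, hp.2⟩

/-- `M` is the multiset of roots of `f` in the disc of radius `r`, in the sense of the argument
principle for test functions holomorphic in the disc of radius `R`. -/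
def IsRootMultiset (f : ℂ → ℂ) (r R : ℝ) (M : Multiset ℂ) : Prop :=
  (∀ a ∈ M, a ∈ ball (0 : ℂ) r) ∧ (∀ w ∈ closedBall (0 : ℂ) r, f w = 0 → w ∈ M) ∧
  (∀ a ∈ M, f a = 0) ∧
  ∀ φ : ℂ → ℂ, DifferentiableOn ℂ φ (ball 0 R) →
    (∮ ζ in C(0, r), φ ζ * (deriv f ζ / f ζ)) = 2 * Real.pi * Complex.I * (M.map φ).sum

lemma IsRootMultiset.of_ne_zero {f : ℂ → ℂ} {r R : ℝ} (hr : 0 < r) (hrR : r < R)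
    (hf : DifferentiableOn ℂ f (ball 0 R)) (h0 : ∀ w ∈ closedBall (0 : ℂ) r, f w ≠ 0) :
    IsRootMultiset f r R 0 := by
  refine ⟨by simp, fun w hw h => absurd h (h0 w hw), by simp, fun φ hφ => ?_⟩
  have hsub : closedBall (0 : ℂ) r ⊆ ball 0 R := closedBall_subset_ball hrR
  have hd : DifferentiableOn ℂ (fun ζ => φ ζ * (deriv f ζ / f ζ)) (closedBall 0 r) :=
    (hφ.mono hsub).mul (((hf.deriv isOpen_ball).mono hsub).div (hf.mono hsub) h0)
  rw [Complex.circleIntegral_eq_zero_of_differentiable_on_off_countable hr.le countable_empty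
    hd.continuousOn fun z hz => (hd.mono ball_subset_closedBall).differentiableAt
      (isOpen_ball.mem_nhds hz.1)]
  simp

lemma IsRootMultiset.cons {f g : ℂ → ℂ} {r R : ℝ} (hr : 0 < r) (hrR : r < R) {a : ℂ}
    (ha : a ∈ ball (0 : ℂ) r) (hg : DifferentiableOn ℂ g (ball 0 R))
    (hfg : ∀ w ∈ ball (0 : ℂ) R, f w = (w - a) * g w) {M : Multiset ℂ}
    (hM : IsRootMultiset g r R M) : IsRootMultiset f r R (a ::ₘ M) := by
  obtain ⟨h1, h2, h3, h4⟩ := hM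
  have hsub : closedBall (0 : ℂ) r ⊆ ball 0 R := closedBall_subset_ball hrR
  refine ⟨?_, ?_, ?_, fun φ hφ => ?_⟩
  · simpa using ⟨by simpa using ha, by simpa using h1⟩
  · intro w hw hfw
    rw [hfg w (hsub hw), mul_eq_zero, sub_eq_zero] at hfw
    exact Multiset.mem_cons.2 (hfw.imp id (h2 w hw))
  · intro b hb
    rcases Multiset.mem_cons.1 hb with rfl | hb
    · simp [hfg b (hsub (ball_subset_closedBall ha))]
    · simp [hfg b (hsub (ball_subset_closedBall (h1 b hb))), h3 b hb]
  · have hgs : ∀ ζ ∈ sphere (0 : ℂ) r, g ζ ≠ 0 := fun ζ hζ h0 => by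
      have h := h1 ζ (h2 ζ (sphere_subset_closedBall hζ) h0)
      simp only [mem_sphere, mem_ball] at h hζ
      linarith
    have has : ∀ ζ ∈ sphere (0 : ℂ) r, ζ - a ≠ 0 := fun ζ hζ h0 => by
      rw [sub_eq_zero] at h0
      subst h0
      simp only [mem_sphere, mem_ball] at ha hζ
      linarith
    have hss : sphere (0 : ℂ) r ⊆ ball 0 R := sphere_subset_closedBall.trans hsub
    have key : EqOn (fun ζ => φ ζ * (deriv f ζ / f ζ))
        (fun ζ => φ ζ / (ζ - a) + φ ζ * (deriv g ζ / g ζ)) (sphere 0 r) := by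
      intro ζ hζ
      have hn := isOpen_ball.mem_nhds (hss hζ)
      have hd : HasDerivAt f (1 * g ζ + (ζ - a) * deriv g ζ) ζ :=
        (((hasDerivAt_id ζ).sub_const a).mul (hg.differentiableAt hn).hasDerivAt).congr_of_eventuallyEq
          (by filter_upwards [hn] with w hw using by simpa using hfg w hw)
      have := hgs ζ hζ
      have := has ζ hζ
      simp only [hd.deriv, hfg ζ (hss hζ)]
      field_simp
    rw [circleIntegral.integral_congr hr.le key, circleIntegral.integral_add, h4 φ hφ]
    · have hc := (hφ.mono hsub).circleIntegral_sub_inv_smul ha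
      simp only [smul_eq_mul] at hc
      rw [Multiset.map_cons, Multiset.sum_cons, mul_add, ← hc]
      congr 2
      ext ζ
      rw [div_eq_inv_mul]
    · refine ContinuousOn.circleIntegrable hr.le ?_
      exact (hφ.continuousOn.mono hss).div (by fun_prop) has
    · refine ContinuousOn.circleIntegrable hr.le ?_
      exact (hφ.continuousOn.mono hss).mul (((hg.deriv isOpen_ball).continuousOn.mono hss).div
        (hg.continuousOn.mono hss) hgs)

lemma exists_eq_pow_mul_of_not_eventually_zero {f : ℂ → ℂ} {U : Set ℂ} (hU : IsOpen U)
    (hf : DifferentiableOn ℂ f U) {a : ℂ} (ha : a ∈ U) (h : ¬ ∀ᶠ w in 𝓝 a, f w = 0) :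
    ∃ (n : ℕ) (g : ℂ → ℂ), DifferentiableOn ℂ g U ∧ g a ≠ 0 ∧ ∀ w, f w = (w - a) ^ n * g w := by
  obtain ⟨n, g₀, hg₀, hga, hfg⟩ :=
    ((hf.analyticAt (hU.mem_nhds ha)).exists_eventuallyEq_pow_smul_nonzero_iff).2 h
  classical
  have hoff : ∀ w, w ≠ a → (if w = a then g₀ a else f w / (w - a) ^ n) = f w / (w - a) ^ n :=
    fun w hw => if_neg hw
  refine ⟨n, fun w => if w = a then g₀ a else f w / (w - a) ^ n, ?_, by simpa using hga, ?_⟩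
  · intro w hw
    refine DifferentiableAt.differentiableWithinAt ?_
    by_cases hwa : w = a
    · subst hwa
      refine hg₀.differentiableAt.congr_of_eventuallyEq ?_
      filter_upwards [hfg] with z hz
      by_cases hza : z = w
      · simp [hza]
      · have : (z - w) ^ n ≠ 0 := pow_ne_zero _ (sub_ne_zero.2 hza)
        simp only [if_neg hza, hz, smul_eq_mul]
        field_simp
    · have : DifferentiableAt ℂ (fun w => f w / (w - a) ^ n) w :=
        (hf.differentiableAt (hU.mem_nhds hw)).div (by fun_prop) (pow_ne_zero _ (sub_ne_zero.2 hwa))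
      refine this.congr_of_eventuallyEq ?_
      filter_upwards [isOpen_ne.mem_nhds hwa] with z hz using hoff z hz
  · intro w
    by_cases hwa : w = a
    · subst hwa
      simpa using hfg.self_of_nhds
    · have : (w - a) ^ n ≠ 0 := pow_ne_zero _ (sub_ne_zero.2 hwa)
      simp only [if_neg hwa]
      field_simp

lemma exists_isRootMultiset {f : ℂ → ℂ} {r R : ℝ} (hr : 0 < r) (hrR : r < R)
    (hf : DifferentiableOn ℂ f (ball 0 R)) (h0 : ∀ w ∈ sphere (0 : ℂ) r, f w ≠ 0) :
    ∃ M, IsRootMultiset f r R M := by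
  have hsub : closedBall (0 : ℂ) r ⊆ ball 0 R := closedBall_subset_ball hrR
  have hne : ∀ f : ℂ → ℂ, DifferentiableOn ℂ f (ball 0 R) → (∀ w ∈ sphere (0 : ℂ) r, f w ≠ 0) →
      ∀ a ∈ ball (0 : ℂ) R, ¬ ∃ᶠ w in 𝓝[≠] a, f w = 0 := by
    intro f hf h0 a ha hfr
    have hz := (hf.analyticOnNhd isOpen_ball).eqOn_zero_of_preconnected_of_frequently_eq_zero
      (convex_ball _ _).isPreconnected ha hfr
    have hs : (r : ℂ) ∈ sphere (0 : ℂ) r := by simp [hr.le]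
    exact h0 _ hs (hz (hsub (sphere_subset_closedBall hs)))
  have hfin : ({w ∈ closedBall (0 : ℂ) r | f w = 0}).Finite := by
    by_contra hinf
    obtain ⟨a, ha, hacc⟩ := Set.Infinite.exists_accPt_of_subset_isCompact hinf
      (isCompact_closedBall (0 : ℂ) r) fun w hw => hw.1
    exact hne f hf h0 a (hsub ha) ((accPt_iff_frequently_nhdsNE.1 hacc).mono fun w hw => hw.2)
  obtain ⟨s, hs⟩ := hfin.exists_finset_coe
  clear hfin
  induction s using Finset.induction_on generalizing f with
  | empty =>
    refine ⟨0, .of_ne_zero hr hrR hf fun w hw h => ?_⟩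
    have : w ∈ {w ∈ closedBall (0 : ℂ) r | f w = 0} := ⟨hw, h⟩
    rw [← hs] at this
    simp at this
  | insert a s has ih =>
    have haf : a ∈ {w ∈ closedBall (0 : ℂ) r | f w = 0} := by
      rw [← hs]
      simp
    have har : a ∈ ball (0 : ℂ) r := by
      refine mem_ball.2 (lt_of_le_of_ne (mem_closedBall.1 haf.1) fun h => h0 a h haf.2)
    obtain ⟨n, g, hg, hga, hfg⟩ := exists_eq_pow_mul_of_not_eventually_zero isOpen_ball hf
      (hsub haf.1) fun h => hne f hf h0 a (hsub haf.1) (h.filter_mono nhdsWithin_le_nhds).frequently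
    have hgs : ∀ w ∈ sphere (0 : ℂ) r, g w ≠ 0 := fun w hw h => h0 w hw (by simp [hfg w, h])
    have hzero : (s : Set ℂ) = {w ∈ closedBall (0 : ℂ) r | g w = 0} := by
      ext w
      have hw : w ∈ (insert a s : Finset ℂ) ↔ w ∈ {w ∈ closedBall (0 : ℂ) r | f w = 0} := by
        rw [← hs]; rfl
      by_cases hwa : w = a
      · subst hwa
        simp [has, hga]
      · have : (w - a) ^ n ≠ 0 := pow_ne_zero _ (sub_ne_zero.2 hwa)
        simpa [hwa, hfg w, this, sub_eq_zero] using hw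
    obtain ⟨M, hM⟩ := ih hg hgs hzero
    clear hs haf ih hzero hga hgs
    induction n generalizing f with
    | zero =>
      refine ⟨M, ?_⟩
      rwa [show f = g from funext fun w => by simpa using hfg w]
    | succ n ihn =>
      have hd : DifferentiableOn ℂ (fun w => (w - a) ^ n * g w) (ball 0 R) := by fun_prop
      have hh : ∀ w ∈ sphere (0 : ℂ) r, (w - a) ^ n * g w ≠ 0 := fun w hw h =>
        h0 w hw (by rw [hfg w, pow_succ', mul_assoc, h, mul_zero])
      obtain ⟨M', hM'⟩ := ihn hd hh fun _ => rfl
      exact ⟨a ::ₘ M', hM'.cons hr hrR har hd fun w _ => by rw [hfg w, pow_succ', mul_assoc]⟩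

section RootFunctions

variable {E : Type*} [NormedAddCommGroup E] [NormedSpace ℂ E]

lemma LineHol.comp_slice {U : Set E} {h : E × ℂ → ℂ} {W : Set ℂ}
    (hh : LineHol h (U ×ˢ W)) {w : ℂ} (hw : w ∈ W) :
    LineHol (fun y => h (y, w)) U := by
  have := hh.comp_affine (ContinuousLinearMap.inl ℂ E ℂ) ((0 : E), w) (W := U)
    fun x hx => by simpa using ⟨hx, hw⟩
  simpa using this

lemma LineHol.comp_fst {U : Set E} {f : E → ℂ} (hf : LineHol f U) (W : Set ℂ) :
    LineHol (fun p : E × ℂ => f p.1) (U ×ˢ W) := by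
  have := hf.comp_affine (ContinuousLinearMap.fst ℂ E ℂ) 0 (W := U ×ˢ W)
    fun x hx => by simpa using hx.1
  simpa using this

lemma LineHol.differentiableOn_snd {U : Set E} {h : E × ℂ → ℂ} {W : Set ℂ}
    (hh : LineHol h (U ×ˢ W)) {y : E} (hy : y ∈ U) :
    DifferentiableOn ℂ (fun w => h (y, w)) W := by
  have := hh.2 (y, 0) (0, 1)
  simp only [Prod.smul_mk, smul_zero, Prod.mk_add_mk, add_zero, smul_eq_mul, mul_one,
    zero_add] at this
  exact this.mono fun w hw => ⟨hy, hw⟩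

lemma LineHol.deriv_snd {V : Set E} (hV : IsOpen V) {h : E × ℂ → ℂ} {r R : ℝ} (hr : 0 < r)
    (hrR : r < R) (hh : LineHol h (V ×ˢ ball 0 R)) :
    LineHol (fun p : E × ℂ => deriv (fun w => h (p.1, w)) p.2) (V ×ˢ ball 0 r) := by
  have hsub : closedBall (0 : ℂ) r ⊆ ball 0 R := closedBall_subset_ball hrR
  have hne : ∀ p ∈ V ×ˢ ball (0 : ℂ) r, ∀ z ∈ sphere (0 : ℂ) r, z - p.2 ≠ 0 := by
    rintro p ⟨-, hp⟩ z hz h0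
    rw [sub_eq_zero] at h0
    subst h0
    simp only [mem_sphere, mem_ball] at hp hz
    linarith
  have key : LineHol (fun p : E × ℂ => (2 * Real.pi * Complex.I : ℂ)⁻¹ *
      ∮ z in C(0, r), h (p.1, z) / (z - p.2) ^ 2) (V ×ˢ ball 0 r) := by
    refine (LineHol.const _).mul (LineHol.circleIntegral (k := fun (p : E × ℂ) z =>
      h (p.1, z) / (z - p.2) ^ 2) (hV.prod isOpen_ball) hr.le ?_ ?_)
    · refine ContinuousOn.div ?_ (by fun_prop) ?_
      · refine hh.1.comp (f := fun q : (E × ℂ) × ℂ => (q.1.1, q.2)) (by fun_prop) ?_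
        rintro q ⟨hq1, hq2⟩
        exact ⟨hq1.1, hsub (sphere_subset_closedBall hq2)⟩
      · rintro q ⟨hq1, hq2⟩
        exact pow_ne_zero _ (hne _ hq1 _ hq2)
    · intro z hz
      refine LineHol.div ?_ (LineHol.pow ?_ 2) fun p hp => pow_ne_zero _ (hne _ hp _ hz)
      · exact (hh.comp_slice (hsub (sphere_subset_closedBall hz))).comp_fst _
      · exact LineHol.of_differentiableOn (by fun_prop)
  refine key.congr fun p hp => ?_
  rw [← Complex.two_pi_I_inv_smul_circleIntegral_sub_sq_inv_smul_of_differentiable isOpen_ball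
    hsub (hh.differentiableOn_snd hp.1) hp.2]
  simp only [smul_eq_mul]
  congr 2
  ext z
  rw [div_eq_inv_mul]

/-- A continuous function with natural number values is constant on preconnected sets. -/
lemma IsPreconnected.eq_of_continuousOn_natCast {X : Type*} [TopologicalSpace X] {S : Set X}
    (hS : IsPreconnected S) {n : X → ℕ} (hn : ContinuousOn (fun x => (n x : ℂ)) S) {x y : X}
    (hx : x ∈ S) (hy : y ∈ S) : n x = n y := by
  have hn' : ContinuousOn n S := by
    refine Nat.isClosedEmbedding_coe_real.isInducing.continuousOn_iff.2 ?_
    exact (Complex.continuous_re.comp_continuousOn hn).congr fun x _ => by simp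
  exact hS.constant hn' hx hy

/-- The roots of `h (y, ·)` in a disc can be enumerated by functions of `y` whose symmetric sums
are holomorphic. -/
lemma exists_root_functions {ε r R : ℝ} (hε : 0 < ε) (hr : 0 < r) (hrR : r < R) {h : E × ℂ → ℂ}
    (hh : LineHol h (ball 0 ε ×ˢ ball 0 R))
    (h0 : ∀ y ∈ ball (0 : E) ε, ∀ w ∈ sphere (0 : ℂ) r, h (y, w) ≠ 0) :
    ∃ (d : ℕ) (ρ : Fin d → E → ℂ),
      (∀ y ∈ ball (0 : E) ε, ∀ i, ρ i y ∈ ball (0 : ℂ) r ∧ h (y, ρ i y) = 0) ∧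
      (∀ y ∈ ball (0 : E) ε, ∀ w ∈ closedBall (0 : ℂ) r, h (y, w) = 0 → ∃ i, ρ i y = w) ∧
      ∀ φ : E × ℂ → ℂ, LineHol φ (ball 0 ε ×ˢ ball 0 R) →
        LineHol (fun y => ∑ i, φ (y, ρ i y)) (ball 0 ε) := by
  have hex : ∀ y : E, ∃ M, y ∈ ball (0 : E) ε → IsRootMultiset (fun w => h (y, w)) r R M := by
    intro y
    by_cases hy : y ∈ ball (0 : E) ε
    · obtain ⟨M, hM⟩ := exists_isRootMultiset hr hrR (hh.differentiableOn_snd hy) (h0 y hy)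
      exact ⟨M, fun _ => hM⟩
    · exact ⟨0, fun h => absurd h hy⟩
  choose M hM using hex
  obtain ⟨r', hrr', hr'R⟩ := exists_between hrR
  have hss : sphere (0 : ℂ) r ⊆ ball 0 r' := fun z hz => by
    simp only [mem_sphere, mem_ball] at hz ⊢; linarith
  have hD := hh.deriv_snd isOpen_ball (hr.trans hrr') hr'R
  have hsum : ∀ φ : E × ℂ → ℂ, LineHol φ (ball 0 ε ×ˢ ball 0 R) →
      LineHol (fun y => ((M y).map fun w => φ (y, w)).sum) (ball 0 ε) := by
    intro φ hφ
    have hsR : sphere (0 : ℂ) r ⊆ ball 0 R := hss.trans (ball_subset_ball hr'R.le)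
    have key : LineHol (fun y => (2 * Real.pi * Complex.I : ℂ)⁻¹ *
        ∮ z in C(0, r), φ (y, z) * (deriv (fun w => h (y, w)) z / h (y, z))) (ball 0 ε) := by
      refine (LineHol.const _).mul (LineHol.circleIntegral (k := fun (y : E) z =>
        φ (y, z) * (deriv (fun w => h (y, w)) z / h (y, z))) isOpen_ball hr.le ?_ ?_)
      · exact (hφ.1.mono (prod_mono_right hsR)).mul ((hD.1.mono (prod_mono_right hss)).div
          (hh.1.mono (prod_mono_right hsR)) fun p hp => h0 _ hp.1 _ hp.2)
      · exact fun z hz => (hφ.comp_slice (hsR hz)).mul ((hD.comp_slice (hss hz)).div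
          (hh.comp_slice (hsR hz)) fun y hy => h0 y hy z hz)
    refine key.congr fun y hy => ?_
    have e := (hM y hy).2.2.2 _ (hφ.differentiableOn_snd hy)
    beta_reduce at e ⊢
    rw [e, inv_mul_cancel_left₀ Complex.two_pi_I_ne_zero]
  have hcard : ∀ y ∈ ball (0 : E) ε, (M y).card = (M 0).card := fun y hy => by
    refine (convex_ball (0 : E) ε).isPreconnected.eq_of_continuousOn_natCast
      (n := fun y => (M y).card) ?_ hy (mem_ball_self hε)
    simpa using (hsum (fun _ => 1) (LineHol.const 1)).1
  have hfun : ∀ y : E, ∃ v : Fin (M 0).card → ℂ, y ∈ ball (0 : E) ε →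
      (Finset.univ.val.map v) = M y := by
    intro y
    by_cases hy : y ∈ ball (0 : E) ε
    · have hl : (M y).toList.length = (M 0).card := by rw [Multiset.length_toList, hcard y hy]
      refine ⟨fun i => (M y).toList.get (i.cast hl.symm), fun _ => ?_⟩
      refine Eq.trans ?_ (Multiset.coe_toList (M y))
      rw [Fin.univ_val_map]
      congr 1
      refine List.ext_get (by simp [hl]) fun n h1 h2 => by simp
    · exact ⟨0, fun h => absurd h hy⟩
  choose v hv using hfun
  refine ⟨_, fun i y => v y i, ?_, ?_, ?_⟩
  · intro y hy i
    have hmem : v y i ∈ M y := by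
      rw [← hv y hy]
      exact Multiset.mem_map_of_mem _ (Finset.mem_univ i)
    exact ⟨(hM y hy).1 _ hmem, (hM y hy).2.2.1 _ hmem⟩
  · intro y hy w hw hyw
    have hmem := (hM y hy).2.1 w hw hyw
    rw [← hv y hy] at hmem
    obtain ⟨i, -, hi⟩ := Multiset.mem_map.1 hmem
    exact ⟨i, hi⟩
  · intro φ hφ
    refine (hsum φ hφ).congr fun y hy => ?_
    simp only [← hv y hy, Multiset.map_map]
    rfl

end RootFunctions

/-- A subalgebra containing the power sums of a finite family contains its product. -/
lemma Subalgebra.prod_mem_of_sum_pow_mem {B : Type*} [CommRing B] [Algebra ℂ B]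
    (A : Subalgebra ℂ B) {d : ℕ} (v : Fin d → B) (h : ∀ s, ∑ i, v i ^ s ∈ A) :
    ∏ i, v i ∈ A := by
  have key : ∀ k, MvPolynomial.aeval v (MvPolynomial.esymm (Fin d) ℂ k) ∈ A := by
    intro k
    induction k using Nat.strong_induction_on with
    | _ k ih =>
      rcases Nat.eq_zero_or_pos k with rfl | hk
      · simp
      · have hN := congrArg (MvPolynomial.aeval v) (MvPolynomial.mul_esymm_eq_sum (Fin d) ℂ k)
        simp only [map_mul, map_natCast, map_pow, map_neg, map_one, map_sum] at hN
        have hmem : (k : B) * MvPolynomial.aeval v (MvPolynomial.esymm (Fin d) ℂ k) ∈ A := by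
          rw [hN]
          have hneg : ∀ m : ℕ, (-1 : B) ^ m ∈ A := fun m => pow_mem (neg_mem A.one_mem) m
          refine A.mul_mem (hneg _) (A.sum_mem fun a ha => ?_)
          refine A.mul_mem (A.mul_mem (hneg _) (ih _ (Finset.mem_filter.1 ha).2)) ?_
          simpa [MvPolynomial.psum] using h a.2
        have := A.smul_mem hmem ((k : ℂ)⁻¹)
        have hk' : (k : ℂ) ≠ 0 := by exact_mod_cast hk.ne'
        rwa [← nsmul_eq_mul, ← Nat.cast_smul_eq_nsmul ℂ, smul_smul, inv_mul_cancel₀ hk',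
          one_smul] at this
  have h1 := key d
  have hc : Finset.powersetCard d (Finset.univ : Finset (Fin d)) = {Finset.univ} := by
    have := Finset.powersetCard_self (Finset.univ : Finset (Fin d))
    simpa using this
  rw [MvPolynomial.esymm, hc] at h1
  simpa using h1

/-- The polynomial `∏ᵢ (aᵢ + bᵢ X)`. -/
def pencilProd {d : ℕ} (a b : Fin d → ℂ) : Polynomial ℂ :=
  ∏ i, (Polynomial.C (a i) + Polynomial.X * Polynomial.C (b i))

lemma pencilProd_eq_X_pow_mul {d : ℕ} (a b : Fin d → ℂ) :
    pencilProd a b = Polynomial.X ^ (Finset.univ.filter fun i => a i = 0).card *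
      ((∏ i with a i = 0, Polynomial.C (b i)) *
        ∏ i with a i ≠ 0, (Polynomial.C (a i) + Polynomial.X * Polynomial.C (b i))) := by
  rw [pencilProd, ← Finset.prod_filter_mul_prod_filter_not Finset.univ (fun i => a i = 0),
    ← mul_assoc, ← Finset.prod_const, ← Finset.prod_mul_distrib]
  congr 1
  refine Finset.prod_congr rfl fun i hi => ?_
  rw [(Finset.mem_filter.1 hi).2]
  simp

lemma pencilProd_coeff_of_lt {d : ℕ} (a b : Fin d → ℂ) {l : ℕ}
    (hl : l < (Finset.univ.filter fun i => a i = 0).card) : (pencilProd a b).coeff l = 0 := by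
  rw [pencilProd_eq_X_pow_mul, Polynomial.coeff_X_pow_mul', if_neg (by omega)]

lemma pencilProd_coeff_card {d : ℕ} (a b : Fin d → ℂ) :
    (pencilProd a b).coeff (Finset.univ.filter fun i => a i = 0).card =
      (∏ i with a i = 0, b i) * ∏ i with a i ≠ 0, a i := by
  rw [pencilProd_eq_X_pow_mul, Polynomial.coeff_X_pow_mul', if_pos le_rfl, Nat.sub_self,
    Polynomial.coeff_zero_eq_eval_zero]
  simp [Polynomial.eval_prod]

lemma pencilProd_degree_lt {d : ℕ} (a b : Fin d → ℂ) : (pencilProd a b).degree < (d + 1 : ℕ) := by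
  refine lt_of_le_of_lt (b := ((d : ℕ) : WithBot ℕ)) ?_ (by exact_mod_cast Nat.lt_succ_self d)
  refine (Polynomial.degree_prod_le _ _).trans ((Finset.sum_le_card_nsmul _ _ 1 fun i _ => ?_).trans
    (by simp))
  refine (Polynomial.degree_add_le _ _).trans (max_le ?_ ?_)
  · exact Polynomial.degree_C_le.trans (by norm_num)
  · rw [mul_comm]
    exact (Polynomial.degree_C_mul_X_le _)

/-- Coefficients of a product over root functions are holomorphic. -/
lemma LineHol.pencilProd_coeff {E : Type*} [NormedAddCommGroup E] [NormedSpace ℂ E] {V : Set E}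
    {W : Set ℂ} {d : ℕ} {ρ : Fin d → E → ℂ}
    (hρ : ∀ φ : E × ℂ → ℂ, LineHol φ (V ×ˢ W) → LineHol (fun y => ∑ i, φ (y, ρ i y)) V)
    {a b : E × ℂ → ℂ} (ha : LineHol a (V ×ˢ W)) (hb : LineHol b (V ×ˢ W)) (q : ℕ) :
    LineHol (fun y => (pencilProd (fun i => a (y, ρ i y)) fun i => b (y, ρ i y)).coeff q) V := by
  have hprod : ∀ s : ℂ, LineHol (fun y => ∏ i, (a (y, ρ i y) + s * b (y, ρ i y))) V := by
    intro s
    have := (LineHol.subalgebra V).prod_mem_of_sum_pow_mem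
      (fun i y => a (y, ρ i y) + s * b (y, ρ i y)) fun m => ?_
    · change LineHol _ _ at this
      refine this.congr fun y _ => ?_
      simp [Finset.prod_apply]
    · change LineHol _ _
      refine (hρ _ ((ha.add ((LineHol.const s).mul hb)).pow m)).congr fun y _ => ?_
      simp [Finset.sum_apply]
  have heq : ∀ y, (pencilProd (fun i => a (y, ρ i y)) fun i => b (y, ρ i y)).coeff q =
      ∑ j ∈ Finset.range (d + 1), (∏ i, (a (y, ρ i y) + (j : ℂ) * b (y, ρ i y))) *
        (Lagrange.basis (Finset.range (d + 1)) (fun j : ℕ => (j : ℂ)) j).coeff q := by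
    intro y
    have hinj : InjOn (fun j : ℕ => (j : ℂ)) (Finset.range (d + 1)) :=
      fun x _ y _ h => Nat.cast_injective h
    have hint := Lagrange.eq_interpolate_of_eval_eq (s := Finset.range (d + 1))
      (v := fun j : ℕ => (j : ℂ)) (r := fun j : ℕ => ∏ i, (a (y, ρ i y) + (j : ℂ) * b (y, ρ i y)))
      (f := pencilProd (fun i => a (y, ρ i y)) fun i => b (y, ρ i y)) hinj
      (by simpa using pencilProd_degree_lt (fun i => a (y, ρ i y)) fun i => b (y, ρ i y))
      (fun j _ => by simp [pencilProd, Polynomial.eval_prod, mul_comm (j : ℂ)])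
    rw [hint]
    rw [Lagrange.interpolate_apply, Polynomial.finsetSum_coeff]
    simp only [Polynomial.coeff_C_mul]
  simp only [heq]
  exact LineHol.sum fun j _ => (hprod j).mul (LineHol.const _)

/-- Finitely many common zero loci can be cut out by a single linear combination. -/
lemma exists_linearCombination_generic {ι τ : Type*} [Finite τ] (u : τ → ι → ℂ) :
    ∃ c : ι →₀ ℂ, ∀ t, Finsupp.linearCombination ℂ (u t) c = 0 → ∀ i, u t i = 0 := by
  by_contra! hcon
  let p : {t // ∃ i, u t i ≠ 0} → Subspace ℂ (ι →₀ ℂ) := fun t =>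
    LinearMap.ker (Finsupp.linearCombination ℂ (u t))
  have hcov : ⋃ t, (p t : Set (ι →₀ ℂ)) = univ := by
    refine eq_univ_of_forall fun c => ?_
    obtain ⟨t, ht, hi⟩ := hcon c
    exact mem_iUnion.2 ⟨⟨t, hi⟩, ht⟩
  obtain ⟨⟨t, i, hi⟩, htop⟩ := Subspace.exists_eq_top_of_iUnion_eq_univ hcov
  have : Finsupp.single i (1 : ℂ) ∈ p ⟨t, i, hi⟩ := by rw [htop]; trivial
  rw [LinearMap.mem_ker] at this
  simp at this
  exact hi this

lemma LineHol.linearCombination {E : Type*} [NormedAddCommGroup E] [NormedSpace ℂ E] {U : Set E}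
    {ι : Type*} {g : ι → E → ℂ} (hg : ∀ j, LineHol (g j) U) (c : ι →₀ ℂ) :
    LineHol (fun x => Finsupp.linearCombination ℂ (fun j => g j x) c) U := by
  simp only [Finsupp.linearCombination_apply, Finsupp.sum, smul_eq_mul]
  exact LineHol.sum fun j _ => (LineHol.const _).mul (hg j)

/-- If the coefficients of order less than `q` vanish for all linear combinations, then at least
`q` indices are common zeros. -/
lemma le_card_of_pencilProd_coeff_eq_zero {ι : Type*} {d q : ℕ} (u : Fin d → ι → ℂ)
    (h : ∀ (c : ι →₀ ℂ), ∀ l < q, (pencilProd (fun i => Finsupp.linearCombination ℂ (u i) c)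
      fun _ => 1).coeff l = 0) [DecidablePred fun i => ∀ j, u i j = 0] :
    q ≤ (Finset.univ.filter fun i => ∀ j, u i j = 0).card := by
  obtain ⟨c, hc⟩ := exists_linearCombination_generic u
  have hiff : ∀ i, Finsupp.linearCombination ℂ (u i) c = 0 ↔ ∀ j, u i j = 0 := fun i =>
    ⟨hc i, fun h => by simp [Finsupp.linearCombination_apply, h]⟩
  by_contra! hlt
  have h1 := h c _ hlt
  have h2 := pencilProd_coeff_card (fun i => Finsupp.linearCombination ℂ (u i) c) fun _ => 1
  simp only [hiff] at h2
  rw [h1] at h2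
  simp only [Finset.prod_const_one, one_mul] at h2
  obtain ⟨i, hi, hi0⟩ := Finset.prod_eq_zero_iff.1 h2.symm
  exact (Finset.mem_filter.1 hi).2 hi0

lemma pencilProd_coeff_eq_zero_of_lt {ι : Type*} {d q : ℕ} (u : Fin d → ι → ℂ)
    [DecidablePred fun i => ∀ j, u i j = 0]
    (h : q ≤ (Finset.univ.filter fun i => ∀ j, u i j = 0).card) (c : ι →₀ ℂ) {l : ℕ} (hl : l < q)
    (b : Fin d → ℂ) :
    (pencilProd (fun i => Finsupp.linearCombination ℂ (u i) c) b).coeff l = 0 := by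
  refine pencilProd_coeff_of_lt _ _ (lt_of_lt_of_le (hl.trans_le h) (Finset.card_le_card ?_))
  intro i hi
  rw [Finset.mem_filter] at hi ⊢
  exact ⟨hi.1, by simp [Finsupp.linearCombination_apply, hi.2]⟩

open Classical in
/-- Common zeros above `y₀` accumulate at a common zero `(y₀, w₀)` as soon as `y₀` is a limit of
points over which there are as many common zeros as over `y₀`. -/
lemma frequently_common_zero_of_frequently_coeff {E : Type*} [NormedAddCommGroup E]
    [NormedSpace ℂ E] {V : Set E} (hV : IsOpen V)
    {W : Set ℂ} {d : ℕ} {ρ : Fin d → E → ℂ}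
    (hρ : ∀ φ : E × ℂ → ℂ, LineHol φ (V ×ˢ W) → LineHol (fun y => ∑ i, φ (y, ρ i y)) V)
    {ι : Type*} {g : ι → E × ℂ → ℂ} (hg : ∀ j, LineHol (g j) (V ×ˢ W)) {y₀ : E} (hy₀ : y₀ ∈ V)
    {i₀ : Fin d} (hi₀ : ∀ j, g j (y₀, ρ i₀ y₀) = 0) {q : ℕ}
    (hq : q = (Finset.univ.filter fun i => ∀ j, g j (y₀, ρ i y₀) = 0).card)
    (hfreq : ∃ᶠ y in 𝓝[≠] y₀, ∀ (c : ι →₀ ℂ), ∀ l < q, (pencilProd (fun i =>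
      Finsupp.linearCombination ℂ (fun j => g j (y, ρ i y)) c) fun _ => 1).coeff l = 0) :
    ∃ᶠ z in 𝓝[≠] (y₀, ρ i₀ y₀), ∀ j, g j z = 0 := by
  set w₀ := ρ i₀ y₀
  obtain ⟨c, hc⟩ := exists_linearCombination_generic fun i j => g j (y₀, ρ i y₀)
  have hG := LineHol.linearCombination hg c
  have hz : ∀ y i, (∀ j, g j (y, ρ i y) = 0) →
      Finsupp.linearCombination ℂ (fun j => g j (y, ρ i y)) c = 0 := fun y i h => by
    simp [Finsupp.linearCombination_apply, h]
  have hb : LineHol (fun p : E × ℂ => p.2 - w₀) (V ×ˢ W) :=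
    LineHol.of_differentiableOn (by fun_prop)
  have hF0 := (LineHol.pencilProd_coeff hρ hG (LineHol.const 1) q).1
  have hF1 := (LineHol.pencilProd_coeff hρ hG hb q).1
  set a : E → Fin d → ℂ := fun y i => Finsupp.linearCombination ℂ (fun j => g j (y, ρ i y)) c

  change ContinuousOn (fun y => (pencilProd (a y) fun _ => 1).coeff q) V at hF0
  change ContinuousOn (fun y => (pencilProd (a y) fun i => ρ i y - w₀).coeff q) V at hF1
  have hqa : q = (Finset.univ.filter fun i => a y₀ i = 0).card := by
    rw [hq]
    congr 1
    ext i
    simp only [Finset.mem_filter, Finset.mem_univ, true_and]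
    exact ⟨hz y₀ i, hc i⟩
  have hF0y : (pencilProd (a y₀) fun _ => 1).coeff q ≠ 0 := by
    rw [hqa, pencilProd_coeff_card]
    simp [Finset.prod_eq_zero_iff]
  have hF1y : (pencilProd (a y₀) fun i => ρ i y₀ - w₀).coeff q = 0 := by
    rw [hqa, pencilProd_coeff_card]
    refine mul_eq_zero_of_left (Finset.prod_eq_zero (i := i₀) ?_ (sub_self _)) _
    exact Finset.mem_filter.2 ⟨Finset.mem_univ _, hz y₀ i₀ hi₀⟩
  refine nhdsWithin_basis_ball.frequently_iff.2 fun δ hδ => ?_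
  have hev : ∀ᶠ y in 𝓝 y₀, ‖(pencilProd (a y) fun i => ρ i y - w₀).coeff q‖ <
      δ ^ q * ‖(pencilProd (a y) fun _ => 1).coeff q‖ := by
    refine ((hF1.continuousAt (hV.mem_nhds hy₀)).norm).eventually_lt
      ((hF0.continuousAt (hV.mem_nhds hy₀)).norm.const_mul _) ?_
    rw [hF1y, norm_zero]
    positivity
  obtain ⟨y, hy, ⟨hlt, hyδ⟩, hne⟩ := (hfreq.and_eventually (((hev.and
    (ball_mem_nhds y₀ hδ)).filter_mono nhdsWithin_le_nhds).and self_mem_nhdsWithin)).exists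
  have hT := le_card_of_pencilProd_coeff_eq_zero (fun i j => g j (y, ρ i y)) hy
  have hTS : (Finset.univ.filter fun i => ∀ j, g j (y, ρ i y) = 0) ⊆
      Finset.univ.filter fun i => a y i = 0 := fun i hi => by
    rw [Finset.mem_filter] at hi ⊢
    exact ⟨hi.1, hz y i hi.2⟩
  have hS : (Finset.univ.filter fun i => a y i = 0).card ≤ q := by
    by_contra! h
    rw [pencilProd_coeff_of_lt (a y) (fun _ => 1) h, norm_zero, mul_zero] at hlt
    exact absurd hlt (norm_nonneg _).not_gt
  have hEq := Finset.eq_of_subset_of_card_le hTS (hS.trans hT)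
  have hSq : (Finset.univ.filter fun i => a y i = 0).card = q := le_antisymm hS (hEq ▸ hT)
  rw [← hSq, pencilProd_coeff_card, pencilProd_coeff_card, Finset.prod_const_one, one_mul,
    norm_mul] at hlt
  have hlt' := lt_of_mul_lt_mul_right hlt (norm_nonneg _)
  obtain ⟨i, hi, hiδ⟩ : ∃ i ∈ Finset.univ.filter fun i => a y i = 0, ‖ρ i y - w₀‖ < δ := by
    by_contra! h
    refine hlt'.not_ge ?_
    rw [norm_prod, ← Finset.prod_const]
    exact Finset.prod_le_prod (fun _ _ => hδ.le) h
  refine ⟨(y, ρ i y), ⟨?_, fun h => hne (congrArg Prod.fst h)⟩, ?_⟩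
  · rw [mem_ball, Prod.dist_eq, max_lt_iff]
    exact ⟨hyδ, by rwa [dist_eq_norm]⟩
  · rw [← hEq] at hi
    exact (Finset.mem_filter.1 hi).2

/-- Near the origin, common zeros of a holomorphic family are not isolated, except possibly the
origin itself. -/
def LocallyNoIsolatedZeros (E : Type) [NormedAddCommGroup E] [NormedSpace ℂ E] : Prop :=
  ∀ (ι : Type) (g : ι → E → ℂ) (r : ℝ), 0 < r → (∀ i, LineHol (g i) (ball 0 r)) →
    ∀ᶠ z in 𝓝[≠] (0 : E), (∀ i, g i z = 0) → ∃ᶠ w in 𝓝[≠] z, ∀ i, g i w = 0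

open Classical in
/-- The inductive step, when some member of the family does not vanish along the last axis. -/
lemma LocallyNoIsolatedZeros.prod_of_regular {E : Type} [NormedAddCommGroup E] [NormedSpace ℂ E]
    (hE : LocallyNoIsolatedZeros E) {ι : Type} {g : ι → E × ℂ → ℂ} {R : ℝ} (hR : 0 < R)
    (hg : ∀ i, LineHol (g i) (ball 0 R)) {j : ι} (hj : ¬ ∀ᶠ w in 𝓝 (0 : ℂ), g j (0, w) = 0) :
    ∀ᶠ z in 𝓝[≠] (0 : E × ℂ), (∀ i, g i z = 0) → ∃ᶠ w in 𝓝[≠] z, ∀ i, g i w = 0 := by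
  have hball : ball (0 : E × ℂ) R = ball 0 R ×ˢ ball 0 R := (ball_prod_same 0 0 R).symm
  simp only [hball] at hg
  have hne : ∀ᶠ w in 𝓝[≠] (0 : ℂ), g j (0, w) ≠ 0 := by
    have hd : DifferentiableOn ℂ (fun w => g j (0, w)) (ball 0 R) :=
      (hg j).differentiableOn_snd (mem_ball_self hR)
    exact ((hd.analyticAt (ball_mem_nhds 0 hR)).eventually_eq_zero_or_eventually_ne_zero).resolve_left
      hj
  obtain ⟨r₀, hr₀, hr₀'⟩ := nhdsWithin_basis_ball.eventually_iff.1 hne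
  obtain ⟨r, hr, hrlt⟩ := exists_between (lt_min hr₀ hR)
  obtain ⟨hrr₀, hrR⟩ := lt_min_iff.1 hrlt
  have hzero : ∀ w ∈ closedBall (0 : ℂ) r, w ≠ 0 → g j (0, w) ≠ 0 := fun w hw hw0 =>
    hr₀' ⟨closedBall_subset_ball hrr₀ hw, hw0⟩
  have hopen : IsOpen ((ball (0 : E) R ×ˢ ball (0 : ℂ) R) ∩ g j ⁻¹' {0}ᶜ) :=
    (hg j).1.isOpen_inter_preimage (isOpen_ball.prod isOpen_ball) isOpen_compl_singleton
  obtain ⟨u, v, hu, -, h0u, hv, huv⟩ := generalized_tube_lemma (isCompact_singleton (x := (0 : E)))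
    (isCompact_sphere (0 : ℂ) r) hopen (by
      rintro ⟨y, w⟩ ⟨rfl, hw⟩
      refine ⟨⟨mem_ball_self hR, closedBall_subset_ball hrR (sphere_subset_closedBall hw)⟩, ?_⟩
      exact hzero w (sphere_subset_closedBall hw) (ne_of_mem_sphere hw hr.ne'))
  obtain ⟨ε, hε, hεu⟩ := Metric.mem_nhds_iff.1
    (Filter.inter_mem (hu.mem_nhds (h0u rfl)) (ball_mem_nhds (0 : E) hR))
  have hsub : ball (0 : E) ε ×ˢ ball (0 : ℂ) R ⊆ ball 0 R ×ˢ ball 0 R :=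
    prod_mono_left fun y hy => (hεu hy).2
  have hg' : ∀ i, LineHol (g i) (ball 0 ε ×ˢ ball 0 R) := fun i => (hg i).mono hsub
  obtain ⟨d, ρ, -, hρ2, hρ⟩ := exists_root_functions hε hr hrR (hg' j)
    fun y hy w hw => (huv ⟨(hεu hy).1, hv hw⟩).2
  let Φ (c : ι →₀ ℂ) (l : ℕ) (y : E) : ℂ := (pencilProd (fun k =>
    Finsupp.linearCombination ℂ (fun j => g j (y, ρ k y)) c) fun _ => 1).coeff l
  have hΦ : ∀ c l, LineHol (Φ c l) (ball 0 ε) := fun c l =>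
    LineHol.pencilProd_coeff hρ (LineHol.linearCombination hg' c) (LineHol.const 1) l
  have hev : ∀ q ∈ Finset.range (d + 1), ∀ᶠ y in 𝓝[≠] (0 : E),
      (∀ i : (ι →₀ ℂ) × Fin q, Φ i.1 i.2 y = 0) →
      ∃ᶠ y' in 𝓝[≠] y, ∀ i : (ι →₀ ℂ) × Fin q, Φ i.1 i.2 y' = 0 := fun q _ =>
    hE ((ι →₀ ℂ) × Fin q) (fun i => Φ i.1 i.2) ε hε fun i => hΦ i.1 i.2
  obtain ⟨δ, hδ, hδ'⟩ := nhdsWithin_basis_ball.eventually_iff.1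
    ((Filter.eventually_all_finset _).2 hev)
  refine nhdsWithin_basis_ball.eventually_iff.2 ⟨min (min δ ε) r, by positivity, ?_⟩
  rintro ⟨y₀, w₀⟩ ⟨hmem, hne0⟩ hz
  rw [mem_ball_zero_iff, Prod.norm_mk, max_lt_iff, lt_min_iff, lt_min_iff, lt_min_iff,
    lt_min_iff] at hmem
  obtain ⟨⟨⟨hyδ, hyε⟩, -⟩, -, hwr⟩ := hmem
  have hw₀ : w₀ ∈ closedBall (0 : ℂ) r := mem_closedBall_zero_iff.2 hwr.le
  have hy₀ : y₀ ∈ ball (0 : E) ε := mem_ball_zero_iff.2 hyε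
  have hy0 : y₀ ≠ 0 := by
    rintro rfl
    exact hzero w₀ hw₀ (fun h => hne0 (by simp [h])) (hz j)
  obtain ⟨i₀, rfl⟩ := hρ2 y₀ hy₀ w₀ hw₀ (hz j)
  refine frequently_common_zero_of_frequently_coeff isOpen_ball hρ hg' hy₀ hz rfl ?_
  set q := (Finset.univ.filter fun i => ∀ j, g j (y₀, ρ i y₀) = 0).card with hq
  have hqd : q ∈ Finset.range (d + 1) := by
    have := Finset.card_le_univ (Finset.univ.filter fun i => ∀ j, g j (y₀, ρ i y₀) = 0)
    rw [Fintype.card_fin] at this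
    exact Finset.mem_range.2 (by omega)
  refine (hδ' ⟨mem_ball_zero_iff.2 hyδ, hy0⟩ q hqd fun i => ?_).mono fun y hy c l hl =>
    hy (c, ⟨l, hl⟩)
  exact pencilProd_coeff_eq_zero_of_lt (fun i j => g j (y₀, ρ i y₀)) hq.le i.1 i.2.2 _

lemma tendsto_nhdsNE_of_injective {X Y : Type*} [TopologicalSpace X] [TopologicalSpace Y]
    {e : X → Y} (hc : Continuous e) (he : Function.Injective e) {x : X} {y : Y} (hxy : e x = y) :
    Tendsto e (𝓝[≠] x) (𝓝[≠] y) := by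
  subst hxy
  exact hc.continuousWithinAt.tendsto_nhdsWithin fun w hw h => hw (he h)

lemma LineHol.not_eventually_zero_of_ne_zero {E : Type*} [NormedAddCommGroup E] [NormedSpace ℂ E]
    {f : E → ℂ} {r : ℝ} (hf : LineHol f (ball 0 r)) {v : E} (hv : v ∈ ball (0 : E) r)
    (hfv : f v ≠ 0) : ¬ ∀ᶠ t in 𝓝 (0 : ℂ), f (t • v) = 0 := by
  intro hev
  have hd := hf.2 0 v
  simp only [zero_add] at hd
  have hopen : IsOpen {t : ℂ | t • v ∈ ball (0 : E) r} := isOpen_ball.preimage (by fun_prop)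
  have hconv : Convex ℝ {t : ℂ | t • v ∈ ball (0 : E) r} :=
    (convex_ball (0 : E) r).linear_preimage ((LinearMap.toSpanSingleton ℂ E v).restrictScalars ℝ)
  have h0 : (0 : ℂ) ∈ {t : ℂ | t • v ∈ ball (0 : E) r} := by
    simpa using (norm_nonneg v).trans_lt (mem_ball_zero_iff.1 hv)
  have := (hd.analyticOnNhd hopen).eqOn_zero_of_preconnected_of_eventuallyEq_zero
    hconv.isPreconnected h0 hev (show (1 : ℂ) ∈ _ by simpa using hv)
  exact hfv (by simpa using this)

/-- Isolated common zeros of a holomorphic family do not accumulate. -/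
theorem locallyNoIsolatedZeros (n : ℕ) : ∀ (E : Type) [NormedAddCommGroup E] [NormedSpace ℂ E]
    [FiniteDimensional ℂ E], Module.finrank ℂ E = n → LocallyNoIsolatedZeros E := by
  induction n with
  | zero =>
    intro E _ _ _ hn ι g r _ _
    have := Module.finrank_zero_iff.1 hn
    refine eventually_nhdsWithin_of_forall fun z hz => absurd (Subsingleton.elim z 0) hz
  | succ n ih =>
    intro E _ _ _ hn ι g r hr hg
    have : Nontrivial E := Module.nontrivial_of_finrank_pos (R := ℂ) (by omega)
    by_cases hall : ∀ j, ∀ v ∈ ball (0 : E) r, g j v = 0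
    · refine nhdsWithin_le_nhds ?_
      filter_upwards [ball_mem_nhds (0 : E) hr] with z hz _
      have := Module.punctured_nhds_neBot ℂ E z
      refine Eventually.frequently (nhdsWithin_le_nhds ?_)
      filter_upwards [isOpen_ball.mem_nhds hz] with w hw j using hall j w hw
    obtain ⟨j, v, hv, hjv⟩ : ∃ j, ∃ v : E, v ≠ 0 ∧ ¬ ∀ᶠ t in 𝓝 (0 : ℂ), g j (t • v) = 0 := by
      push Not at hall
      obtain ⟨j, v, hv, hjv⟩ := hall
      rcases eq_or_ne v 0 with rfl | hv0
      · obtain ⟨v, hv⟩ := exists_ne (0 : E)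
        exact ⟨j, v, hv, fun h => hjv (by simpa using h.self_of_nhds)⟩
      · exact ⟨j, v, hv0, (hg j).not_eventually_zero_of_ne_zero hv hjv⟩
    obtain ⟨q, hq⟩ := Submodule.exists_isCompl (Submodule.span ℂ {v})
    have hqn : Module.finrank ℂ q = n := by
      have := Submodule.finrank_add_eq_of_isCompl hq
      rw [finrank_span_singleton hv] at this
      omega
    let L : (q × ℂ) ≃L[ℂ] E := (((LinearEquiv.refl ℂ q).prodCongr
      (LinearEquiv.toSpanNonzeroSingleton ℂ E v hv)).trans
        (Submodule.prodEquivOfIsCompl q _ hq.symm)).toContinuousLinearEquiv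
    have hL : ∀ w : ℂ, L (0, w) = w • v := fun w => by simp [L]
    obtain ⟨R, hR, hRL⟩ := Metric.mem_nhds_iff.1 (L.continuous.continuousAt.preimage_mem_nhds
      (x := 0) (by simpa using ball_mem_nhds (0 : E) hr))
    have key := (ih q hqn).prod_of_regular (g := fun i p => g i (L p)) hR (j := j) (fun i => by
      simpa using (hg i).comp_affine (L : (q × ℂ) →L[ℂ] E) 0 (W := ball 0 R)
        fun x hx => by simpa using hRL hx) (by simpa only [hL] using hjv)
    have ht := tendsto_nhdsNE_of_injective L.symm.continuous L.symm.injective (map_zero L.symm)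
    filter_upwards [ht.eventually key] with z hz hzero
    exact (tendsto_nhdsNE_of_injective L.continuous L.injective (L.apply_symm_apply z)).frequently
      (hz (by simpa using hzero))

theorem fixed_points_finite_of_extension {n : ℕ} (D : Set (CSpace n))
    (hDopen : IsOpen D) (hDconn : IsConnected D) (hDbdd : Bornology.IsBounded D)
    (f : CSpace n → CSpace n) (hf : AutOn D f) (hext : ExtendsHolo D f)
    (hdisc : DiscreteIn (FixOn D f)) :
    (FixOn D f).Finite := by
  obtain ⟨U, hU, hDU, F, hF, hFf⟩ := hext
  by_contra hinf
  obtain ⟨p, hp, hacc⟩ := Set.Infinite.exists_accPt_of_subset_isCompact hinf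
    hDbdd.isCompact_closure (fun z hz => subset_closure hz.1)
  rw [accPt_iff_frequently_nhdsNE] at hacc
  obtain ⟨r, hr, hrU⟩ := Metric.isOpen_iff.1 hU p (hDU hp)
  have hmaps : MapsTo (fun z => p + z) (ball (0 : CSpace n) r) U := fun z hz =>
    hrU (by simpa using hz)
  have hg : ∀ i : Fin n, LineHol (fun z => (F (p + z) - (p + z)) i) (ball (0 : CSpace n) r) := by
    intro i
    refine LineHol.of_differentiableOn ?_
    refine (EuclideanSpace.proj (𝕜 := ℂ) i).differentiable.comp_differentiableOn
      (f := fun z => F (p + z) - (p + z)) ?_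
    exact (hF.comp (by fun_prop) hmaps).sub (by fun_prop)
  have hzero : ∀ z, (∀ i : Fin n, (F (p + z) - (p + z)) i = 0) ↔ F (p + z) = p + z := fun z =>
    ⟨fun h => sub_eq_zero.1 (by ext i; exact h i), fun h i => by simp [h]⟩
  have key := locallyNoIsolatedZeros n (CSpace n) (by simp) (Fin n) _ r hr hg
  simp only [hzero] at key
  have ht : Tendsto (fun z => z - p) (𝓝[≠] p) (𝓝[≠] 0) :=
    tendsto_nhdsNE_of_injective (by fun_prop) (sub_left_injective) (sub_self p)
  obtain ⟨z, hz, hzkey⟩ := (hacc.and_eventually (ht.eventually key)).exists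
  have hzfreq := hzkey (by simpa using (hFf hz.1).trans hz.2)
  have ht' : Tendsto (fun w => p + w) (𝓝[≠] (z - p)) (𝓝[≠] z) :=
    tendsto_nhdsNE_of_injective (by fun_prop) (add_right_injective p) (by simp)
  obtain ⟨ε, hε, hiso⟩ := hdisc z hz
  have hfix : ∃ᶠ w in 𝓝[≠] z, F w = w := ht'.frequently hzfreq
  have hnear : ∀ᶠ w in 𝓝[≠] z, (w ∈ D ∧ w ∈ ball z ε) ∧ w ≠ z :=
    (((hDopen.eventually_mem hz.1).and (ball_mem_nhds z hε)).filter_mono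
      nhdsWithin_le_nhds).and self_mem_nhdsWithin
  obtain ⟨w, hw, ⟨hwD, hwε⟩, hne⟩ := (hfix.and_eventually hnear).exists
  exact (hiso w ⟨hwD, (hFf hwD).symm.trans hw⟩ hne).not_gt hwε
end
end

section
/- Let D ⊂ ℂ^n be a bounded domain and let H be a compact subgroup of the automorphism group of D, i.e. H contains the identity, is closed under composition and inversion, and every sequence in H has a subsequence converging uniformly on compact subsets of D to an element of H. Assume every f ∈ H extends holomorphically beyond the boundary of D. Then there exists a natural number m (depending only on D and H) such that every f ∈ H whose fixed point set is discrete in D has a finite fixed point set of cardinality at most m. -/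
open Set Metric Filter Topology

noncomputable section

/-- Around every point `p` of `D`, the map `f` coincides on `D ∩ ball p ρ` with a map `F` on the
whole ball which is strictly differentiable at `p`, with constants uniform in `p`. -/
def HasUniformLocalExt {E : Type*} [NormedAddCommGroup E] [NormedSpace ℂ E]
    (D : Set E) (ρ K : ℝ) (f : E → E) : Prop :=
  ∀ p ∈ D, ∃ (F : E → E) (A : E →L[ℂ] E), ‖A‖ ≤ K ∧ (∀ z ∈ D, z ∈ ball p ρ → F z = f z) ∧
    ∀ z ∈ ball p ρ, ∀ w ∈ ball p ρ, ‖F z - F w - A (z - w)‖ ≤ K * (‖z - p‖ + ‖w - p‖) * ‖z - w‖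

section Extension

variable {E : Type*} [NormedAddCommGroup E] [NormedSpace ℂ E]

lemma norm_fderiv_le_of_forall_closedBall_norm_le {F : E → E} {z : E} {R M : ℝ} (hR : 0 < R)
    (hM : 0 ≤ M) (hd : ∀ x ∈ closedBall z R, DifferentiableAt ℂ F x)
    (hb : ∀ x ∈ closedBall z R, ‖F x‖ ≤ M) : ‖fderiv ℂ F z‖ ≤ M / R := by
  refine ContinuousLinearMap.opNorm_le_bound _ (by positivity) fun v => ?_
  rcases eq_or_ne v 0 with rfl | hv
  · simp
  have hv' : 0 < ‖v‖ := norm_pos_iff.2 hv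
  have hmem : ∀ ζ ∈ closedBall (0 : ℂ) (R / ‖v‖), z + ζ • v ∈ closedBall z R := by
    intro ζ hζ
    rw [mem_closedBall, dist_zero_right, le_div_iff₀ hv'] at hζ
    simpa [dist_eq_norm, norm_smul] using hζ
  have hline : ∀ ζ : ℂ, HasDerivAt (fun ζ : ℂ => z + ζ • v) v ζ := fun ζ => by
    simpa using ((hasDerivAt_id ζ).smul_const v).const_add z
  have hdiff : DifferentiableOn ℂ (fun ζ : ℂ => F (z + ζ • v)) (closedBall 0 (R / ‖v‖)) :=
    fun ζ hζ => ((hd _ (hmem ζ hζ)).comp ζ (hline ζ).differentiableAt).differentiableWithinAt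
  have hder : HasDerivAt (fun ζ : ℂ => F (z + ζ • v)) (fderiv ℂ F z v) 0 := by
    have h1 : HasFDerivAt F (fderiv ℂ F z) (z + (0 : ℂ) • v) := by
      simpa using (hd z (mem_closedBall_self hR.le)).hasFDerivAt
    exact h1.comp_hasDerivAt (0 : ℂ) (hline 0)
  have h := Complex.norm_deriv_le_of_forall_mem_sphere_norm_le (C := M) (div_pos hR hv')
    (hdiff.diffContOnCl_ball subset_rfl)
    (fun ζ hζ => hb _ (hmem ζ (sphere_subset_closedBall hζ)))
  rw [hder.deriv] at h
  calc _ ≤ M / (R / ‖v‖) := h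
    _ = M / R * ‖v‖ := by field_simp

lemma norm_fderiv_sub_fderiv_le {F : E → E} {p z : E} {ρ M : ℝ} (hρ : 0 < ρ)
    (hM : 0 ≤ M) (hd : ∀ x ∈ closedBall p (3 * ρ), DifferentiableAt ℂ F x)
    (hb : ∀ x ∈ closedBall p (3 * ρ), ‖F x‖ ≤ M) (hz : z ∈ closedBall p ρ) :
    ‖fderiv ℂ F z - fderiv ℂ F p‖ ≤ M / ρ / ρ * ‖z - p‖ := by
  rw [mem_closedBall, dist_eq_norm] at hz
  have hsub : ∀ x ∈ closedBall p (2 * ρ), closedBall x ρ ⊆ closedBall p (3 * ρ) := fun x hx =>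
    closedBall_subset_closedBall' (by rw [mem_closedBall] at hx; linarith)
  have hF' : ∀ x ∈ closedBall p (2 * ρ), ‖fderiv ℂ F x‖ ≤ M / ρ := fun x hx =>
    norm_fderiv_le_of_forall_closedBall_norm_le hρ hM (fun y hy => hd y (hsub x hx hy))
      (fun y hy => hb y (hsub x hx hy))
  have hx2 : ∀ x ∈ closedBall p ρ, x ∈ closedBall p (2 * ρ) ∧
      x + (z - p) ∈ closedBall p (2 * ρ) := by
    intro x hx
    rw [mem_closedBall, dist_eq_norm] at hx
    refine ⟨by rw [mem_closedBall, dist_eq_norm]; linarith, ?_⟩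
    rw [mem_closedBall, dist_eq_norm]
    calc ‖x + (z - p) - p‖ = ‖(x - p) + (z - p)‖ := by congr 1; abel
      _ ≤ ‖x - p‖ + ‖z - p‖ := norm_add_le _ _
      _ ≤ _ := by linarith
  have h23 : closedBall p (2 * ρ) ⊆ closedBall p (3 * ρ) :=
    closedBall_subset_closedBall (by linarith)
  have hG : ∀ x ∈ closedBall p ρ, HasFDerivAt (fun x => F (x + (z - p)) - F x)
      (fderiv ℂ F (x + (z - p)) - fderiv ℂ F x) x := fun x hx =>
    ((hasFDerivAt_comp_add_right (z - p)).2 (hd _ (h23 (hx2 x hx).2)).hasFDerivAt).sub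
      (hd _ (h23 (hx2 x hx).1)).hasFDerivAt
  have hGb : ∀ x ∈ closedBall p ρ, ‖F (x + (z - p)) - F x‖ ≤ M / ρ * ‖z - p‖ := by
    intro x hx
    have := (convex_closedBall p (2 * ρ)).norm_image_sub_le_of_norm_fderiv_le (𝕜 := ℂ)
      (fun y hy => hd y (h23 hy)) hF' (hx2 x hx).1 (hx2 x hx).2
    simpa using this
  have h := norm_fderiv_le_of_forall_closedBall_norm_le hρ (by positivity)
    (fun x hx => (hG x hx).differentiableAt) hGb
  rw [(hG p (mem_closedBall_self hρ.le)).fderiv, add_sub_cancel] at h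
  calc _ ≤ _ := h
    _ = _ := by ring

lemma norm_sub_sub_fderiv_le {F : E → E} {p : E} {ρ M : ℝ} (hρ : 0 < ρ)
    (hM : 0 ≤ M) (hd : ∀ x ∈ closedBall p (3 * ρ), DifferentiableAt ℂ F x)
    (hb : ∀ x ∈ closedBall p (3 * ρ), ‖F x‖ ≤ M) {z w : E} (hz : z ∈ ball p ρ)
    (hw : w ∈ ball p ρ) :
    ‖F z - F w - fderiv ℂ F p (z - w)‖ ≤ M / ρ / ρ * (‖z - p‖ + ‖w - p‖) * ‖z - w‖ := by
  rw [mem_ball, dist_eq_norm] at hz hw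
  set s := max ‖z - p‖ ‖w - p‖ with hs
  have hsρ : s ≤ ρ := max_le hz.le hw.le
  have hmem : ∀ x ∈ closedBall p s, x ∈ closedBall p (3 * ρ) := fun x hx =>
    closedBall_subset_closedBall (by linarith) hx
  have h := (convex_closedBall p s).norm_image_sub_le_of_norm_hasFDerivWithin_le' (𝕜 := ℂ)
    (C := M / ρ / ρ * s) (φ := fderiv ℂ F p)
    (fun x hx => (hd x (hmem x hx)).hasFDerivAt.hasFDerivWithinAt)
    (fun x hx => (norm_fderiv_sub_fderiv_le hρ hM hd hb
      (closedBall_subset_closedBall hsρ hx)).trans (by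
        rw [mem_closedBall, dist_eq_norm] at hx
        gcongr))
    (by rw [mem_closedBall, dist_eq_norm]; exact le_max_right _ _ : w ∈ closedBall p s)
    (by rw [mem_closedBall, dist_eq_norm]; exact le_max_left _ _ : z ∈ closedBall p s)
  refine h.trans ?_
  gcongr
  exact max_le_add_of_nonneg (norm_nonneg _) (norm_nonneg _)

lemma HasUniformLocalExt.mono {D : Set E} {ρ ρ' K K' : ℝ} {f : E → E}
    (h : HasUniformLocalExt D ρ K f) (hρ : ρ' ≤ ρ) (hK : K ≤ K') :
    HasUniformLocalExt D ρ' K' f := by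
  intro p hp
  obtain ⟨F, A, hA, hF, hFA⟩ := h p hp
  refine ⟨F, A, hA.trans hK, fun z hz hzp => hF z hz (ball_subset_ball hρ hzp),
    fun z hz w hw => (hFA z (ball_subset_ball hρ hz) w (ball_subset_ball hρ hw)).trans ?_⟩
  gcongr

lemma HasUniformLocalExt.congr {D : Set E} {ρ K : ℝ} {f g : E → E}
    (h : HasUniformLocalExt D ρ K f) (hfg : ∀ z ∈ D, g z = f z) :
    HasUniformLocalExt D ρ K g := by
  intro p hp
  obtain ⟨F, A, hA, hF, hFA⟩ := h p hp
  exact ⟨F, A, hA, fun z hz hzp => (hF z hz hzp).trans (hfg z hz).symm, hFA⟩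

lemma HasUniformLocalExt.of_differentiableOn [ProperSpace E] {D U : Set E} {f F : E → E}
    (hD : Bornology.IsBounded D) (hU : IsOpen U) (hDU : closure D ⊆ U)
    (hF : DifferentiableOn ℂ F U) (hFf : EqOn F f D) :
    ∃ ρ > 0, ∃ K, HasUniformLocalExt D ρ K f := by
  obtain ⟨δ, hδ, hδU⟩ := hD.isCompact_closure.exists_cthickening_subset_open hU hDU
  rw [cthickening_closure] at hδU
  have hcomp : IsCompact (cthickening δ D) :=
    isCompact_of_isClosed_isBounded isClosed_cthickening hD.cthickening
  obtain ⟨M, hM⟩ := hcomp.exists_bound_of_continuousOn (hF.continuousOn.mono hδU)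
  have hρ : 0 < δ / 3 := by positivity
  have hball : ∀ p ∈ D, ∀ x ∈ closedBall p (3 * (δ / 3)), x ∈ cthickening δ D := by
    intro p hp x hx
    rw [mul_div_cancel₀ _ (by norm_num)] at hx
    exact closedBall_subset_cthickening hp δ hx
  refine ⟨δ / 3, hρ, max M 0 / (δ / 3) + max M 0 / (δ / 3) / (δ / 3), fun p hp => ?_⟩
  have hd : ∀ x ∈ closedBall p (3 * (δ / 3)), DifferentiableAt ℂ F x := fun x hx =>
    hF.differentiableAt (hU.mem_nhds (hδU (hball p hp x hx)))
  have hb : ∀ x ∈ closedBall p (3 * (δ / 3)), ‖F x‖ ≤ max M 0 := fun x hx =>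
    (hM x (hball p hp x hx)).trans (le_max_left _ _)
  have hsub : closedBall p (δ / 3) ⊆ closedBall p (3 * (δ / 3)) :=
    closedBall_subset_closedBall (by linarith)
  refine ⟨F, fderiv ℂ F p, ?_, fun z hz _ => hFf hz, fun z hz w hw => ?_⟩
  · refine (norm_fderiv_le_of_forall_closedBall_norm_le hρ (le_max_right M 0)
      (fun x hx => hd x (hsub hx)) (fun x hx => hb x (hsub hx))).trans ?_
    have : 0 ≤ max M 0 / (δ / 3) / (δ / 3) := by positivity
    linarith
  · refine (norm_sub_sub_fderiv_le hρ (le_max_right M 0) hd hb hz hw).trans ?_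
    gcongr
    have : 0 ≤ max M 0 / (δ / 3) := by positivity
    linarith

lemma HasUniformLocalExt.comp {ρ K : ℝ} (hρ : 0 < ρ) (hK : 0 ≤ K) :
    ∃ ρ' > 0, ∃ K' ≥ 0, ∀ (D : Set E) (f g : E → E), HasUniformLocalExt D ρ K f →
      HasUniformLocalExt D ρ K g → MapsTo f D D → HasUniformLocalExt D ρ' K' (g ∘ f) := by
  set C := K + K * (ρ + ρ) with hC
  have hC0 : 0 ≤ C := by positivity
  refine ⟨ρ / (1 + C), by positivity, K * C * C + K * K, by positivity, ?_⟩
  intro D f g hf hg hfD p hp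
  obtain ⟨F, A, hA, hF, hFA⟩ := hf p hp
  obtain ⟨G, B, hB, hG, hGB⟩ := hg (f p) (hfD hp)
  have hlip : ∀ z ∈ ball p ρ, ∀ w ∈ ball p ρ, ‖F z - F w‖ ≤ C * ‖z - w‖ := by
    intro z hz w hw
    have h1 := hFA z hz w hw
    rw [mem_ball, dist_eq_norm] at hz hw
    calc ‖F z - F w‖ = ‖(F z - F w - A (z - w)) + A (z - w)‖ := by rw [sub_add_cancel]
      _ ≤ ‖F z - F w - A (z - w)‖ + ‖A (z - w)‖ := norm_add_le _ _
      _ ≤ K * (‖z - p‖ + ‖w - p‖) * ‖z - w‖ + K * ‖z - w‖ :=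
        add_le_add h1 (A.le_of_opNorm_le hA _)
      _ ≤ K * (ρ + ρ) * ‖z - w‖ + K * ‖z - w‖ := by gcongr
      _ = C * ‖z - w‖ := by rw [hC]; ring
  have hpρ : p ∈ ball p ρ := mem_ball_self hρ
  have hle : ρ / (1 + C) ≤ ρ := div_le_self hρ.le (by linarith)
  have hFp : F p = f p := hF p hp hpρ
  have hFlip : ∀ z ∈ ball p ρ, ‖F z - f p‖ ≤ C * ‖z - p‖ := fun z hz => by
    rw [← hFp]; exact hlip z hz p hpρ
  have hmap : ∀ z ∈ ball p (ρ / (1 + C)), F z ∈ ball (f p) ρ := by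
    intro z hz
    have h1 := hFlip z (ball_subset_ball hle hz)
    rw [mem_ball, dist_eq_norm] at hz ⊢
    rw [lt_div_iff₀ (by positivity)] at hz
    nlinarith [norm_nonneg (z - p)]
  refine ⟨G ∘ F, B.comp A, ?_, ?_, ?_⟩
  · calc ‖B.comp A‖ ≤ ‖B‖ * ‖A‖ := B.opNorm_comp_le A
      _ ≤ K * K := by gcongr
      _ ≤ _ := by linarith [show 0 ≤ K * C * C by positivity]
  · intro z hz hzp
    have h1 : F z = f z := hF z hz (ball_subset_ball hle hzp)
    have h2 := hmap z hzp
    rw [h1] at h2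
    simp only [Function.comp_apply, h1]
    exact hG _ (hfD hz) h2
  · intro z hz w hw
    have hz' := ball_subset_ball hle hz
    have hw' := ball_subset_ball hle hw
    calc ‖(G ∘ F) z - (G ∘ F) w - (B.comp A) (z - w)‖
        = ‖(G (F z) - G (F w) - B (F z - F w)) + B (F z - F w - A (z - w))‖ := by
          congr 1; simp only [Function.comp_apply, ContinuousLinearMap.comp_apply, map_sub]; abel
      _ ≤ ‖G (F z) - G (F w) - B (F z - F w)‖ + ‖B (F z - F w - A (z - w))‖ := norm_add_le _ _
      _ ≤ K * (‖F z - f p‖ + ‖F w - f p‖) * ‖F z - F w‖ + K * ‖F z - F w - A (z - w)‖ :=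
        add_le_add (hGB _ (hmap z hz) _ (hmap w hw)) (B.le_of_opNorm_le hB _)
      _ ≤ K * (C * ‖z - p‖ + C * ‖w - p‖) * (C * ‖z - w‖) +
          K * (K * (‖z - p‖ + ‖w - p‖) * ‖z - w‖) := by
        gcongr
        · exact hFlip z hz'
        · exact hFlip w hw'
        · exact hlip z hz' w hw'
        · exact hFA z hz' w hw'
      _ = _ := by ring

lemma exists_tendsto_hyperfilter_of_norm_le {X : Type*} [NormedAddCommGroup X] [ProperSpace X]
    {u : ℕ → X} {C : ℝ} (hu : ∀ j, ‖u j‖ ≤ C) :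
    ∃ x, Tendsto u (hyperfilter ℕ : Filter ℕ) (𝓝 x) := by
  obtain ⟨x, -, hx⟩ := (isCompact_closedBall (0 : X) C).ultrafilter_le_nhds
    ((hyperfilter ℕ).map u) (le_principal_iff.2 (mem_map.2 (univ_mem' fun j => by
      simpa using hu j)))
  exact ⟨x, hx⟩

lemma hyperfilter_le_atTop_nat : (hyperfilter ℕ : Filter ℕ) ≤ atTop :=
  Nat.cofinite_eq_atTop ▸ hyperfilter_le_cofinite

lemma HasUniformLocalExt.of_tendsto [FiniteDimensional ℂ E] {D : Set E} {ρ K : ℝ} (hρ : 0 < ρ)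
    {u : ℕ → E → E} {f : E → E} (hu : ∀ j, HasUniformLocalExt D ρ K (u j))
    (hlim : ∀ z ∈ D, Tendsto (fun j => u j z) atTop (𝓝 (f z))) :
    HasUniformLocalExt D ρ K f := by
  have : ProperSpace E := FiniteDimensional.proper ℂ E
  have : ProperSpace (E →L[ℂ] E) := FiniteDimensional.proper ℂ _
  intro p hp
  choose F A hA hF hFA using fun j => hu j p hp
  have hK : 0 ≤ K := (norm_nonneg _).trans (hA 0)
  have hpρ : p ∈ ball p ρ := mem_ball_self hρ
  obtain ⟨A', hA'⟩ := exists_tendsto_hyperfilter_of_norm_le hA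
  have hex : ∀ z, ∃ y, z ∈ ball p ρ → Tendsto (fun j => F j z) (hyperfilter ℕ : Filter ℕ) (𝓝 y) := by
    intro z
    by_cases hz : z ∈ ball p ρ
    · have hbd : ∀ j, ‖F j z - F j p‖ ≤ K * (‖z - p‖ + ‖p - p‖) * ‖z - p‖ + K * ‖z - p‖ := by
        intro j
        calc ‖F j z - F j p‖ = ‖(F j z - F j p - A j (z - p)) + A j (z - p)‖ := by
              rw [sub_add_cancel]
          _ ≤ _ := norm_add_le _ _
          _ ≤ _ := add_le_add (hFA j z hz p hpρ) ((A j).le_of_opNorm_le (hA j) _)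
      obtain ⟨y, hy⟩ := exists_tendsto_hyperfilter_of_norm_le hbd
      refine ⟨y + f p, fun _ => ?_⟩
      have h2 := hy.add ((hlim p hp).mono_left hyperfilter_le_atTop_nat)
      refine h2.congr fun j => ?_
      rw [hF j p hp hpρ, sub_add_cancel]
    · exact ⟨0, fun h => absurd h hz⟩
  choose G hG using hex
  refine ⟨G, A', le_of_tendsto hA'.norm (Eventually.of_forall hA), ?_, ?_⟩
  · intro z hz hzp
    refine tendsto_nhds_unique (hG z hzp) ?_
    exact ((hlim z hz).mono_left hyperfilter_le_atTop_nat).congr fun j => (hF j z hz hzp).symm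
  · intro z hz w hw
    have h1 : Tendsto (fun j => A j (z - w)) (hyperfilter ℕ : Filter ℕ) (𝓝 (A' (z - w))) :=
      ((ContinuousLinearMap.apply ℂ E (z - w)).continuous.tendsto A').comp hA'
    exact le_of_tendsto (((hG z hz).sub (hG w hw)).sub h1).norm
      (Eventually.of_forall fun j => hFA j z hz w hw)

lemma HasUniformLocalExt.exists_of_hasFDerivAt {D : Set E} (hD : IsOpen D) {ρ K : ℝ} (hρ : 0 < ρ)
    {f : E → E} (h : HasUniformLocalExt D ρ K f) {p : E} (hp : p ∈ D) {A : E →L[ℂ] E}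
    (hfA : HasFDerivAt f A p) :
    ‖A‖ ≤ K ∧ ∃ F : E → E, (∀ z ∈ D, z ∈ ball p ρ → F z = f z) ∧
      ∀ z ∈ ball p ρ, ∀ w ∈ ball p ρ,
        ‖F z - F w - A (z - w)‖ ≤ K * (‖z - p‖ + ‖w - p‖) * ‖z - w‖ := by
  obtain ⟨F, A', hA', hF, hFA⟩ := h p hp
  have hpρ : p ∈ ball p ρ := mem_ball_self hρ
  have hder : HasFDerivAt f A' p := by
    rw [hasFDerivAt_iff_isLittleO]
    have hO : (fun z => f z - f p - A' (z - p)) =O[𝓝 p] fun z => ‖z - p‖ ^ 2 := by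
      refine Asymptotics.IsBigO.of_bound K ?_
      filter_upwards [hD.mem_nhds hp, ball_mem_nhds p hρ] with z hz hzp
      have := hFA z hzp p hpρ
      rw [hF z hz hzp, hF p hp hpρ] at this
      refine this.trans (le_of_eq ?_)
      simp
      ring
    refine hO.trans_isLittleO ?_
    have h0 : Tendsto (fun z : E => z - p) (𝓝 p) (𝓝 0) :=
      tendsto_sub_nhds_zero_iff.2 tendsto_id
    simpa [Function.comp_def] using
      (Asymptotics.isLittleO_norm_pow_id (E' := E) one_lt_two).comp_tendsto h0
  obtain rfl := hder.unique hfA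
  exact ⟨hA', F, hF, hFA⟩

end Extension

section Linearization

variable {E : Type*} [NormedAddCommGroup E] [NormedSpace ℂ E]

/-- A map conjugating `f` to its differential `A` near the fixed point `p`: it is a limit of the
averages of `A⁻ᵏ (fᵏ - p)`. -/
lemma exists_linearization [FiniteDimensional ℂ E] {D : Set E} (hD : IsOpen D) {ρ K r : ℝ}
    (hr : 0 < r) (hrρ : r ≤ ρ) (hrK : 4 * K ^ 2 * r ≤ 1) {f : E → E} (hfD : MapsTo f D D)
    (hf : ∀ k, HasUniformLocalExt D ρ K f^[k]) {p : E} (hp : p ∈ D) (hfp : f p = p)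
    {A B : E →L[ℂ] E} (hA : HasFDerivAt f A p) (hBA : B * A = 1) (hAB : A * B = 1)
    (hB : ∀ k, ‖B ^ k‖ ≤ K) :
    ∃ L : E → E, L p = 0 ∧
      (∀ z ∈ ball p r, ∀ w ∈ ball p r, ‖L z - L w - (z - w)‖ ≤ 1 / 2 * ‖z - w‖) ∧
      ∀ z ∈ D, z ∈ ball p r → f z ∈ ball p r → L (f z) = A (L z) := by
  have : ProperSpace E := FiniteDimensional.proper ℂ E
  have hρ : 0 < ρ := hr.trans_le hrρ
  choose hAk F hF hFA using fun k => (hf k).exists_of_hasFDerivAt hD hρ hp (hA.iterate hfp k)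
  have hK : 0 ≤ K := (norm_nonneg _).trans (hB 0)
  have hcomm : Commute B A := hBA.trans hAB.symm
  have hBAk : ∀ k x, (B ^ k) ((A ^ k) x) = x := fun k x => by
    rw [← mul_apply_eq_comp, ← hcomm.mul_pow, hBA, one_pow,
      one_apply_eq_self]
  have hpr : p ∈ ball p r := mem_ball_self hr
  have hsub : ball p r ⊆ ball p ρ := ball_subset_ball hrρ
  have hiter : ∀ k, ∀ z ∈ D, f^[k] z ∈ D := fun k z hz => hfD.iterate k hz
  set T : ℕ → E → E := fun k z => (B ^ k) (F k z - p) with hT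
  have hTp : ∀ k, T k p = 0 := fun k => by
    simp only [hT, hF k p hp (hsub hpr), Function.iterate_fixed hfp, sub_self, map_zero]
  have hTlip : ∀ k, ∀ z ∈ ball p r, ∀ w ∈ ball p r,
      ‖T k z - T k w - (z - w)‖ ≤ 1 / 2 * ‖z - w‖ := by
    intro k z hz w hw
    have h1 := hFA k z (hsub hz) w (hsub hw)
    have h2 : T k z - T k w - (z - w) = (B ^ k) (F k z - F k w - (A ^ k) (z - w)) := by
      rw [map_sub (B ^ k) (F k z - F k w), hBAk, ← sub_sub_sub_cancel_right (F k z) (F k w) p,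
        map_sub (B ^ k)]
    rw [mem_ball, dist_eq_norm] at hz hw
    rw [h2]
    calc _ ≤ K * (K * (‖z - p‖ + ‖w - p‖) * ‖z - w‖) :=
          ((B ^ k).le_of_opNorm_le (hB k) _).trans (by gcongr)
      _ ≤ K * (K * (r + r) * ‖z - w‖) := by gcongr
      _ = (2 * K ^ 2 * r) * ‖z - w‖ := by ring
      _ ≤ 1 / 2 * ‖z - w‖ := by gcongr; linarith
  have hTb : ∀ k, ∀ z ∈ ball p r, ‖T k z‖ ≤ 2 * r := by
    intro k z hz
    have h1 := hTlip k z hz p hpr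
    rw [hTp, sub_zero] at h1
    rw [mem_ball, dist_eq_norm] at hz
    have h2 := norm_sub_norm_le (T k z) (z - p)
    linarith
  set S : ℕ → E → E := fun N z => ((N + 1 : ℕ) : ℂ)⁻¹ • ∑ k ∈ Finset.range (N + 1), T k z with hS
  have hnorm : ∀ (N : ℕ) (x : E), ‖((N + 1 : ℕ) : ℂ)⁻¹ • x‖ = ((N : ℝ) + 1)⁻¹ * ‖x‖ := by
    intro N x
    rw [norm_smul, norm_inv, Complex.norm_natCast]
    push_cast
    rfl
  have havg : ∀ (N : ℕ) (v : ℕ → E) (c : ℝ), (∀ k, ‖v k‖ ≤ c) →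
      ‖((N + 1 : ℕ) : ℂ)⁻¹ • ∑ k ∈ Finset.range (N + 1), v k‖ ≤ c := by
    intro N v c hv
    rw [hnorm, inv_mul_le_iff₀ (by positivity)]
    refine (norm_sum_le_of_le _ fun k _ => hv k).trans (le_of_eq ?_)
    simp
  have hex : ∀ z, ∃ y, z ∈ ball p r →
      Tendsto (fun N => S N z) (hyperfilter ℕ : Filter ℕ) (𝓝 y) := by
    intro z
    by_cases hz : z ∈ ball p r
    · obtain ⟨y, hy⟩ := exists_tendsto_hyperfilter_of_norm_le (C := 2 * r)
        (u := fun N => S N z) fun N => havg N _ _ fun k => hTb k z hz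
      exact ⟨y, fun _ => hy⟩
    · exact ⟨0, fun h => absurd h hz⟩
  choose L hL using hex
  refine ⟨L, ?_, ?_, ?_⟩
  · refine tendsto_nhds_unique (hL p hpr) ?_
    simp [hS, hTp]
  · intro z hz w hw
    refine le_of_tendsto (((hL z hz).sub (hL w hw)).sub_const (z - w)).norm
      (Eventually.of_forall fun N => ?_)
    have h1 : S N z - S N w - (z - w) = ((N + 1 : ℕ) : ℂ)⁻¹ •
        ∑ k ∈ Finset.range (N + 1), (T k z - T k w - (z - w)) := by
      rw [Finset.sum_sub_distrib, Finset.sum_sub_distrib, Finset.sum_const, Finset.card_range,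
        smul_sub, smul_sub, ← Nat.cast_smul_eq_nsmul ℂ, smul_smul,
        inv_mul_cancel₀ (Nat.cast_ne_zero.2 N.succ_ne_zero), one_smul]
    rw [h1]
    exact havg N _ _ fun k => hTlip k z hz w hw
  · intro z hz hzr hfzr
    have hstep : ∀ k, B (T k (f z)) = T (k + 1) z := by
      intro k
      simp only [hT]
      rw [hF k _ (hfD hz) (hsub hfzr), hF (k + 1) _ hz (hsub hzr), Function.iterate_succ_apply,
        pow_succ', mul_apply_eq_comp]
    have hdiff : ∀ N, B (S N (f z)) - S N z =
        ((N + 1 : ℕ) : ℂ)⁻¹ • (T (N + 1) z - T 0 z) := by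
      intro N
      simp only [hS]
      rw [map_smul, map_sum, ← smul_sub, ← Finset.sum_sub_distrib]
      simp only [hstep]
      rw [Finset.sum_range_sub (fun k => T k z)]
    have hzero : Tendsto (fun N => B (S N (f z)) - S N z) atTop (𝓝 0) := by
      refine squeeze_zero_norm (a := fun N : ℕ => 4 * r * (1 / ((N : ℝ) + 1))) (fun N => ?_) ?_
      · rw [hdiff, hnorm]
        have h3 : ‖T (N + 1) z - T 0 z‖ ≤ 4 * r :=
          (norm_sub_le _ _).trans (by linarith [hTb (N + 1) z hzr, hTb 0 z hzr])
        calc _ ≤ ((N : ℝ) + 1)⁻¹ * (4 * r) := by gcongr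
          _ = _ := by ring
      · simpa using tendsto_one_div_add_atTop_nhds_zero_nat.const_mul (4 * r)
    have hBL : B (L (f z)) = L z := by
      have h4 := ((B.continuous.tendsto _).comp (hL _ hfzr)).sub (hL z hzr)
      exact sub_eq_zero.1 (tendsto_nhds_unique h4 (hzero.mono_left hyperfilter_le_atTop_nat))
    rw [← hBL, ← mul_apply_eq_comp, hAB, one_apply_eq_self]

lemma frequently_fixed_of_linearization [CompleteSpace E] {D : Set E} (hD : IsOpen D) {r : ℝ}
    (hr : 0 < r) {f : E → E} {p q : E} (hp : p ∈ D) (hfp : f p = p) (hq : q ∈ D) (hfq : f q = q)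
    (hqp : q ≠ p) (hqr : q ∈ ball p r) (hfc : ContinuousAt f p) {A : E →L[ℂ] E} {L : E → E}
    (hLp : L p = 0)
    (hL : ∀ z ∈ ball p r, ∀ w ∈ ball p r, ‖L z - L w - (z - w)‖ ≤ 1 / 2 * ‖z - w‖)
    (hLf : ∀ z ∈ D, z ∈ ball p r → f z ∈ ball p r → L (f z) = A (L z)) :
    ∃ᶠ z in 𝓝[≠] p, f z = z := by
  have hpr : p ∈ ball p r := mem_ball_self hr
  have hinj : InjOn L (ball p r) := by
    intro z hz w hw h
    have h1 := hL z hz w hw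
    rw [h, sub_self, zero_sub, norm_neg] at h1
    have h2 := norm_nonneg (z - w)
    exact sub_eq_zero.1 (norm_eq_zero.1 (by linarith))
  have hAq : A (L q) = L q := by
    rw [← hLf q hq hqr (by rwa [hfq]), hfq]
  have hLq : L q ≠ 0 := fun h => hqp (hinj hqr hpr (h.trans hLp.symm))
  have happ : ApproximatesLinearOn L
      ((ContinuousLinearEquiv.refl ℂ E : E ≃L[ℂ] E) : E →L[ℂ] E) (ball p r) (1 / 2) := by
    intro z hz w hw
    simpa using hL z hz w hw
  have hc : Subsingleton E ∨
      (1 / 2 : NNReal) < ‖((ContinuousLinearEquiv.refl ℂ E).symm : E →L[ℂ] E)‖₊⁻¹ := by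
    right
    have hne : Nontrivial E := ⟨⟨q, p, hqp⟩⟩
    have h1 : ‖((ContinuousLinearEquiv.refl ℂ E).symm : E →L[ℂ] E)‖₊ = 1 :=
      NNReal.eq (ContinuousLinearMap.norm_id (𝕜 := ℂ) (E := E))
    rw [h1, inv_one]
    exact NNReal.half_lt_self one_ne_zero
  rw [frequently_nhdsWithin_iff, frequently_iff]
  intro U hU
  set s := U ∩ D ∩ ball p r ∩ f ⁻¹' ball p r with hs
  have hsp : s ∈ 𝓝 p := by
    refine inter_mem (inter_mem (inter_mem hU (hD.mem_nhds hp)) (ball_mem_nhds p hr)) ?_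
    exact hfc.preimage_mem_nhds (by rw [hfp]; exact ball_mem_nhds p hr)
  have himg : L '' s ∈ 𝓝 (0 : E) := by
    rw [← hLp]
    exact (happ.mono_set fun z hz => hz.1.2).image_mem_nhds
      (ContinuousLinearEquiv.refl ℂ E).toNonlinearRightInverse hsp hc
  have htend : Tendsto (fun t : ℂ => t • L q) (𝓝[≠] 0) (𝓝 0) := by
    have : Tendsto (fun t : ℂ => t • L q) (𝓝 0) (𝓝 ((0 : ℂ) • L q)) :=
      tendsto_id.smul_const _
    rw [zero_smul] at this
    exact this.mono_left nhdsWithin_le_nhds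
  obtain ⟨t, ⟨z, hz, hzt⟩, ht⟩ := ((htend.eventually_mem himg).and self_mem_nhdsWithin).exists
  obtain ⟨⟨⟨hzU, hzD⟩, hzr⟩, hfzr⟩ := hz
  refine ⟨z, hzU, hinj hfzr hzr ?_, ?_⟩
  · rw [hLf z hzD hzr hfzr, hzt, map_smul, hAq]
  · rintro rfl
    rw [hLp] at hzt
    exact smul_ne_zero ht hLq hzt.symm

end Linearization

section Baire

variable {E : Type*} [NormedAddCommGroup E]

/-- A countable union of conditions that are closed under pointwise limits and exhaust a compact
group of homeomorphisms of `D`: one of them holds on a set having finitely many left translates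
covering the group. -/
lemma exists_finite_translates [SecondCountableTopology E] {D : Set E} {H : Set (E → E)}
    (hcont : ∀ f ∈ H, ContinuousOn f D) (hmaps : ∀ f ∈ H, MapsTo f D D) (hne : H.Nonempty)
    (hmul : ∀ f ∈ H, ∀ g ∈ H, ∃ h ∈ H, ∀ z ∈ D, h z = f (g z))
    (hinv : ∀ f ∈ H, ∃ g ∈ H, (∀ z ∈ D, g (f z) = z) ∧ (∀ z ∈ D, f (g z) = z))
    (hcpt : ∀ u : ℕ → E → E, (∀ k, u k ∈ H) → ∃ φ : ℕ → ℕ, StrictMono φ ∧ ∃ f ∈ H,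
      ∀ z ∈ D, Tendsto (fun k => u (φ k) z) atTop (𝓝 (f z)))
    {P : ℕ → (E → E) → Prop} (hP : ∀ f ∈ H, ∃ k, P k f)
    (hPcongr : ∀ k f g, (∀ z ∈ D, f z = g z) → P k f → P k g)
    (hPlim : ∀ k (u : ℕ → E → E) (f : E → E), (∀ j, P k (u j)) →
      (∀ z ∈ D, Tendsto (fun j => u j z) atTop (𝓝 (f z))) → P k f) :
    ∃ k, ∃ S : Finset (E → E), (∀ h ∈ S, h ∈ H) ∧
      ∀ f ∈ H, ∃ h ∈ S, ∃ u ∈ H, P k u ∧ ∀ z ∈ D, f z = h (u z) := by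
  rcases D.eq_empty_or_nonempty with rfl | hDne
  · obtain ⟨e, he⟩ := hne
    obtain ⟨k, hk⟩ := hP e he
    exact ⟨k, {e}, by simpa using he, fun f hf => ⟨e, by simp, e, he, hk, by simp⟩⟩
  have : Nonempty D := hDne.to_subtype
  let d : ℕ → D := TopologicalSpace.denseSeq D
  let Φ : (E → E) → ℕ → E := fun f i => f (d i)
  have hΦ : ∀ f ∈ H, ∀ g ∈ H, Φ f = Φ g → ∀ z ∈ D, f z = g z := by
    intro f hf g hg h z hz
    have h1 : D.domRestrict f = D.domRestrict g := by
      refine Continuous.ext_on (TopologicalSpace.denseRange_denseSeq D)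
        (hcont f hf).domRestrict (hcont g hg).domRestrict ?_
      rintro _ ⟨i, rfl⟩
      exact congrFun h i
    exact congrFun h1 ⟨z, hz⟩
  have hX : IsCompact (Φ '' H) := by
    refine IsSeqCompact.isCompact fun x hx => ?_
    choose u hu hux using hx
    obtain ⟨φ, hφ, f, hf, hlim⟩ := hcpt u hu
    refine ⟨Φ f, mem_image_of_mem _ hf, φ, hφ, tendsto_pi_nhds.2 fun i => ?_⟩
    refine (hlim (d i) (d i).2).congr fun k => ?_
    simp only [Function.comp_apply, ← hux, Φ]
  let X := ↥(Φ '' H)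
  have : CompactSpace X := isCompact_iff_compactSpace.1 hX
  have : Nonempty X := (hne.image Φ).to_subtype
  let C : ℕ → Set X := fun k => {x | ∃ f ∈ H, Φ f = x ∧ P k f}
  have hC : ∀ k, IsClosed (C k) := by
    intro k
    refine IsSeqClosed.isClosed fun x y hx hxy => ?_
    choose u hu hux hPu using hx
    obtain ⟨φ, hφ, f, hf, hlim⟩ := hcpt u hu
    refine ⟨f, hf, ?_, hPlim k _ f (fun j => hPu (φ j)) hlim⟩
    funext i
    have h1 : Tendsto (fun j => (x (φ j) : ℕ → E) i) atTop (𝓝 ((y : ℕ → E) i)) :=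
      (((continuous_apply i).comp continuous_subtype_val).tendsto y).comp
        (hxy.comp hφ.tendsto_atTop)
    refine tendsto_nhds_unique (hlim (d i) (d i).2) (h1.congr fun j => ?_)
    rw [← hux]
  have hCU : ⋃ k, C k = univ := by
    refine eq_univ_of_forall ?_
    rintro ⟨_, f, hf, rfl⟩
    obtain ⟨k, hk⟩ := hP f hf
    exact mem_iUnion.2 ⟨k, f, hf, rfl, hk⟩
  obtain ⟨k, x₀, hx₀⟩ := nonempty_interior_of_iUnion_of_closed hC hCU
  choose inv hinvH hinv1 hinv2 using fun h : H => hinv h h.2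
  have hval : ∀ x : X, ∀ i, (x : ℕ → E) i ∈ D := by
    rintro ⟨_, f, hf, rfl⟩ i
    exact hmaps f hf (d i).2
  let τ : H → X → X := fun h x => ⟨fun i => inv h ((x : ℕ → E) i), by
    obtain ⟨_, f, hf, rfl⟩ := x
    obtain ⟨g, hg, hgf⟩ := hmul _ (hinvH h) f hf
    exact ⟨g, hg, funext fun i => hgf _ (d i).2⟩⟩
  have hτ : ∀ h, Continuous (τ h) := fun h => by
    refine Continuous.subtype_mk (continuous_pi fun i => ?_) _
    exact (hcont _ (hinvH h)).comp_continuous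
      ((continuous_apply i).comp continuous_subtype_val) fun x => hval x i
  have hcover : (univ : Set X) ⊆ ⋃ h : H, τ h ⁻¹' interior (C k) := by
    rintro ⟨_, f, hf, rfl⟩ -
    obtain ⟨u, hu, hux, -⟩ := interior_subset hx₀
    obtain ⟨u', hu', hu1, hu2⟩ := hinv u hu
    obtain ⟨h, hh, hhf⟩ := hmul f hf u' hu'
    refine mem_iUnion.2 ⟨⟨h, hh⟩, ?_⟩
    have h1 : τ ⟨h, hh⟩ ⟨Φ f, f, hf, rfl⟩ = x₀ := by
      refine Subtype.ext (funext fun i => ?_)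
      have hdi := (d i).2
      have h2 : f (d i) = h (u (d i)) := by
        rw [hhf _ (hmaps u hu hdi), hu1 _ hdi]
      change inv ⟨h, hh⟩ (f (d i)) = _
      rw [h2, ← hux]
      exact hinv1 ⟨h, hh⟩ _ (hmaps u hu hdi)
    rwa [mem_preimage, h1]
  obtain ⟨t, ht⟩ := isCompact_univ.elim_finite_subcover _
    (fun h => isOpen_interior.preimage (hτ h)) hcover
  classical
  refine ⟨k, t.image Subtype.val, by simp +contextual, fun f hf => ?_⟩
  obtain ⟨h, hht, hh⟩ := mem_iUnion₂.1 (ht (mem_univ (⟨Φ f, f, hf, rfl⟩ : X)))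
  obtain ⟨u, hu, hux, hPu⟩ := interior_subset hh
  obtain ⟨g, hg, hgf⟩ := hmul _ (hinvH h) f hf
  refine ⟨h, Finset.mem_image_of_mem _ hht, u, hu, hPu, fun z hz => ?_⟩
  have h3 : ∀ z ∈ D, u z = g z := hΦ u hu g hg (by
    rw [hux]
    exact funext fun i => (hgf _ (d i).2).symm)
  rw [h3 z hz, hgf z hz, hinv2 h _ (hmaps f hf hz)]

lemma exists_ncard_le_of_separated {X : Type*} [PseudoMetricSpace X] {D : Set X}
    (hD : TotallyBounded D) {r : ℝ} (hr : 0 < r) :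
    ∃ m : ℕ, ∀ S ⊆ D, (∀ x ∈ S, ∀ y ∈ S, x ≠ y → r ≤ dist x y) → S.Finite ∧ S.ncard ≤ m := by
  obtain ⟨t, ht, hDt⟩ := totallyBounded_iff.1 hD (r / 2) (half_pos hr)
  refine ⟨t.ncard, fun S hS hsep => ?_⟩
  have hex : ∀ x ∈ S, ∃ y ∈ t, dist x y < r / 2 := fun x hx => by
    simpa using hDt (hS hx)
  choose! c hct hc using hex
  have hinj : InjOn c S := by
    intro x hx y hy hxy
    by_contra hne
    have h1 := hc x hx
    have h2 := hc y hy
    rw [← hxy] at h2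
    linarith [hsep x hx y hy hne, dist_triangle_right x y (c x)]
  exact ⟨Finite.of_injOn hct hinj ht, ncard_le_ncard_of_injOn c hct hinj ht⟩

end Baire

lemma exists_hasUniformLocalExt_of_compact_group {E : Type*} [NormedAddCommGroup E]
    [NormedSpace ℂ E] [FiniteDimensional ℂ E] {D : Set E} {H : Set (E → E)}
    (hmaps : ∀ f ∈ H, MapsTo f D D) (hne : H.Nonempty)
    (hmul : ∀ f ∈ H, ∀ g ∈ H, ∃ h ∈ H, ∀ z ∈ D, h z = f (g z))
    (hinv : ∀ f ∈ H, ∃ g ∈ H, (∀ z ∈ D, g (f z) = z) ∧ (∀ z ∈ D, f (g z) = z))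
    (hcont : ∀ f ∈ H, ContinuousOn f D)
    (hcpt : ∀ u : ℕ → E → E, (∀ k, u k ∈ H) → ∃ φ : ℕ → ℕ, StrictMono φ ∧ ∃ f ∈ H,
      ∀ z ∈ D, Tendsto (fun k => u (φ k) z) atTop (𝓝 (f z)))
    (hext : ∀ f ∈ H, ∃ ρ > 0, ∃ K, HasUniformLocalExt D ρ K f) :
    ∃ ρ > 0, ∃ K, ∀ f ∈ H, HasUniformLocalExt D ρ K f := by
  have : ProperSpace E := FiniteDimensional.proper ℂ E
  let P : ℕ → (E → E) → Prop := fun k f => HasUniformLocalExt D (1 / ((k : ℝ) + 1)) k f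
  have hPmono : ∀ {k l f}, k ≤ l → P k f → P l f := fun {k l f} hkl h =>
    HasUniformLocalExt.mono h (by gcongr) (by exact_mod_cast hkl)
  have hP : ∀ f ∈ H, ∃ k, P k f := by
    intro f hf
    obtain ⟨ρ, hρ, K, h⟩ := hext f hf
    obtain ⟨k, hk⟩ := exists_nat_one_div_lt hρ
    obtain ⟨l, hl⟩ := exists_nat_ge K
    refine ⟨max k l, HasUniformLocalExt.mono h ?_ ?_⟩
    · refine le_trans ?_ hk.le
      gcongr
      exact le_max_left k l
    · exact hl.trans (by exact_mod_cast le_max_right k l)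
  obtain ⟨k, S, hS, hcov⟩ := exists_finite_translates hcont hmaps hne hmul hinv hcpt hP
    (fun k f g hfg h => HasUniformLocalExt.congr h fun z hz => (hfg z hz).symm)
    (fun k u f hu hlim => HasUniformLocalExt.of_tendsto (by positivity) hu hlim)
  choose! κ hκ using fun h (hh : h ∈ S) => hP h (hS h hh)
  set N := max k (S.sup κ) with hN
  obtain ⟨ρ, hρ, K, -, hcomp⟩ := HasUniformLocalExt.comp (E := E)
    (ρ := 1 / ((N : ℝ) + 1)) (K := N) (by positivity) (by positivity)
  refine ⟨ρ, hρ, K, fun f hf => ?_⟩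
  obtain ⟨h, hh, u, hu, hPu, hfu⟩ := hcov f hf
  exact (hcomp D u h (hPmono (le_max_left _ _) hPu)
    (hPmono ((Finset.le_sup hh).trans (le_max_right _ _)) (hκ h hh)) (hmaps u hu)).congr hfu

theorem uniform_bound_of_compact_subgroup {n : ℕ} (D : Set (CSpace n))
    (hDopen : IsOpen D) (hDconn : IsConnected D) (hDbdd : Bornology.IsBounded D)
    (H : Set (CSpace n → CSpace n)) (hH : IsCompactAutGroup D H)
    (hext : ∀ f ∈ H, ExtendsHolo D f) :
    ∃ m : ℕ, ∀ f ∈ H, DiscreteIn (FixOn D f) →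
      (FixOn D f).Finite ∧ (FixOn D f).ncard ≤ m := by
  obtain ⟨haut, ⟨e, he, hid⟩, hmul, hinv, hcpt⟩ := hH
  have hmaps : ∀ f ∈ H, MapsTo f D D := fun f hf => (haut f hf).2.1.mapsTo
  obtain ⟨ρ, hρ, K, hHext⟩ :=
    exists_hasUniformLocalExt_of_compact_group hmaps ⟨e, he⟩ hmul hinv
      (fun f hf => (haut f hf).1.continuousOn) (fun u hu => by
        obtain ⟨φ, hφ, f, hf, hlim⟩ := hcpt u hu
        exact ⟨φ, hφ, f, hf, fun z hz => (hlim {z} (singleton_subset_iff.2 hz)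
          isCompact_singleton).tendsto_at (mem_singleton z)⟩)
      (fun f hf => by
        obtain ⟨U, hU, hDU, F, hF, hFf⟩ := hext f hf
        exact HasUniformLocalExt.of_differentiableOn hDbdd hU hDU hF hFf)
  have hiter : ∀ f ∈ H, ∀ k, HasUniformLocalExt D ρ K f^[k] := by
    intro f hf k
    have : ∃ h ∈ H, ∀ z ∈ D, f^[k] z = h z := by
      induction k with
      | zero => exact ⟨e, he, fun z hz => (hid z hz).symm⟩
      | succ k ih =>
        obtain ⟨h, hh, hfh⟩ := ih
        obtain ⟨h', hh', hfh'⟩ := hmul f hf h hh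
        exact ⟨h', hh', fun z hz => by
          rw [Function.iterate_succ_apply', hfh z hz, hfh' z hz]⟩
    obtain ⟨h, hh, hfh⟩ := this
    exact (hHext h hh).congr hfh
  have hr : 0 < min ρ (1 / (4 * K ^ 2 + 1)) := lt_min hρ (by positivity)
  set r := min ρ (1 / (4 * K ^ 2 + 1)) with hrdef
  have hrK : 4 * K ^ 2 * r ≤ 1 := by
    have h1 : r ≤ 1 / (4 * K ^ 2 + 1) := min_le_right _ _
    rw [le_div_iff₀ (by positivity)] at h1
    nlinarith
  obtain ⟨m, hm⟩ := exists_ncard_le_of_separated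
    (hDbdd.isCompact_closure.totallyBounded.subset subset_closure) hr
  refine ⟨m, fun f hf hdisc => hm _ (fun z hz => hz.1) fun q hq p hp hqp => ?_⟩
  by_contra! hlt
  obtain ⟨hpD, hfp⟩ := hp
  obtain ⟨hqD, hfq⟩ := hq
  obtain ⟨g, hg, hgf, hfg⟩ := hinv f hf
  have hgp : g p = p := by
    have := hgf p hpD
    rwa [hfp] at this
  have hA : HasFDerivAt f (fderiv ℂ f p) p :=
    ((haut f hf).1.differentiableAt (hDopen.mem_nhds hpD)).hasFDerivAt
  have hB : HasFDerivAt g (fderiv ℂ g p) p :=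
    ((haut g hg).1.differentiableAt (hDopen.mem_nhds hpD)).hasFDerivAt
  have hBA : fderiv ℂ g p * fderiv ℂ f p = 1 := by
    refine (HasFDerivAt.comp p (by rwa [hfp]) hA).unique
      ((hasFDerivAt_id p).congr_of_eventuallyEq ?_)
    filter_upwards [hDopen.mem_nhds hpD] with z hz using hgf z hz
  have hAB : fderiv ℂ f p * fderiv ℂ g p = 1 := by
    refine (HasFDerivAt.comp p (by rwa [hgp]) hB).unique
      ((hasFDerivAt_id p).congr_of_eventuallyEq ?_)
    filter_upwards [hDopen.mem_nhds hpD] with z hz using hfg z hz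
  obtain ⟨L, hLp, hL, hLf⟩ := exists_linearization hDopen hr (min_le_left _ _) hrK
    (hmaps f hf) (hiter f hf) hpD hfp hA hBA hAB fun k =>
      ((hiter g hg k).exists_of_hasFDerivAt hDopen hρ hpD (hB.iterate hgp k)).1
  have hfreq := frequently_fixed_of_linearization hDopen hr hpD hfp hqD hfq hqp hlt
    hA.continuousAt hLp hL hLf
  obtain ⟨ε, hε, hiso⟩ := hdisc p ⟨hpD, hfp⟩
  have hev : ∀ᶠ z in 𝓝[≠] p, z ≠ p ∧ z ∈ D ∧ z ∈ ball p ε :=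
    (eventually_mem_nhdsWithin).and (eventually_nhdsWithin_of_eventually_nhds
      ((hDopen.eventually_mem hpD).and (ball_mem_nhds p hε)))
  obtain ⟨z, hfz, hzp, hzD, hzε⟩ := (hfreq.and_eventually hev).exists
  exact absurd (hiso z ⟨hzD, hfz⟩ hzp) (not_le.2 hzε)
end
end

section
/- Let D ⊂ ℂ^n be a bounded domain with smooth boundary, witnessed by a C^∞ function ρ defined on an open neighborhood of the closure of D with D = {ρ < 0}, ∂D = {ρ = 0}, and the gradient of ρ nonvanishing on ∂D. Assume: (1) every automorphism f of D extends to a smooth diffeomorphism of the closure of D (i.e. f has a C^∞ extension to the closure that is a bijection of the closure with C^∞ inverse); (2) whenever a sequence of automorphisms f_k converges uniformly on compact subsets of D to an automorphism f, the extensions converge in the C^∞ topology on the closure of D, i.e. for every order j the j-th derivatives of the extensions of f_k converge uniformly on the closure of D to those of the extension of f. Then for every compact subgroup H of the automorphism group of D there exists a natural number m (depending only on D and H) such that every f ∈ H whose fixed point set is discrete in D has a finite fixed point set of cardinality at most m. -/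
open Set Metric Filter Topology

noncomputable section

/-- `D` has smooth boundary, witnessed by the defining function `ρ` defined on the
open neighborhood `V` of the closure of `D`. -/
def SmoothDefiningFn {n : ℕ} (D V : Set (CSpace n)) (ρ : CSpace n → ℝ) : Prop :=
  IsOpen V ∧ closure D ⊆ V ∧ ContDiffOn ℝ (⊤ : ℕ∞) ρ V ∧
    D = {z ∈ V | ρ z < 0} ∧ frontier D = {z ∈ V | ρ z = 0} ∧
    ∀ z ∈ frontier D, fderiv ℝ ρ z ≠ 0

/-- `F` is a smooth extension of `f` to the closure of `D` which is a diffeomorphism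
of the closure of `D`. -/
def SmoothDiffeoExt {n : ℕ} (D : Set (CSpace n)) (f F : CSpace n → CSpace n) : Prop :=
  ContDiffOn ℝ (⊤ : ℕ∞) F (closure D) ∧ Set.EqOn F f D ∧
    Set.BijOn F (closure D) (closure D) ∧
    ∃ G : CSpace n → CSpace n, ContDiffOn ℝ (⊤ : ℕ∞) G (closure D) ∧
      (∀ z ∈ closure D, G (F z) = z) ∧ (∀ z ∈ closure D, F (G z) = z)

/-- Convergence of automorphisms uniformly on compact subsets of `D` implies
`C^∞`-convergence of the extensions on the closure of `D`. -/
def SmoothConvergenceProperty {n : ℕ} (D : Set (CSpace n)) : Prop :=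
  ∀ (u : ℕ → CSpace n → CSpace n) (f : CSpace n → CSpace n),
    (∀ k, AutOn D (u k)) → AutOn D f →
    (∀ K : Set (CSpace n), K ⊆ D → IsCompact K →
      TendstoUniformlyOn u f Filter.atTop K) →
    ∀ (F : ℕ → CSpace n → CSpace n) (F₀ : CSpace n → CSpace n),
      (∀ k, SmoothDiffeoExt D (u k) (F k)) → SmoothDiffeoExt D f F₀ →
      ∀ j : ℕ,
        TendstoUniformlyOn
          (fun k => iteratedFDerivWithin ℝ j (F k) (closure D))
          (iteratedFDerivWithin ℝ j F₀ (closure D)) Filter.atTop (closure D)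

/-- A generalized Cesàro limit (Banach limit) for bounded sequences in a proper space. -/
theorem exists_cesaro_limit (E : Type*) [NormedAddCommGroup E] [NormedSpace ℝ E]
    [FiniteDimensional ℝ E] :
    ∃ Λ : (ℕ → E) → E,
      (∀ a b : ℕ → E, ∀ A B : ℝ, (∀ j, ‖a j‖ ≤ A) → (∀ j, ‖b j‖ ≤ B) →
        Λ (fun j => a j - b j) = Λ a - Λ b) ∧
      (∀ a : ℕ → E, ∀ A : ℝ, (∀ j, ‖a j‖ ≤ A) → ∀ L : E →L[ℝ] E,
        Λ (fun j => L (a j)) = L (Λ a)) ∧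
      (∀ a : ℕ → E, ∀ A : ℝ, (∀ j, ‖a j‖ ≤ A) → Λ (fun j => a (j + 1)) = Λ a) ∧
      (∀ a : ℕ → E, ∀ c : E, ∀ A : ℝ, (∀ j, ‖a j - c‖ ≤ A) → ‖Λ a - c‖ ≤ A) := by
  have := FiniteDimensional.proper ℝ E
  let U : Ultrafilter ℕ := hyperfilter ℕ
  let avg : (ℕ → E) → ℕ → E := fun a N => ((N : ℝ) + 1)⁻¹ • ∑ j ∈ Finset.range (N + 1), a j
  have havg : ∀ a : ℕ → E, ∀ c : E, ∀ A : ℝ, (∀ j, ‖a j - c‖ ≤ A) →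
      ∀ N, ‖avg a N - c‖ ≤ A := by
    intro a c A h N
    have hN : (0 : ℝ) < (N : ℝ) + 1 := by positivity
    have : avg a N - c = ((N : ℝ) + 1)⁻¹ • ∑ j ∈ Finset.range (N + 1), (a j - c) := by
      rw [Finset.sum_sub_distrib, smul_sub, Finset.sum_const, Finset.card_range,
        ← Nat.cast_smul_eq_nsmul ℝ, smul_smul]
      push_cast
      rw [inv_mul_cancel₀ hN.ne', one_smul]
    rw [this, norm_smul, norm_inv, Real.norm_of_nonneg hN.le, inv_mul_le_iff₀ hN]
    refine (norm_sum_le_of_le _ (fun j _ => h j)).trans ?_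
    simp
  have hlim : ∀ a : ℕ → E, ∃ l : E, ∀ c : E, ∀ A : ℝ, (∀ j, ‖a j - c‖ ≤ A) →
      Tendsto (avg a) U (𝓝 l) := by
    intro a
    by_cases h : ∃ c : E, ∃ A : ℝ, ∀ j, ‖a j - c‖ ≤ A
    · obtain ⟨c, A, h⟩ := h
      obtain ⟨l, -, hl⟩ := (isCompact_closedBall c A).ultrafilter_le_nhds (U.map (avg a)) (by
        rw [le_principal_iff]
        exact Filter.mem_map.2 (Filter.univ_mem' fun N =>
          mem_closedBall_iff_norm.2 (havg a c A h N)))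
      exact ⟨l, fun _ _ _ => hl⟩
    · exact ⟨0, fun c A h' => (h ⟨c, A, h'⟩).elim⟩
  choose Λ hΛ using hlim
  have hΛ0 : ∀ a : ℕ → E, ∀ A : ℝ, (∀ j, ‖a j‖ ≤ A) → Tendsto (avg a) U (𝓝 (Λ a)) :=
    fun a A h => hΛ a 0 A (by simpa using h)
  refine ⟨Λ, ?_, ?_, ?_, ?_⟩
  · intro a b A B ha hb
    refine tendsto_nhds_unique (hΛ0 _ (A + B) fun j =>
      (norm_sub_le _ _).trans (add_le_add (ha j) (hb j))) ?_
    refine ((hΛ0 a A ha).sub (hΛ0 b B hb)).congr fun N => ?_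
    simp [avg, Finset.sum_sub_distrib, smul_sub]
  · intro a A ha L
    refine tendsto_nhds_unique (hΛ0 _ (‖L‖ * A) fun j => L.le_opNorm_of_le (ha j)) ?_
    refine ((L.continuous.tendsto _).comp (hΛ0 a A ha)).congr fun N => ?_
    simp [avg]
  · intro a A ha
    refine tendsto_nhds_unique (hΛ0 _ A fun j => ha (j + 1)) ?_
    have h0 : Tendsto (fun N : ℕ => ((N : ℝ) + 1)⁻¹ • (a (N + 1) - a 0)) U (𝓝 0) := by
      have h1 : Tendsto (fun N : ℕ => ((N : ℝ) + 1)⁻¹) U (𝓝 0) := by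
        have := tendsto_one_div_add_atTop_nhds_zero_nat (𝕜 := ℝ)
        simp only [one_div] at this
        exact this.mono_left Nat.hyperfilter_le_atTop
      refine h1.zero_smul_isBoundedUnder_le ?_
      refine isBoundedUnder_of ⟨A + A, fun N => ?_⟩
      exact (norm_sub_le _ _).trans (add_le_add (ha _) (ha _))
    have h2 := (hΛ0 a A ha).add h0
    rw [add_zero] at h2
    refine h2.congr fun N => ?_
    simp only [avg]
    rw [← smul_add, Finset.sum_range_succ' a N, Finset.sum_range_succ (fun j => a (j + 1)) N]
    congr 1
    abel
  · intro a c A h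
    have h1 := ((hΛ a c A h).sub_const c).norm
    exact le_of_tendsto h1 (Eventually.of_forall (havg a c A h))

/-- A power-bounded operator whose powers move `v` by at most `‖v‖ / 2` has a nonzero fixed
vector. -/
theorem exists_ne_zero_fixed_of_pow_near {E : Type*} [NormedAddCommGroup E] [NormedSpace ℝ E]
    [FiniteDimensional ℝ E] (L : E →L[ℝ] E) (v : E) (hv : v ≠ 0)
    (h : ∀ j : ℕ, ‖(L ^ j) v - v‖ ≤ ‖v‖ / 2) : ∃ w, w ≠ 0 ∧ L w = w := by
  obtain ⟨Λ, -, hL, hshift, hnear⟩ := exists_cesaro_limit E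
  have hb : ∀ j : ℕ, ‖(L ^ j) v‖ ≤ ‖v‖ / 2 + ‖v‖ := fun j => by
    have := norm_add_le ((L ^ j) v - v) v
    rw [sub_add_cancel] at this
    linarith [h j]
  refine ⟨Λ fun j => (L ^ j) v, fun h0 => ?_, ?_⟩
  · have := hnear _ v _ h
    rw [h0, zero_sub, norm_neg] at this
    linarith [norm_pos_iff.2 hv]
  · rw [← hL _ _ hb L, ← hshift _ _ hb]
    simp [pow_succ']

/-- Cartan-type linearization by averaging: if the iterates of `f` near the fixed point `p` are
uniformly close to the powers of an operator `L` with right inverse `B`, then a nonzero fixed vector of `L`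
produces fixed points of `f` other than `p` arbitrarily close to `p`. -/
theorem exists_fixed_near_of_fixed_vector {E : Type*} [NormedAddCommGroup E] [NormedSpace ℝ E]
    [FiniteDimensional ℝ E] (f : E → E) (p : E) (hfp : f p = p) (hfc : ContinuousAt f p)
    (L B : E →L[ℝ] E) (hLB : L * B = 1) (r : ℝ) (hr : 0 < r)
    (h : ∀ j : ℕ, ∀ x ∈ ball p r, ∀ y ∈ ball p r,
      ‖(B ^ j) (f^[j] x - f^[j] y) - (x - y)‖ ≤ 1 / 2 * ‖x - y‖)
    (w : E) (hw : w ≠ 0) (hLw : L w = w) (ε : ℝ) (hε : 0 < ε) :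
    ∃ x, x ≠ p ∧ dist x p < ε ∧ f x = x := by
  have := FiniteDimensional.complete ℝ E
  obtain ⟨Λ, hsub, hlin, hshift, hnear⟩ := exists_cesaro_limit E
  let b : E → ℕ → E := fun x j => (B ^ j) (f^[j] x - p)
  have hpp : ∀ j, f^[j] p = p := fun j => Function.iterate_fixed hfp j
  have hp : p ∈ ball p r := mem_ball_self hr
  have hb : ∀ x ∈ ball p r, ∀ j, ‖b x j‖ ≤ 1 / 2 * ‖x - p‖ + ‖x - p‖ := by
    intro x hx j
    have h1 := h j x hx p hp
    rw [hpp] at h1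
    have h2 := norm_add_le ((B ^ j) (f^[j] x - p) - (x - p)) (x - p)
    rw [sub_add_cancel] at h2
    exact h2.trans (by linarith)
  let φ : E → E := fun x => Λ (b x)
  have happ : ∀ x ∈ ball p r, ∀ y ∈ ball p r, ‖φ x - φ y - (x - y)‖ ≤ 1 / 2 * ‖x - y‖ := by
    intro x hx y hy
    have h1 : φ x - φ y = Λ (fun j => b x j - b y j) := (hsub _ _ _ _ (hb x hx) (hb y hy)).symm
    rw [h1]
    refine hnear _ _ _ fun j => ?_
    have h2 := h j x hx y hy
    have h3 : b x j - b y j = (B ^ j) (f^[j] x - f^[j] y) := by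
      simp only [b]
      rw [← map_sub]
      congr 1
      abel
    rwa [h3]
  have hφp : φ p = 0 := by
    have h1 := hnear (b p) 0 0 (fun j => by simp [b, hpp])
    simpa using h1
  have hcomm : ∀ x ∈ ball p r, f x ∈ ball p r → φ (f x) = L (φ x) := by
    intro x hx hfx
    have h1 : b (f x) = fun j => L (b x (j + 1)) := by
      funext j
      simp only [b, Function.iterate_succ_apply, pow_succ']
      rw [← mul_apply_eq_comp L, ← mul_assoc, hLB, one_mul]
    simp only [φ]
    rw [h1, hlin (fun j => b x (j + 1)) _ (fun j => hb x hx (j + 1)) L, hshift _ _ (hb x hx)]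
  have hcont : ∀ᶠ x in 𝓝 p, f x ∈ ball p r :=
    hfc.eventually (by rw [hfp]; exact ball_mem_nhds p hr)
  obtain ⟨δ, hδ, hδf⟩ := Metric.eventually_nhds_iff_ball.1 hcont
  let η := min (min δ ε) r
  have hη : 0 < η := lt_min (lt_min hδ hε) hr
  have hηr : ball p η ⊆ ball p r := ball_subset_ball (min_le_right _ _)
  have hA : ApproximatesLinearOn φ (ContinuousLinearMap.id ℝ E) (ball p η) (1 / 2) := by
    intro x hx y hy
    simpa using happ x (hηr hx) y (hηr hy)
  have himg : φ '' ball p η ∈ 𝓝 (φ p) :=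
    hA.image_mem_nhds ⟨id, 1, by simp, by simp⟩ (ball_mem_nhds p hη)
      (Or.inr (by simpa using NNReal.half_lt_self one_ne_zero))
  rw [hφp] at himg
  have htend : Tendsto (fun t : ℝ => t • w) (𝓝[≠] 0) (𝓝 0) := by
    have : ContinuousAt (fun t : ℝ => t • w) 0 := by fun_prop
    simpa using this.tendsto.mono_left (nhdsWithin_le_nhds (s := {0}ᶜ))
  obtain ⟨t, ⟨x, hx, hxt⟩, ht⟩ := ((htend.eventually himg).and self_mem_nhdsWithin).exists
  have ht0 : t ≠ 0 := ht
  have hfx : f x ∈ ball p r :=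
    hδf x (ball_subset_ball ((min_le_left _ _).trans (min_le_left _ _)) hx)
  refine ⟨x, ?_, (mem_ball.1 hx).trans_le ((min_le_left _ _).trans (min_le_right _ _)), ?_⟩
  · rintro rfl
    rw [hφp] at hxt
    exact smul_ne_zero ht0 hw hxt.symm
  · have h1 : φ (f x) = φ x := by
      rw [hcomm x (hηr hx) hfx, hxt, map_smul, hLw]
    have h2 := happ (f x) hfx x (hηr hx)
    rw [h1, sub_self, zero_sub, norm_neg] at h2
    have h3 : ‖f x - x‖ = 0 := by linarith [norm_nonneg (f x - x)]
    exact sub_eq_zero.1 (norm_eq_zero.1 h3)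

/-- `g` is twice differentiable on `D` with first and second derivatives bounded by `C`. -/
def HasC2Bound {E : Type*} [NormedAddCommGroup E] [NormedSpace ℝ E] (D : Set E) (C : ℝ)
    (g : E → E) : Prop :=
  ∀ z ∈ D, DifferentiableAt ℝ g z ∧ DifferentiableAt ℝ (fderiv ℝ g) z ∧
    ‖fderiv ℝ g z‖ ≤ C ∧ ‖fderiv ℝ (fderiv ℝ g) z‖ ≤ C

theorem HasC2Bound.congr {E : Type*} [NormedAddCommGroup E] [NormedSpace ℝ E] {D : Set E}
    (hD : IsOpen D) {C : ℝ} {g h : E → E} (hg : HasC2Bound D C g) (heq : EqOn h g D) :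
    HasC2Bound D C h := by
  intro z hz
  obtain ⟨h1, h2, h3, h4⟩ := hg z hz
  have he : h =ᶠ[𝓝 z] g := heq.eventuallyEq_of_mem (hD.mem_nhds hz)
  exact ⟨he.differentiableAt_iff.2 h1, he.fderiv.differentiableAt_iff.2 h2,
    by rwa [he.fderiv_eq], by rwa [he.fderiv.fderiv_eq]⟩

/-- The linear approximation error along a segment contained in `D`. -/
theorem HasC2Bound.segment_estimate {E : Type*} [NormedAddCommGroup E] [NormedSpace ℝ E]
    {D : Set E} {C : ℝ} {g : E → E} (hg : HasC2Bound D C g) (φ : E →L[ℝ] E) {K l : ℝ} {a b : E}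
    (hseg : segment ℝ a b ⊆ D) (hC : 0 ≤ C) (hl : ‖b - a‖ ≤ l) (ha : ‖fderiv ℝ g a - φ‖ ≤ K) :
    ‖fderiv ℝ g b - φ‖ ≤ K + C * l ∧
      ‖g b - g a - φ (b - a)‖ ≤ (K + C * l) * l := by
  have key : ∀ z ∈ segment ℝ a b, ‖fderiv ℝ g z - φ‖ ≤ K + C * l := by
    intro z hz
    have h1 := (convex_segment a b).norm_image_sub_le_of_norm_fderiv_le (𝕜 := ℝ)
      (f := fderiv ℝ g) (C := C) (fun x hx => (hg x (hseg hx)).2.1)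
      (fun x hx => (hg x (hseg hx)).2.2.2) (left_mem_segment ℝ a b) hz
    have h2 : ‖z - a‖ ≤ l := by
      refine le_trans ?_ hl
      obtain ⟨t, ht, rfl⟩ := segment_eq_image' ℝ a b ▸ hz
      rw [add_sub_cancel_left, norm_smul, Real.norm_of_nonneg ht.1]
      exact mul_le_of_le_one_left (norm_nonneg _) ht.2
    have h3 := norm_add_le (fderiv ℝ g z - fderiv ℝ g a) (fderiv ℝ g a - φ)
    rw [sub_add_sub_cancel] at h3
    have h4 := mul_le_mul_of_nonneg_left h2 hC
    linarith
  refine ⟨key b (right_mem_segment ℝ a b), ?_⟩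
  have h1 := (convex_segment a b).norm_image_sub_le_of_norm_fderiv_le' (𝕜 := ℝ)
      (f := g) (φ := φ) (fun x hx => (hg x (hseg hx)).1) key
      (left_mem_segment ℝ a b) (right_mem_segment ℝ a b)
  refine h1.trans (mul_le_mul_of_nonneg_left hl ?_)
  exact (norm_nonneg _).trans (key a (left_mem_segment ℝ a b))

/-- Quadratic Taylor estimate between two points joined by a three-piece polygon in `D`. -/
theorem HasC2Bound.polygon_estimate {E : Type*} [NormedAddCommGroup E] [NormedSpace ℝ E]
    {D : Set E} {C : ℝ} {g : E → E} (hg : HasC2Bound D C g) (hC : 0 ≤ C) {l : ℝ} {p q e : E}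
    (h1 : segment ℝ p (p + e) ⊆ D) (h2 : segment ℝ (p + e) (q + e) ⊆ D)
    (h3 : segment ℝ (q + e) q ⊆ D) (he : ‖e‖ ≤ l) (hpq : ‖q - p‖ ≤ l) :
    ‖g q - g p - fderiv ℝ g p (q - p)‖ ≤ 6 * C * l ^ 2 := by
  obtain ⟨k1, e1⟩ := hg.segment_estimate (fderiv ℝ g p) (K := 0) (l := l) h1 hC (by simpa)
    (by simp)
  obtain ⟨k2, e2⟩ := hg.segment_estimate (fderiv ℝ g p) (l := l) h2 hC (by simpa) k1
  obtain ⟨k3, e3⟩ := hg.segment_estimate (fderiv ℝ g p) (l := l) h3 hC (by simpa) k2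
  have hsum : g q - g p - fderiv ℝ g p (q - p) =
      (g (p + e) - g p - fderiv ℝ g p (p + e - p)) +
      (g (q + e) - g (p + e) - fderiv ℝ g p (q + e - (p + e))) +
      (g q - g (q + e) - fderiv ℝ g p (q - (q + e))) := by
    simp only [map_sub, map_add]
    abel
  rw [hsum]
  refine (norm_add₃_le).trans ?_
  nlinarith

/-- If all iterates of `f` and of its inverse `g` satisfy a uniform `C²` bound and `p` is a
fixed point at which `fderiv ℝ f p` has a nonzero fixed vector, then `p` is not isolated in the
fixed point set. -/
theorem exists_fixed_near_of_HasC2Bound {E : Type*} [NormedAddCommGroup E] [NormedSpace ℝ E]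
    [FiniteDimensional ℝ E] {D : Set E} (hD : IsOpen D) {C : ℝ} (hC : 0 ≤ C) (f g : E → E)
    (hf : ∀ j, HasC2Bound D C f^[j]) (hg : ∀ j, HasC2Bound D C g^[j])
    (hgf : ∀ z ∈ D, g (f z) = z) (hfg : ∀ z ∈ D, f (g z) = z)
    {p : E} (hp : p ∈ D) (hfp : f p = p) {w : E} (hw : w ≠ 0) (hLw : fderiv ℝ f p w = w)
    {ε : ℝ} (hε : 0 < ε) : ∃ x, x ≠ p ∧ dist x p < ε ∧ f x = x := by
  have hgp : g p = p := by simpa [hfp] using hgf p hp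
  have hdf : HasFDerivAt f (fderiv ℝ f p) p := ((hf 1) p hp).1.hasFDerivAt
  have hdg : HasFDerivAt g (fderiv ℝ g p) p := ((hg 1) p hp).1.hasFDerivAt
  have hcomp : ∀ u v : E → E, HasFDerivAt u (fderiv ℝ u p) p → HasFDerivAt v (fderiv ℝ v p) p →
      v p = p → (∀ z ∈ D, u (v z) = z) → fderiv ℝ u p * fderiv ℝ v p = 1 := by
    intro u v hu hv hvp huv
    have h1 : HasFDerivAt (u ∘ v) (fderiv ℝ u p * fderiv ℝ v p) p :=
      HasFDerivAt.comp p (by rwa [hvp]) hv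
    have h2 : HasFDerivAt (u ∘ v) (1 : E →L[ℝ] E) p := by
      refine (hasFDerivAt_id p).congr_of_eventuallyEq ?_
      filter_upwards [hD.mem_nhds hp] with z hz using huv z hz
    exact h1.unique h2
  have hLB := hcomp f g hdf hdg hgp hfg
  have hBL := hcomp g f hdg hdf hfp hgf
  obtain ⟨s, hs, hsD⟩ := Metric.isOpen_iff.1 hD p hp
  let r := min s (1 / (2 * (C * C + 1)))
  have hr : 0 < r := lt_min hs (by positivity)
  have hrC : C * (C * r) ≤ 1 / 2 := by
    have h1 : r ≤ 1 / (2 * (C * C + 1)) := min_le_right _ _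
    rw [le_div_iff₀ (by positivity)] at h1
    nlinarith
  have hrD : ball p r ⊆ D := (ball_subset_ball (min_le_left _ _)).trans hsD
  refine exists_fixed_near_of_fixed_vector f p hfp hdf.continuousAt (fderiv ℝ f p)
    (fderiv ℝ g p) hLB r hr ?_ w hw hLw ε hε
  intro j x hx y hy
  have hL : fderiv ℝ f^[j] p = fderiv ℝ f p ^ j := (hdf.iterate hfp j).fderiv
  have hB : fderiv ℝ g^[j] p = fderiv ℝ g p ^ j := (hdg.iterate hgp j).fderiv
  have hBnorm : ‖fderiv ℝ g p ^ j‖ ≤ C := hB ▸ ((hg j) p hp).2.2.1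
  have hBLj : fderiv ℝ g p ^ j * fderiv ℝ f p ^ j = 1 := by
    have hc : Commute (fderiv ℝ g p) (fderiv ℝ f p) := hBL.trans hLB.symm
    rw [← hc.mul_pow, hBL, one_pow]
  have hder : ∀ z ∈ ball p r, ‖fderiv ℝ f^[j] z - fderiv ℝ f p ^ j‖ ≤ C * r := by
    intro z hz
    rw [← hL]
    refine ((convex_ball p r).norm_image_sub_le_of_norm_fderiv_le (𝕜 := ℝ)
      (f := fderiv ℝ f^[j]) (C := C) (fun x hx => (hf j x (hrD hx)).2.1)
      (fun x hx => (hf j x (hrD hx)).2.2.2) (mem_ball_self hr) hz).trans ?_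
    exact mul_le_mul_of_nonneg_left (mem_ball_iff_norm.1 hz).le hC
  have h1 := (convex_ball p r).norm_image_sub_le_of_norm_fderiv_le' (𝕜 := ℝ)
    (f := f^[j]) (φ := fderiv ℝ f p ^ j) (fun x hx => (hf j x (hrD hx)).1) hder hy hx
  have h2 : (fderiv ℝ g p ^ j) (f^[j] x - f^[j] y) - (x - y) =
      (fderiv ℝ g p ^ j) (f^[j] x - f^[j] y - (fderiv ℝ f p ^ j) (x - y)) := by
    have h3 : (fderiv ℝ g p ^ j) ((fderiv ℝ f p ^ j) (x - y)) = x - y :=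
      DFunLike.congr_fun hBLj (x - y)
    rw [map_sub (fderiv ℝ g p ^ j) (f^[j] x - f^[j] y), h3]
  rw [h2]
  calc _ ≤ C * (C * r * ‖x - y‖) := ContinuousLinearMap.le_of_opNorm_le_of_le _ hBnorm h1
    _ = C * (C * r) * ‖x - y‖ := by ring
    _ ≤ _ := by gcongr

/-- In a domain with smooth boundary, nearby points can be joined by three-piece polygons whose
length is comparable to their distance. -/
theorem SmoothDefiningFn.exists_polygon {n : ℕ} {D V : Set (CSpace n)} {ρ : CSpace n → ℝ}
    (hD : IsOpen D) (h : SmoothDefiningFn D V ρ) {x : CSpace n} (hx : x ∈ closure D) :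
    ∃ ε > 0, ∃ M : ℝ, 0 ≤ M ∧ ∀ p ∈ D, ∀ q ∈ D, dist p x < ε → dist q x < ε →
      ∃ e, ‖e‖ ≤ M * ‖q - p‖ ∧ segment ℝ p (p + e) ⊆ D ∧
        segment ℝ (p + e) (q + e) ⊆ D ∧ segment ℝ (q + e) q ⊆ D := by
  by_cases hxD : x ∈ D
  · obtain ⟨ε, hε, hεD⟩ := Metric.isOpen_iff.1 hD x hxD
    refine ⟨ε, hε, 0, le_rfl, fun p hp q hq hpx hqx => ⟨0, by simp, ?_, ?_, ?_⟩⟩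
    · simpa using hp
    · simpa using ((convex_ball x ε).segment_subset hpx hqx).trans hεD
    · simpa using hq
  obtain ⟨hV, hDV, hρ, hDρ, -, hgrad⟩ := h
  have hxf : x ∈ frontier D := by
    rw [hD.frontier_eq]
    exact ⟨hx, hxD⟩
  have hstrict : HasStrictFDerivAt ρ (fderiv ℝ ρ x) x :=
    (hρ.contDiffAt (hV.mem_nhds (hDV hx))).hasStrictFDerivAt (by simp)
  obtain ⟨v, hv⟩ : ∃ v, fderiv ℝ ρ x v = -1 := by
    obtain ⟨u, hu⟩ := DFunLike.ne_iff.1 (hgrad x hxf)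
    have hu' : fderiv ℝ ρ x u ≠ 0 := hu
    refine ⟨-((fderiv ℝ ρ x u)⁻¹ • u), ?_⟩
    rw [map_neg, map_smul, smul_eq_mul, inv_mul_cancel₀ hu']
  set c : ℝ := 1 / (2 * (‖v‖ + 1)) with hc
  have hvn : 0 ≤ ‖v‖ := norm_nonneg v
  have hc0 : 0 < c := by positivity
  have hcv : c * ‖v‖ ≤ 1 / 2 := by
    rw [hc, div_mul_eq_mul_div, div_le_div_iff₀ (by positivity) (by norm_num)]
    linarith
  have hnear := hstrict.isLittleO.def hc0
  obtain ⟨η₁, hη₁, hη₁'⟩ := Metric.eventually_nhds_iff_ball.1 hnear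
  obtain ⟨η₂, hη₂, hη₂'⟩ := Metric.isOpen_iff.1 hV x (hDV hx)
  set η := min η₁ η₂ with hη
  have hη0 : 0 < η := lt_min hη₁ hη₂
  have happ : ∀ a ∈ ball x η, ∀ b ∈ ball x η,
      |ρ a - ρ b - fderiv ℝ ρ x (a - b)| ≤ c * ‖a - b‖ := by
    intro a ha b hb
    refine hη₁' (a, b) ?_
    rw [← ball_prod_same]
    exact ⟨ball_subset_ball (min_le_left _ _) ha, ball_subset_ball (min_le_left _ _) hb⟩
  have hmem : ∀ a ∈ ball x η, ρ a < 0 → a ∈ D := by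
    intro a ha hneg
    rw [hDρ]
    exact ⟨hη₂' (ball_subset_ball (min_le_right _ _) ha), hneg⟩
  set K : ℝ := ‖fderiv ℝ ρ x‖ + c with hK
  have hK0 : 0 < K := by positivity
  have hLip : ∀ a ∈ ball x η, ∀ b ∈ ball x η, ρ a ≤ ρ b + K * ‖a - b‖ := by
    intro a ha b hb
    have h1 := (abs_le.1 (happ a ha b hb)).2
    have h2 := (le_abs_self _).trans ((fderiv ℝ ρ x).le_opNorm (a - b))
    rw [hK, add_mul]
    linarith
  have hdec : ∀ a ∈ ball x η, ∀ t : ℝ, 0 ≤ t → a + t • v ∈ ball x η →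
      ρ (a + t • v) ≤ ρ a - t / 2 := by
    intro a ha t ht hat
    have h1 := (abs_le.1 (happ _ hat a ha)).2
    rw [add_sub_cancel_left, map_smul, hv, norm_smul, Real.norm_of_nonneg ht, smul_eq_mul] at h1
    nlinarith
  let M : ℝ := 4 * K * ‖v‖
  have hM : 0 ≤ M := by positivity
  refine ⟨η / (2 * M + 4), by positivity, M, hM, fun p hp q hq hpx hqx => ?_⟩
  set ε := η / (2 * M + 4) with hε
  have hε0 : 0 < ε := by positivity
  have hεη : ε * (2 * M + 4) = η := div_mul_cancel₀ _ (by positivity)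
  set d := ‖q - p‖ with hd
  have hd2 : d ≤ 2 * ε := by
    have := dist_triangle_right q p x
    rw [dist_eq_norm] at this
    linarith
  have hd0 : 0 ≤ d := norm_nonneg _
  have hball : ∀ a : CSpace n, dist a x < ε → ∀ t : ℝ, 0 ≤ t → t ≤ 4 * K * d →
      a + t • v ∈ ball x η := by
    intro a ha t ht ht'
    rw [mem_ball]
    have h1 : dist (a + t • v) a ≤ M * d := by
      rw [dist_eq_norm, add_sub_cancel_left, norm_smul, Real.norm_of_nonneg ht]
      calc t * ‖v‖ ≤ 4 * K * d * ‖v‖ := by gcongr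
        _ = M * d := by ring
    have h2 := dist_triangle (a + t • v) a x
    nlinarith
  have hneg : ∀ a ∈ D, ρ a < 0 := fun a ha => by
    rw [hDρ] at ha
    exact ha.2
  have hray : ∀ a ∈ D, dist a x < ε → segment ℝ a (a + (4 * K * d) • v) ⊆ D := by
    intro a ha hax z hz
    rw [segment_eq_image'] at hz
    obtain ⟨t, ht, rfl⟩ := hz
    have hT : 0 ≤ 4 * K * d := by positivity
    have e1 : a + t • (a + (4 * K * d) • v - a) = a + (t * (4 * K * d)) • v := by
      rw [add_sub_cancel_left, smul_smul]
    simp only [e1]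
    have h0 : 0 ≤ t * (4 * K * d) := mul_nonneg ht.1 hT
    have h1 := hball a hax (t * (4 * K * d)) h0 (mul_le_of_le_one_left hT ht.2)
    have h2 : a ∈ ball x η := by simpa using hball a hax 0 le_rfl hT
    refine hmem _ h1 ?_
    have := hdec a h2 _ h0 h1
    linarith [hneg a ha]
  refine ⟨(4 * K * d) • v, ?_, hray p hp hpx, ?_, ?_⟩
  · rw [norm_smul, Real.norm_of_nonneg (by positivity)]
    exact le_of_eq (by ring)
  · intro z hz
    have hT : 0 ≤ 4 * K * d := by positivity
    have hpT := hball p hpx _ hT le_rfl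
    have hqT := hball q hqx _ hT le_rfl
    have hzb : z ∈ ball x η := (convex_ball x η).segment_subset hpT hqT hz
    refine hmem z hzb ?_
    have hp0 : p ∈ ball x η := by simpa using hball p hpx 0 le_rfl hT
    have h1 := hdec p hp0 _ hT hpT
    have h2 := hLip z hzb _ hpT
    have h3 : ‖z - (p + (4 * K * d) • v)‖ ≤ d := by
      rw [segment_eq_image'] at hz
      obtain ⟨t, ht, rfl⟩ := hz
      simp only [add_sub_cancel_left, add_sub_add_right_eq_sub]
      rw [norm_smul, Real.norm_of_nonneg ht.1]
      exact mul_le_of_le_one_left hd0 ht.2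
    have h4 := mul_le_mul_of_nonneg_left h3 hK0.le
    have h5 : 0 ≤ K * d := by positivity
    linarith [hneg p hp]
  · rw [segment_symm]
    exact hray q hq hqx

/-- Derivatives of a function smooth up to the boundary are bounded on a bounded open set. -/
theorem exists_bound_iteratedFDeriv {E : Type*} [NormedAddCommGroup E] [NormedSpace ℝ E]
    [FiniteDimensional ℝ E] {D : Set E} (hD : IsOpen D) (hbdd : Bornology.IsBounded D)
    {F : E → E} (hF : ContDiffOn ℝ (⊤ : ℕ∞) F (closure D)) (j : ℕ) :
    ∃ C : ℝ, ∀ z ∈ D, ‖iteratedFDeriv ℝ j F z‖ ≤ C := by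
  have := FiniteDimensional.proper ℝ E
  have key : ∃ C : ℝ, ∀ z ∈ closure D ∩ D, ‖iteratedFDeriv ℝ j F z‖ ≤ C := by
    refine hbdd.isCompact_closure.induction_on
      (p := fun s => ∃ C : ℝ, ∀ z ∈ s ∩ D, ‖iteratedFDeriv ℝ j F z‖ ≤ C) ⟨0, by simp⟩ ?_ ?_ ?_
    · rintro s t hst ⟨C, hC⟩
      exact ⟨C, fun z hz => hC z ⟨hst hz.1, hz.2⟩⟩
    · rintro s t ⟨C, hC⟩ ⟨C', hC'⟩
      refine ⟨max C C', fun z hz => ?_⟩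
      rcases hz.1 with h | h
      · exact (hC z ⟨h, hz.2⟩).trans (le_max_left _ _)
      · exact (hC' z ⟨h, hz.2⟩).trans (le_max_right _ _)
    · intro x hx
      obtain ⟨u, hu, p, hp⟩ := (hF x hx) j (by exact_mod_cast le_top)
      rw [insert_eq_of_mem hx] at hu
      have hcont : ContinuousWithinAt (fun y => p y j) u x :=
        hp.cont j le_rfl x (mem_of_mem_nhdsWithin hx hu)
      have hlt : ∀ᶠ y in 𝓝[u] x, ‖p y j‖ < ‖p x j‖ + 1 :=
        hcont.norm.eventually (gt_mem_nhds (by linarith))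
      have hlt' : ∀ᶠ y in 𝓝[closure D] x, ‖p y j‖ < ‖p x j‖ + 1 :=
        nhdsWithin_le_of_mem hu hlt
      obtain ⟨o, ho, hxo, hou⟩ := mem_nhdsWithin.1 (inter_mem hu hlt')
      refine ⟨o, mem_nhdsWithin_of_mem_nhds (ho.mem_nhds hxo), ‖p x j‖ + 1, fun z hz => ?_⟩
      have hsub : o ∩ D ⊆ u := fun y hy => (hou ⟨hy.1, subset_closure hy.2⟩).1
      have hopen : IsOpen (o ∩ D) := ho.inter hD
      rw [← iteratedFDerivWithin_of_isOpen j hopen hz,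
        ← (hp.mono hsub).eq_iteratedFDerivWithin_of_uniqueDiffOn le_rfl hopen.uniqueDiffOn hz]
      exact (hou ⟨hz.1, subset_closure hz.2⟩).2.le
  obtain ⟨C, hC⟩ := key
  exact ⟨C, fun z hz => hC z ⟨subset_closure hz, hz⟩⟩

theorem SmoothDiffeoExt.iteratedFDeriv_eq {n : ℕ} {D : Set (CSpace n)} (hD : IsOpen D)
    {f F : CSpace n → CSpace n} (h : SmoothDiffeoExt D f F) (j : ℕ) {z : CSpace n} (hz : z ∈ D) :
    iteratedFDerivWithin ℝ j F (closure D) z = iteratedFDeriv ℝ j f z := by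
  have h1 : iteratedFDerivWithin ℝ j F (closure D) z = iteratedFDerivWithin ℝ j F univ z :=
    iteratedFDerivWithin_congr_set
      (eventuallyEq_univ.2 (mem_of_superset (hD.mem_nhds hz) subset_closure)) j
  rw [h1, iteratedFDerivWithin_univ]
  exact ((h.2.1.eventuallyEq_of_mem (hD.mem_nhds hz)).iteratedFDeriv ℝ j).self_of_nhds

/-- Over a compact group of automorphisms, the derivatives of each order are uniformly bounded. -/
theorem IsCompactAutGroup.exists_bound_iteratedFDeriv {n : ℕ} {D : Set (CSpace n)}
    (hD : IsOpen D) (hbdd : Bornology.IsBounded D)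
    (hext : ∀ f : CSpace n → CSpace n, AutOn D f →
      ∃ F : CSpace n → CSpace n, SmoothDiffeoExt D f F)
    (hconv : SmoothConvergenceProperty D)
    {H : Set (CSpace n → CSpace n)} (hH : IsCompactAutGroup D H) (j : ℕ) :
    ∃ C : ℝ, ∀ f ∈ H, ∀ z ∈ D, ‖iteratedFDeriv ℝ j f z‖ ≤ C := by
  by_contra! hcon
  choose u huH z hzD hbig using fun k : ℕ => hcon k
  obtain ⟨ψ, hψ, f, hfH, hunif⟩ := hH.2.2.2.2 u huH
  choose F hF using fun k => hext (u k) (hH.1 _ (huH k))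
  obtain ⟨F₀, hF₀⟩ := hext f (hH.1 f hfH)
  have hlim := hconv (fun k => u (ψ k)) f (fun k => hH.1 _ (huH _)) (hH.1 f hfH) hunif
    (fun k => F (ψ k)) F₀ (fun k => hF _) hF₀ j
  obtain ⟨C, hC⟩ := _root_.exists_bound_iteratedFDeriv hD hbdd hF₀.1 j
  have hev := Metric.tendstoUniformlyOn_iff.1 hlim 1 one_pos
  obtain ⟨k, hk, hkC⟩ := (hev.and (eventually_ge_atTop ⌈C + 1⌉₊)).exists
  have hz := hzD (ψ k)
  have h1 := hk _ (subset_closure hz)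
  have h0 : iteratedFDerivWithin ℝ j F₀ (closure D) (z (ψ k)) = iteratedFDeriv ℝ j F₀ (z (ψ k)) :=
    (hF₀.iteratedFDeriv_eq hD j hz).trans
      (((hF₀.2.1.eventuallyEq_of_mem (hD.mem_nhds hz)).iteratedFDeriv ℝ j).self_of_nhds).symm
  rw [(hF _).iteratedFDeriv_eq hD j hz, h0, dist_eq_norm] at h1
  have h2 := norm_sub_norm_le (iteratedFDeriv ℝ j (u (ψ k)) (z (ψ k)))
    (iteratedFDeriv ℝ j F₀ (z (ψ k)))
  rw [norm_sub_rev] at h1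
  have h3 := hC _ hz
  have h4 := hbig (ψ k)
  have h5 : C + 1 ≤ (k : ℝ) := (Nat.le_ceil _).trans (by exact_mod_cast hkC)
  have h6 : (k : ℝ) ≤ (ψ k : ℝ) := by exact_mod_cast hψ.le_apply
  linarith

theorem IsCompactAutGroup.exists_hasC2Bound {n : ℕ} {D : Set (CSpace n)}
    (hD : IsOpen D) (hbdd : Bornology.IsBounded D)
    (hext : ∀ f : CSpace n → CSpace n, AutOn D f →
      ∃ F : CSpace n → CSpace n, SmoothDiffeoExt D f F)
    (hconv : SmoothConvergenceProperty D)
    {H : Set (CSpace n → CSpace n)} (hH : IsCompactAutGroup D H) :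
    ∃ C : ℝ, 0 ≤ C ∧ ∀ f ∈ H, HasC2Bound D C f := by
  obtain ⟨C₁, hC₁⟩ := hH.exists_bound_iteratedFDeriv hD hbdd hext hconv 1
  obtain ⟨C₂, hC₂⟩ := hH.exists_bound_iteratedFDeriv hD hbdd hext hconv 2
  refine ⟨max 0 (max C₁ C₂), le_max_left _ _, fun f hf z hz => ?_⟩
  obtain ⟨F, hF⟩ := hext f (hH.1 f hf)
  have hsm : ContDiffAt ℝ 2 f z := by
    refine ((hF.1.contDiffAt (mem_of_superset (hD.mem_nhds hz) subset_closure)).of_le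
      (WithTop.coe_le_coe.2 (le_top : (2 : ℕ∞) ≤ ⊤))).congr_of_eventuallyEq ?_
    exact (hF.2.1.eventuallyEq_of_mem (hD.mem_nhds hz)).symm
  refine ⟨hsm.differentiableAt (by norm_num),
    (hsm.fderiv_right (m := 1) (by norm_num)).differentiableAt (by norm_num), ?_, ?_⟩
  · rw [← norm_iteratedFDeriv_one]
    exact (hC₁ f hf z hz).trans ((le_max_left _ _).trans (le_max_right _ _))
  · rw [← norm_iteratedFDeriv_one, norm_iteratedFDeriv_fderiv]
    exact (hC₂ f hf z hz).trans ((le_max_right _ _).trans (le_max_right _ _))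

/-- Iterates of an element of the group agree on `D` with elements of the group. -/
theorem IsCompactAutGroup.exists_eqOn_iterate {n : ℕ} {D : Set (CSpace n)}
    {H : Set (CSpace n → CSpace n)} (hH : IsCompactAutGroup D H) {f : CSpace n → CSpace n}
    (hf : f ∈ H) (j : ℕ) : ∃ h ∈ H, EqOn f^[j] h D := by
  induction j with
  | zero =>
    obtain ⟨e, he, heq⟩ := hH.2.1
    exact ⟨e, he, fun z hz => (heq z hz).symm⟩
  | succ j ih =>
    obtain ⟨g, hg, hgeq⟩ := ih
    obtain ⟨h, hh, heq⟩ := hH.2.2.1 f hf g hg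
    refine ⟨h, hh, fun z hz => ?_⟩
    rw [heq z hz, Function.iterate_succ_apply', hgeq hz]

/-- Near any point of the closure, an element of the group with isolated fixed points has at most
one fixed point. -/
theorem IsCompactAutGroup.exists_subsingleton_fixOn {n : ℕ} {D V : Set (CSpace n)}
    {ρ : CSpace n → ℝ} (hD : IsOpen D) (hbdry : SmoothDefiningFn D V ρ)
    {H : Set (CSpace n → CSpace n)} (hH : IsCompactAutGroup D H) {C : ℝ} (hC : 0 ≤ C)
    (hbound : ∀ f ∈ H, HasC2Bound D C f) {x : CSpace n} (hx : x ∈ closure D) :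
    ∃ ε > 0, ∀ f ∈ H, DiscreteIn (FixOn D f) → (FixOn D f ∩ ball x ε).Subsingleton := by
  obtain ⟨ε₀, hε₀, M, hM, hpoly⟩ := hbdry.exists_polygon hD hx
  set A : ℝ := 6 * C * (M + 1) ^ 2 with hA
  have hA0 : 0 ≤ A := by positivity
  refine ⟨min ε₀ (1 / (4 * (A + 1))), lt_min hε₀ (by positivity), fun f hf hdisc => ?_⟩
  rintro p ⟨⟨hpD, hfp⟩, hpx⟩ q ⟨⟨hqD, hfq⟩, hqx⟩
  rw [mem_ball] at hpx hqx
  by_contra hpq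
  have hit : ∀ g ∈ H, ∀ j, HasC2Bound D C g^[j] := by
    intro g hg j
    obtain ⟨h, hh, heq⟩ := hH.exists_eqOn_iterate hg j
    exact (hbound h hh).congr hD heq
  obtain ⟨g, hg, hgf, hfg⟩ := hH.2.2.2.1 f hf
  have hv : q - p ≠ 0 := sub_ne_zero.2 (Ne.symm hpq)
  obtain ⟨e, he, h1, h2, h3⟩ := hpoly p hpD q hqD (lt_of_lt_of_le hpx (min_le_left _ _))
    (lt_of_lt_of_le hqx (min_le_left _ _))
  have hd0 : 0 ≤ ‖q - p‖ := norm_nonneg _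
  have hsmall : A * ‖q - p‖ ≤ 1 / 2 := by
    have ha : ‖q - p‖ ≤ 2 * (1 / (4 * (A + 1))) := by
      have ha1 := dist_triangle_right q p x
      rw [dist_eq_norm] at ha1
      have ha2 := lt_of_lt_of_le hpx (min_le_right _ _)
      have ha3 := lt_of_lt_of_le hqx (min_le_right _ _)
      linarith
    calc A * ‖q - p‖ ≤ (A + 1) * (2 * (1 / (4 * (A + 1)))) := by gcongr; linarith
      _ = 1 / 2 := by field_simp; norm_num
  have hdf : HasFDerivAt f (fderiv ℝ f p) p := ((hbound f hf) p hpD).1.hasFDerivAt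
  obtain ⟨w, hw, hLw⟩ := exists_ne_zero_fixed_of_pow_near (fderiv ℝ f p) (q - p) hv (by
    intro j
    have hj := (hit f hf j).polygon_estimate hC (l := (M + 1) * ‖q - p‖) h1 h2 h3
      (by nlinarith) (by nlinarith)
    rw [Function.iterate_fixed hfp, Function.iterate_fixed hfq, (hdf.iterate hfp j).fderiv,
      norm_sub_rev] at hj
    refine hj.trans ?_
    calc 6 * C * ((M + 1) * ‖q - p‖) ^ 2 = A * ‖q - p‖ * ‖q - p‖ := by ring
      _ ≤ 1 / 2 * ‖q - p‖ := by gcongr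
      _ = ‖q - p‖ / 2 := by ring)
  obtain ⟨δ, hδ, hiso⟩ := hdisc p ⟨hpD, hfp⟩
  obtain ⟨s, hs, hsD⟩ := Metric.isOpen_iff.1 hD p hpD
  obtain ⟨y, hyp, hyd, hfy⟩ := exists_fixed_near_of_HasC2Bound hD hC f g (hit f hf) (hit g hg)
    hgf hfg hpD hfp hw hLw (lt_min hδ hs)
  have := hiso y ⟨hsD (hyd.trans_le (min_le_right _ _)), hfy⟩ hyp
  linarith [min_le_left δ s]

theorem uniform_bound_smooth_boundary {n : ℕ} (D V : Set (CSpace n)) (ρ : CSpace n → ℝ)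
    (hDconn : IsConnected D) (hDopen : IsOpen D) (hDbdd : Bornology.IsBounded D)
    (hbdry : SmoothDefiningFn D V ρ)
    (hext : ∀ f : CSpace n → CSpace n, AutOn D f →
      ∃ F : CSpace n → CSpace n, SmoothDiffeoExt D f F)
    (hconv : SmoothConvergenceProperty D)
    (H : Set (CSpace n → CSpace n)) (hH : IsCompactAutGroup D H) :
    ∃ m : ℕ, ∀ f ∈ H, DiscreteIn (FixOn D f) →
      (FixOn D f).Finite ∧ (FixOn D f).ncard ≤ m := by
  obtain ⟨C, hC, hbound⟩ := hH.exists_hasC2Bound hDopen hDbdd hext hconv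
  have key : ∃ m : ℕ, ∀ f ∈ H, DiscreteIn (FixOn D f) →
      (FixOn D f ∩ closure D).Finite ∧ (FixOn D f ∩ closure D).ncard ≤ m := by
    refine hDbdd.isCompact_closure.induction_on
      (p := fun s => ∃ m : ℕ, ∀ f ∈ H, DiscreteIn (FixOn D f) →
        (FixOn D f ∩ s).Finite ∧ (FixOn D f ∩ s).ncard ≤ m) ⟨0, by simp⟩ ?_ ?_ ?_
    · rintro s t hst ⟨m, hm⟩
      refine ⟨m, fun f hf hd => ?_⟩
      obtain ⟨h1, h2⟩ := hm f hf hd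
      have hsub : FixOn D f ∩ s ⊆ FixOn D f ∩ t := inter_subset_inter_right _ hst
      exact ⟨h1.subset hsub, (ncard_le_ncard hsub h1).trans h2⟩
    · rintro s t ⟨m, hm⟩ ⟨m', hm'⟩
      refine ⟨m + m', fun f hf hd => ?_⟩
      obtain ⟨h1, h2⟩ := hm f hf hd
      obtain ⟨h1', h2'⟩ := hm' f hf hd
      rw [inter_union_distrib_left]
      exact ⟨h1.union h1', (ncard_union_le _ _).trans (add_le_add h2 h2')⟩
    · intro x hx
      obtain ⟨ε, hε, h⟩ := hH.exists_subsingleton_fixOn hDopen hbdry hC hbound hx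
      refine ⟨ball x ε, mem_nhdsWithin_of_mem_nhds (ball_mem_nhds x hε), 1, fun f hf hd => ?_⟩
      have hfin := (h f hf hd).finite
      have := hfin.to_subtype
      exact ⟨hfin, ncard_le_one_iff_subsingleton.2 (h f hf hd)⟩
  obtain ⟨m, hm⟩ := key
  refine ⟨m, fun f hf hd => ?_⟩
  have hsub : FixOn D f ∩ closure D = FixOn D f :=
    inter_eq_left.2 fun z hz => subset_closure hz.1
  simpa only [hsub] using hm f hf hd
end
end

section
/- Let D be a bounded domain in ℂ^n and let H be a compact subgroup of the automorphism group of D, i.e. H contains the identity, is closed under composition and inversion, and every sequence in H has a subsequence converging uniformly on compact subsets of D to an element of H. Assume every f ∈ H extends holomorphically to an open neighborhood of the closure of D. Then there exists a single domain U containing the closure of D such that every f ∈ H extends to an automorphism of U: for each f ∈ H there is a holomorphic bijection F : U → U with holomorphic inverse such that F = f on D. -/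
open Set Metric Filter Topology

noncomputable section

theorem mapsTo_closedBall_of_norm_le {α F : Type*} [SeminormedAddCommGroup F] {f : α → F}
    {s : Set α} {c : α} {M : ℝ} (hc : c ∈ s) (hM : ∀ z ∈ s, ‖f z‖ ≤ M) :
    MapsTo f s (closedBall (f c) (2 * M)) := by
  intro z hz
  rw [mem_closedBall, dist_eq_norm]
  linarith [norm_sub_le (f z) (f c), hM z hz, hM c hc]

section BoundedHolomorphic

variable {E F : Type*} [NormedAddCommGroup E] [NormedSpace ℂ E]
  [NormedAddCommGroup F] [NormedSpace ℂ F]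

theorem norm_fderiv_le_of_norm_le_ball {f : E → F} {c : E} {r M : ℝ} (hr : 0 < r)
    (hf : DifferentiableOn ℂ f (ball c r)) (hM : ∀ z ∈ ball c r, ‖f z‖ ≤ M) :
    ‖fderiv ℂ f c‖ ≤ 2 * M / r :=
  Complex.norm_fderiv_le_div_of_mapsTo_ball hf
    (mapsTo_closedBall_of_norm_le (mem_ball_self hr) hM) hr

theorem norm_sub_sub_fderiv_le_of_norm_le_ball {f : E → F} {c z : E} {r M : ℝ}
    (hf : DifferentiableOn ℂ f (ball c r)) (hM : ∀ w ∈ ball c r, ‖f w‖ ≤ M)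
    (hz : z ∈ ball c r) :
    ‖f z - f c - fderiv ℂ f c (z - c)‖ ≤ 4 * M / r ^ 2 * ‖z - c‖ ^ 2 := by
  have hr : 0 < r := nonempty_ball.1 ⟨z, hz⟩
  have hL := norm_fderiv_le_of_norm_le_ball hr hf hM
  have hfc : DifferentiableAt ℂ f c := hf.differentiableAt (ball_mem_nhds c hr)
  let g : E → F := fun w => f w - fderiv ℂ f c (w - c)
  have hg : DifferentiableOn ℂ g (ball c r) := hf.sub (by fun_prop)
  have hmaps : MapsTo g (ball c r) (closedBall (g c) (4 * M)) := by
    intro w hw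
    have h1 := mem_closedBall.1 (mapsTo_closedBall_of_norm_le (mem_ball_self hr) hM hw)
    have h2 : ‖fderiv ℂ f c (w - c)‖ ≤ 2 * M := by
      calc ‖fderiv ℂ f c (w - c)‖ ≤ ‖fderiv ℂ f c‖ * ‖w - c‖ := ContinuousLinearMap.le_opNorm _ _
        _ ≤ 2 * M / r * r := by
            have h3 : ‖w - c‖ ≤ r := (mem_ball_iff_norm.1 hw).le
            have h4 := (norm_nonneg _).trans hL
            gcongr
        _ = 2 * M := by field_simp
    rw [dist_eq_norm] at h1
    rw [mem_closedBall, dist_eq_norm]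
    have h5 : g w - g c = (f w - f c) - fderiv ℂ f c (w - c) := by simp [g]; abel
    rw [h5]
    linarith [norm_sub_le (f w - f c) (fderiv ℂ f c (w - c))]
  have ho : (g · - g c) =o[𝓝 c] (fun w => ‖w - c‖ ^ 1) := by
    have := hfc.hasFDerivAt.isLittleO.norm_right
    refine (this.congr_left fun w => ?_).congr_right fun w => (pow_one _).symm
    simp [g]; abel
  have key := Complex.dist_le_mul_div_pow_of_mapsTo_ball_of_isLittleO hg hmaps ho hz
  have h6 : g z - g c = f z - f c - fderiv ℂ f c (z - c) := by simp [g]; abel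
  rw [dist_eq_norm, dist_eq_norm, h6] at key
  refine key.trans_eq ?_
  rw [one_add_one_eq_two, div_pow]
  ring

/-- Montel's theorem, for ultrafilters: a family of holomorphic functions that is eventually
uniformly bounded on an open set converges pointwise to a holomorphic function. -/
theorem exists_differentiableOn_tendsto_ultrafilter [FiniteDimensional ℂ E]
    [FiniteDimensional ℂ F] {ι : Type*} (u : Ultrafilter ι) {f : ι → E → F} {U : Set E}
    (hU : IsOpen U) {M : ℝ}
    (hf : ∀ᶠ i in u, DifferentiableOn ℂ (f i) U ∧ ∀ z ∈ U, ‖f i z‖ ≤ M) :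
    ∃ g : E → F, DifferentiableOn ℂ g U ∧ (∀ z ∈ U, ‖g z‖ ≤ M) ∧
      ∀ z ∈ U, Tendsto (fun i => f i z) u (𝓝 (g z)) := by
  have : ProperSpace F := FiniteDimensional.proper ℂ F
  have : ProperSpace (E →L[ℂ] F) := FiniteDimensional.proper ℂ _
  have hlim : ∀ z, ∃ y, z ∈ U → ‖y‖ ≤ M ∧ Tendsto (fun i => f i z) u (𝓝 y) := by
    intro z
    by_cases hz : z ∈ U
    · have hmem : closedBall (0 : F) M ∈ u.map (fun i => f i z) := by
        rw [Ultrafilter.mem_map]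
        filter_upwards [hf] with i hi
        simpa using hi.2 z hz
      obtain ⟨y, hy, hle⟩ := (isCompact_closedBall (0 : F) M).ultrafilter_le_nhds' _ hmem
      exact ⟨y, fun _ => ⟨by simpa using hy, hle⟩⟩
    · exact ⟨0, fun h => absurd h hz⟩
  choose g hg using hlim
  refine ⟨g, fun c hc => ?_, fun z hz => (hg z hz).1, fun z hz => (hg z hz).2⟩
  obtain ⟨r, hr, hball⟩ := Metric.isOpen_iff.1 hU c hc
  have hmem : closedBall (0 : E →L[ℂ] F) (2 * M / r) ∈ u.map (fun i => fderiv ℂ (f i) c) := by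
    rw [Ultrafilter.mem_map]
    filter_upwards [hf] with i hi
    simpa using norm_fderiv_le_of_norm_le_ball hr (hi.1.mono hball) fun z hz => hi.2 z (hball hz)
  obtain ⟨L, -, hL⟩ := (isCompact_closedBall _ _).ultrafilter_le_nhds' _ hmem
  have hL : Tendsto (fun i => fderiv ℂ (f i) c) u (𝓝 L) := hL
  have hquad : ∀ z ∈ ball c r, ‖g z - g c - L (z - c)‖ ≤ 4 * M / r ^ 2 * ‖z - c‖ ^ 2 := by
    intro z hz
    have ht : Tendsto (fun i => ‖f i z - f i c - fderiv ℂ (f i) c (z - c)‖) u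
        (𝓝 ‖g z - g c - L (z - c)‖) :=
      ((((hg z (hball hz)).2).sub (hg c hc).2).sub
        ((ContinuousLinearMap.apply ℂ F (z - c)).continuous.tendsto L |>.comp hL)).norm
    refine le_of_tendsto ht ?_
    filter_upwards [hf] with i hi
    exact norm_sub_sub_fderiv_le_of_norm_le_ball (hi.1.mono hball)
      (fun w hw => hi.2 w (hball hw)) hz
  have hder : HasFDerivAt g L c := by
    refine .of_isLittleO (Asymptotics.IsBigO.trans_isLittleO (g := fun z => ‖z - c‖ ^ 2) ?_ ?_)
    · refine Asymptotics.IsBigO.of_bound (4 * M / r ^ 2) ?_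
      filter_upwards [ball_mem_nhds c hr] with z hz
      simpa using hquad z hz
    · have h0 : Tendsto (fun z => z - c) (𝓝 c) (𝓝 0) := by
        simpa using (continuous_id.sub continuous_const).tendsto (f := fun z : E => z - c) c
      exact (Asymptotics.isLittleO_norm_pow_id one_lt_two).comp_tendsto h0
  exact hder.differentiableAt.differentiableWithinAt

theorem eqOn_ball_of_eventuallyEq_of_differentiableOn [CompleteSpace F] {f g : E → F} {c : E}
    {r : ℝ} (hf : DifferentiableOn ℂ f (ball c r)) (hg : DifferentiableOn ℂ g (ball c r))
    (h : f =ᶠ[𝓝 c] g) : EqOn f g (ball c r) := by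
  intro w hw
  have hr : 0 < r := nonempty_ball.1 ⟨w, hw⟩
  let l : ℂ → E := fun t => t • (w - c) + c
  have hl : Differentiable ℂ l := by fun_prop
  have hl0 : l 0 = c := by simp [l]
  have hl1 : l 1 = w := by simp [l]
  have hopen : IsOpen (l ⁻¹' ball c r) := isOpen_ball.preimage hl.continuous
  have hconv : Convex ℝ (l ⁻¹' ball c r) :=
    (convex_ball c r).affine_preimage
      (((LinearMap.toSpanSingleton ℂ E (w - c)).restrictScalars ℝ).toAffineMap +
        AffineMap.const ℝ ℂ c)
  have hanal : ∀ {k : E → F}, DifferentiableOn ℂ k (ball c r) →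
      AnalyticOnNhd ℂ (k ∘ l) (l ⁻¹' ball c r) := fun hk =>
    (hk.comp hl.differentiableOn fun _ ht => ht).analyticOnNhd hopen
  have hev : f ∘ l =ᶠ[𝓝 0] g ∘ l := by
    have := hl.continuous.tendsto 0
    rw [hl0] at this
    exact this.eventually h
  have := (hanal hf).eqOn_of_preconnected_of_eventuallyEq (hanal hg) hconv.isPreconnected
    (by simpa [hl0] using hr) hev (show (1 : ℂ) ∈ l ⁻¹' ball c r by simpa [hl1] using hw)
  simpa [hl1] using this

/-- The identity theorem for holomorphic functions of several variables. -/
theorem eqOn_of_isPreconnected_of_differentiableOn [CompleteSpace F] {f g : E → F} {U D : Set E}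
    (hU : IsOpen U) (hUc : IsPreconnected U) (hf : DifferentiableOn ℂ f U)
    (hg : DifferentiableOn ℂ g U) (hD : IsOpen D) (hDne : D.Nonempty) (hDU : D ⊆ U)
    (h : EqOn f g D) : EqOn f g U := by
  let S : Set E := {z | f =ᶠ[𝓝 z] g}
  have hS : IsOpen S := isOpen_setOfPred_eventually_nhds
  have hDS : D ⊆ S := fun z hz => h.eventuallyEq_of_mem (hD.mem_nhds hz)
  obtain ⟨z₀, hz₀⟩ := hDne
  suffices closure S ∩ U ⊆ S from fun z hz => Filter.EventuallyEq.eq_of_nhds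
    (hUc.subset_of_closure_inter_subset hS ⟨z₀, hDU hz₀, hDS hz₀⟩ this hz)
  rintro w ⟨hwS, hwU⟩
  obtain ⟨r, hr, hball⟩ := Metric.isOpen_iff.1 hU w hwU
  obtain ⟨c, hcS, hc⟩ := Metric.mem_closure_iff.1 hwS (r / 2) (half_pos hr)
  have hsub : ball c (r / 2) ⊆ U :=
    (ball_subset_ball' (by rw [dist_comm] at hc; linarith)).trans hball
  exact (eqOn_ball_of_eventuallyEq_of_differentiableOn (hf.mono hsub) (hg.mono hsub)
    hcS).eventuallyEq_of_mem (isOpen_ball.mem_nhds hc)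

end BoundedHolomorphic

theorem IsConnected.thickening {E : Type*} [SeminormedAddCommGroup E] [NormedSpace ℝ E] {s : Set E}
    (hs : IsConnected s) {δ : ℝ} (hδ : 0 < δ) : IsConnected (thickening δ s) := by
  obtain ⟨x₀, hx₀⟩ := hs.nonempty
  have hsub := self_subset_thickening hδ s
  refine ⟨⟨x₀, hsub hx₀⟩, isPreconnected_of_forall x₀ fun y hy => ?_⟩
  obtain ⟨x, hx, hxy⟩ := mem_thickening_iff.1 hy
  exact ⟨s ∪ ball x δ, union_subset hsub (ball_subset_thickening hx δ), .inl hx₀, .inr hxy,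
    hs.isPreconnected.union x hx (mem_ball_self hδ) (convex_ball x δ).isPreconnected⟩

section BoundedExtension

variable {E F : Type*} [NormedAddCommGroup E] [NormedSpace ℂ E]
  [NormedAddCommGroup F] [NormedSpace ℂ F]

/-- `g` is a holomorphic extension of `f` from `D` to the `δ`-neighbourhood of `D`,
bounded by `M` there. -/
structure IsBoundedExtension (D : Set E) (δ M : ℝ) (f g : E → F) : Prop where
  differentiableOn : DifferentiableOn ℂ g (thickening δ D)
  norm_le : ∀ z ∈ thickening δ D, ‖g z‖ ≤ M
  eqOn : EqOn g f D

/-- `f` extends holomorphically from `D` to the `δ`-neighbourhood of `D`, with bound `M`. -/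
def HasBoundedExtension (D : Set E) (δ M : ℝ) (f : E → F) : Prop :=
  ∃ g, IsBoundedExtension D δ M f g

theorem IsBoundedExtension.mono {D : Set E} {δ δ' M M' : ℝ} {f g : E → F}
    (h : IsBoundedExtension D δ M f g) (hδ : δ' ≤ δ) (hM : M ≤ M') :
    IsBoundedExtension D δ' M' f g where
  differentiableOn := h.differentiableOn.mono (thickening_mono hδ D)
  norm_le z hz := (h.norm_le z (thickening_mono hδ D hz)).trans hM
  eqOn := h.eqOn

theorem HasBoundedExtension.mono {D : Set E} {δ δ' M M' : ℝ} {f : E → F}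
    (h : HasBoundedExtension D δ M f) (hδ : δ' ≤ δ) (hM : M ≤ M') :
    HasBoundedExtension D δ' M' f :=
  h.imp fun _ hg => hg.mono hδ hM

theorem HasBoundedExtension.congr {D : Set E} {δ M : ℝ} {f f' : E → F}
    (h : HasBoundedExtension D δ M f) (hff' : EqOn f f' D) : HasBoundedExtension D δ M f' :=
  h.imp fun _ hg => ⟨hg.1, hg.2, hg.3.trans hff'⟩

theorem exists_hasBoundedExtension [ProperSpace E] {D U : Set E} (hD : Bornology.IsBounded D)
    (hU : IsOpen U) (hDU : closure D ⊆ U) {f : E → F} (hf : DifferentiableOn ℂ f U) :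
    ∃ δ > 0, ∃ M, HasBoundedExtension D δ M f := by
  obtain ⟨δ, hδ, hsub⟩ := hD.isCompact_closure.exists_cthickening_subset_open hU hDU
  obtain ⟨M, hM⟩ := hD.isCompact_closure.cthickening.exists_bound_of_continuousOn
    (hf.continuousOn.mono hsub)
  have hsub' : thickening δ D ⊆ cthickening δ (closure D) := by
    rw [cthickening_closure]; exact thickening_subset_cthickening δ D
  exact ⟨δ, hδ, M, f, hf.mono (hsub'.trans hsub), fun z hz => hM z (hsub' hz), fun _ _ => rfl⟩

theorem exists_mapsTo_thickening (D : Set E) (D' : Set F) {δ η : ℝ} (hδ : 0 < δ) (hη : 0 < η)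
    (M : ℝ) :
    ∃ ε > 0, ε ≤ δ ∧ ∀ f g : E → F, IsBoundedExtension D δ M f g → MapsTo f D D' →
      MapsTo g (thickening ε D) (thickening η D') := by
  have hM : 0 < 2 * max M 1 := by positivity
  refine ⟨min δ (η * δ / (2 * max M 1)), by positivity, min_le_left _ _, fun f g hg hf z hz => ?_⟩
  obtain ⟨w, hw, hzw⟩ := mem_thickening_iff.1 hz
  rw [lt_min_iff, lt_div_iff₀ hM] at hzw
  have hsub := ball_subset_thickening hw δ
  have hdist := Complex.dist_le_div_mul_dist_of_mapsTo_ball (hg.differentiableOn.mono hsub)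
    (mapsTo_closedBall_of_norm_le (mem_ball_self hδ) fun x hx => (hg.norm_le x (hsub hx)).trans
      (le_max_left M 1)) (mem_ball.2 hzw.1)
  refine mem_thickening_iff.2 ⟨f w, hf hw, ?_⟩
  rw [← hg.eqOn hw]
  refine hdist.trans_lt ?_
  rw [div_mul_eq_mul_div, div_lt_iff₀ hδ]
  linarith

theorem exists_hasBoundedExtension_comp {D : Set E} {δ η M M' : ℝ} (hδ : 0 < δ) (hη : 0 < η)
    {p : E → F} (hp : HasBoundedExtension D η M' p) :
    ∃ ε > 0, ∀ h : E → E, MapsTo h D D → HasBoundedExtension D δ M h →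
      HasBoundedExtension D ε M' (p ∘ h) := by
  obtain ⟨P, hP⟩ := hp
  obtain ⟨ε, hε, hεδ, hmaps⟩ := exists_mapsTo_thickening D D hδ hη M
  refine ⟨ε, hε, fun h hh ⟨k, hk⟩ => ⟨P ∘ k, ?_, fun z hz => hP.norm_le _ (hmaps h k hk hh hz),
    fun z hz => ?_⟩⟩
  · exact hP.differentiableOn.comp (hk.mono hεδ le_rfl).differentiableOn (hmaps h k hk hh)
  · simp [hk.eqOn hz, hP.eqOn (hh hz)]

/-- Having a bounded extension is preserved under limits that are only assumed pointwise on a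
dense sequence. -/
theorem isClosed_setOf_hasBoundedExtension [FiniteDimensional ℂ E] [FiniteDimensional ℂ F]
    {D : Set E} {δ M : ℝ} (hδ : 0 < δ) {x : ℕ → E} (hxD : ∀ i, x i ∈ D)
    (hx : D ⊆ closure (range x)) (H : Set (E → F)) (hH : ∀ f ∈ H, ContinuousOn f D) :
    IsClosed {y : (fun (f : E → F) i => f (x i)) '' H |
      ∃ f ∈ H, HasBoundedExtension D δ M f ∧ (fun i => f (x i)) = y.1} := by
  rw [isClosed_iff_ultrafilter]
  intro y u hu hmem
  obtain ⟨f, hf, hfy⟩ := y.2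
  have hex : ∀ y' : (fun (f : E → F) i => f (x i)) '' H, ∃ g : E → F,
      (∃ f ∈ H, HasBoundedExtension D δ M f ∧ (fun i => f (x i)) = y'.1) →
      (DifferentiableOn ℂ g (thickening δ D) ∧ ∀ z ∈ thickening δ D, ‖g z‖ ≤ M) ∧
        ∀ i, g (x i) = y'.1 i := by
    intro y'
    by_cases h : ∃ f ∈ H, HasBoundedExtension D δ M f ∧ (fun i => f (x i)) = y'.1
    · obtain ⟨f, -, ⟨g, hg⟩, hfy⟩ := h
      exact ⟨g, fun _ => ⟨⟨hg.1, hg.2⟩, fun i => by rw [hg.eqOn (hxD i), ← hfy]⟩⟩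
    · exact ⟨0, fun h' => absurd h' h⟩
  choose g hg using hex
  have hev : ∀ᶠ y' in u, (DifferentiableOn ℂ (g y') (thickening δ D) ∧
      ∀ z ∈ thickening δ D, ‖g y' z‖ ≤ M) ∧ ∀ i, g y' (x i) = y'.1 i := by
    filter_upwards [hmem] with y' hy' using hg y' hy'
  obtain ⟨G, hGd, hGM, hG⟩ := exists_differentiableOn_tendsto_ultrafilter u isOpen_thickening
    (hev.mono fun _ h => h.1)
  have hDsub := self_subset_thickening hδ D
  have hGx : ∀ i, G (x i) = f (x i) := by
    intro i
    have h1 : Tendsto (fun y' : (fun (f : E → F) i => f (x i)) '' H => y'.1 i) u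
        (𝓝 (y.1 i)) :=
      (((continuous_apply i).comp continuous_subtype_val).tendsto y).mono_left hu
    have h2 := (hG _ (hDsub (hxD i))).congr' (hev.mono fun _ h => h.2 i)
    rw [tendsto_nhds_unique h2 h1, ← hfy]
  refine ⟨f, hf, ⟨G, hGd, hGM, ?_⟩, hfy⟩
  exact EqOn.of_subset_closure (s := range x) (by rintro _ ⟨i, rfl⟩; exact hGx i)
    (hGd.continuousOn.mono hDsub) (hH f hf) (range_subset_iff.2 hxD) hx

end BoundedExtension

theorem IsCompactAutGroup.exists_uniform_hasBoundedExtension {n : ℕ} {D : Set (CSpace n)}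
    (hDopen : IsOpen D) (hDne : D.Nonempty) (hDbdd : Bornology.IsBounded D)
    {H : Set (CSpace n → CSpace n)} (hH : IsCompactAutGroup D H)
    (hext : ∀ f ∈ H, ExtendsHolo D f) :
    ∃ δ > 0, ∃ M, ∀ f ∈ H, HasBoundedExtension D δ M f := by
  obtain ⟨haut, ⟨e, heH, -⟩, hcomp, hinv, hseq⟩ := hH
  have hmaps : ∀ f ∈ H, MapsTo f D D := fun f hf => (haut f hf).2.1.mapsTo
  have hcont : ∀ f ∈ H, ContinuousOn f D := fun f hf => (haut f hf).1.continuousOn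
  have hext' : ∀ f ∈ H, ∃ δ > 0, ∃ M, HasBoundedExtension D δ M f := by
    intro f hf
    obtain ⟨U, hU, hDU, F, hF, hFf⟩ := hext f hf
    obtain ⟨δ, hδ, M, h⟩ := exists_hasBoundedExtension hDbdd hU hDU hF
    exact ⟨δ, hδ, M, h.congr hFf⟩
  have hlim : ∀ u : ℕ → CSpace n → CSpace n, (∀ k, u k ∈ H) → ∃ φ : ℕ → ℕ, StrictMono φ ∧
      ∃ f ∈ H, ∀ z ∈ D, Tendsto (fun k => u (φ k) z) atTop (𝓝 (f z)) := by
    intro u hu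
    obtain ⟨φ, hφ, f, hf, h⟩ := hseq u hu
    exact ⟨φ, hφ, f, hf, fun z hz =>
      (h {z} (singleton_subset_iff.2 hz) isCompact_singleton).tendsto_at (mem_singleton z)⟩
  obtain ⟨x, hxD, hx⟩ : ∃ x : ℕ → CSpace n, (∀ i, x i ∈ D) ∧ D ⊆ closure (range x) := by
    have := hDne.to_subtype
    obtain ⟨u, hu⟩ := TopologicalSpace.exists_dense_seq D
    refine ⟨fun i => u i, fun i => (u i).2, fun z hz => ?_⟩
    have := image_closure_subset_closure_image continuous_subtype_val
      (mem_image_of_mem Subtype.val (hu ⟨z, hz⟩))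
    rwa [← range_comp] at this
  let ev : (CSpace n → CSpace n) → ℕ → CSpace n := fun f i => f (x i)
  have hinj : ∀ f ∈ H, ∀ g ∈ H, ev f = ev g → EqOn f g D := fun f hf g hg h =>
    EqOn.of_subset_closure (s := range x) (by rintro _ ⟨i, rfl⟩; exact congrFun h i)
      (hcont f hf) (hcont g hg) (range_subset_iff.2 hxD) hx
  have hK : IsCompact (ev '' H) := by
    refine IsSeqCompact.isCompact fun y hy => ?_
    choose u hu huy using hy
    obtain ⟨φ, hφ, f, hf, h⟩ := hlim u hu
    refine ⟨ev f, mem_image_of_mem ev hf, φ, hφ, tendsto_pi_nhds.2 fun i => ?_⟩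
    exact (h _ (hxD i)).congr fun k => by simp [← huy, ev]
  have := isCompact_iff_compactSpace.1 hK
  have : Nonempty (ev '' H) := ⟨⟨_, mem_image_of_mem ev heH⟩⟩
  obtain ⟨k, y₀, hy₀⟩ := nonempty_interior_of_iUnion_of_closed (X := ev '' H)
    (fun k : ℕ => isClosed_setOf_hasBoundedExtension (δ := 1 / ((k : ℝ) + 1)) (M := k)
      Nat.one_div_pos_of_nat hxD hx H hcont) (by
    refine eq_univ_of_forall fun ⟨y, f, hf, hfy⟩ => ?_
    obtain ⟨δ, hδ, M, h⟩ := hext' f hf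
    obtain ⟨k₁, hk₁⟩ := exists_nat_one_div_lt hδ
    obtain ⟨k₂, hk₂⟩ := exists_nat_ge M
    refine mem_iUnion.2 ⟨max k₁ k₂, f, hf, h.mono ?_ ?_, hfy⟩
    · exact (Nat.one_div_le_one_div (le_max_left k₁ k₂)).trans hk₁.le
    · exact hk₂.trans (by exact_mod_cast le_max_right k₁ k₂))
  obtain ⟨_, f₀, hf₀, rfl⟩ := y₀
  by_contra! hno
  have hno' : ∀ m : ℕ, ∃ f ∈ H, ¬ HasBoundedExtension D (1 / ((m : ℝ) + 1)) m f := fun m =>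
    hno _ Nat.one_div_pos_of_nat m
  choose u hu hu' using hno'
  obtain ⟨φ, hφ, g, hg, hug⟩ := hlim u hu
  obtain ⟨g', hg', hg'g, -⟩ := hinv g hg
  obtain ⟨q, hq, hqfg⟩ := hcomp f₀ hf₀ g' hg'
  obtain ⟨p, hp, hpq, -⟩ := hinv q hq
  choose h hh hhq using fun m => hcomp q hq (u (φ m)) (hu (φ m))
  have hlim_h : Tendsto (fun m => (⟨ev (h m), mem_image_of_mem ev (hh m)⟩ : ev '' H)) atTop
      (𝓝 ⟨ev f₀, mem_image_of_mem ev hf₀⟩) := by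
    refine tendsto_subtype_rng.2 (tendsto_pi_nhds.2 fun i => ?_)
    have hgx := hmaps g hg (hxD i)
    have hqc : Tendsto q (𝓝 (g (x i))) (𝓝 (f₀ (x i))) := by
      have := (hcont q hq).continuousAt (hDopen.mem_nhds hgx)
      rwa [ContinuousAt, hqfg _ hgx, hg'g _ (hxD i)] at this
    exact (hqc.comp (hug _ (hxD i))).congr fun m => (hhq m _ (hxD i)).symm
  obtain ⟨η, hη, M', hpext⟩ := hext' p hp
  obtain ⟨ε, hε, hcompext⟩ := exists_hasBoundedExtension_comp (δ := 1 / ((k : ℝ) + 1)) (M := k)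
    Nat.one_div_pos_of_nat hη hpext
  obtain ⟨k₁, hk₁⟩ := exists_nat_one_div_lt hε
  obtain ⟨k₂, hk₂⟩ := exists_nat_ge M'
  obtain ⟨m, ⟨f', hf', hf'ext, hf'h⟩, hm⟩ := ((hlim_h.eventually
    (mem_interior_iff_mem_nhds.1 hy₀)).and (eventually_ge_atTop (max k₁ k₂))).exists
  have hmφ : max k₁ k₂ ≤ φ m := hm.trans hφ.le_apply
  have hext_h := hf'ext.congr (hinj f' hf' _ (hh m) hf'h)
  refine hu' (φ m) (((hcompext _ (hmaps _ (hh m)) hext_h).congr fun z hz => ?_).mono ?_ ?_)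
  · rw [Function.comp_apply, hhq m z hz, hpq _ (hmaps _ (hu _) hz)]
  · exact (Nat.one_div_le_one_div ((le_max_left k₁ k₂).trans hmφ)).trans hk₁.le
  · exact hk₂.trans (by exact_mod_cast (le_max_right k₁ k₂).trans hmφ)

theorem uniform_extension_of_compact_subgroup {n : ℕ} (D : Set (CSpace n))
    (hDopen : IsOpen D) (hDconn : IsConnected D) (hDbdd : Bornology.IsBounded D)
    (H : Set (CSpace n → CSpace n)) (hH : IsCompactAutGroup D H)
    (hext : ∀ f ∈ H, ExtendsHolo D f) :
    ∃ U : Set (CSpace n), IsOpen U ∧ IsConnected U ∧ closure D ⊆ U ∧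
      ∀ f ∈ H, ∃ F : CSpace n → CSpace n,
        DifferentiableOn ℂ F U ∧ Set.BijOn F U U ∧ Set.EqOn F f D ∧
        ∃ G : CSpace n → CSpace n, DifferentiableOn ℂ G U ∧
          (∀ z ∈ U, G (F z) = z) ∧ (∀ z ∈ U, F (G z) = z) := by
  obtain ⟨δ, hδ, M, hbdd⟩ :=
    hH.exists_uniform_hasBoundedExtension hDopen hDconn.nonempty hDbdd hext
  obtain ⟨haut, ⟨e, heH, he⟩, hcomp, hinv, -⟩ := hH
  have hmaps : ∀ f ∈ H, MapsTo f D D := fun f hf => (haut f hf).2.1.mapsTo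
  have hbdd' : ∀ f, ∃ F, f ∈ H → IsBoundedExtension D δ M f F := fun f => by
    by_cases hf : f ∈ H
    · exact (hbdd f hf).imp fun F hF _ => hF
    · exact ⟨f, fun h => absurd h hf⟩
  choose X hX using hbdd'
  obtain ⟨ε₁, hε₁, hε₁δ, h₁⟩ := exists_mapsTo_thickening D D hδ hδ M
  obtain ⟨ε₂', hε₂', -, h₂⟩ := exists_mapsTo_thickening D D hδ hε₁ M
  let ε₂ := min ε₂' ε₁
  have hε₂ : 0 < ε₂ := lt_min hε₂' hε₁
  replace h₁ : ∀ f ∈ H, MapsTo (X f) (thickening ε₁ D) (thickening δ D) := fun f hf =>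
    h₁ f _ (hX f hf) (hmaps f hf)
  replace h₂ : ∀ f ∈ H, MapsTo (X f) (thickening ε₂ D) (thickening ε₁ D) := fun f hf =>
    (h₂ f _ (hX f hf) (hmaps f hf)).mono_left (thickening_mono (min_le_left _ _) D)
  have hdiff : ∀ f ∈ H, DifferentiableOn ℂ (X f) (thickening ε₁ D) := fun f hf =>
    (hX f hf).differentiableOn.mono (thickening_mono hε₁δ D)
  have hident : ∀ F G : CSpace n → CSpace n, DifferentiableOn ℂ F (thickening ε₁ D) →
      DifferentiableOn ℂ G (thickening ε₁ D) → EqOn F G D → EqOn F G (thickening ε₁ D) :=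
    fun F G hF hG => eqOn_of_isPreconnected_of_differentiableOn isOpen_thickening
      (hDconn.thickening hε₁).isPreconnected hF hG hDopen hDconn.nonempty
      (self_subset_thickening hε₁ D)
  have hdiff_comp : ∀ f ∈ H, ∀ g ∈ H, DifferentiableOn ℂ (X f ∘ X g) (thickening ε₁ D) :=
    fun f hf g hg => (hX f hf).differentiableOn.comp (hdiff g hg) (h₁ g hg)
  have hX_comp : ∀ f ∈ H, ∀ g ∈ H, ∀ z ∈ D, X f (X g z) = f (g z) := fun f hf g hg z hz => by
    rw [(hX g hg).eqOn hz, (hX f hf).eqOn (hmaps g hg hz)]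
  have hmul : ∀ f ∈ H, ∀ g ∈ H, ∃ h ∈ H, ∀ z ∈ thickening ε₁ D, X f (X g z) = X h z := by
    intro f hf g hg
    obtain ⟨h, hh, hhfg⟩ := hcomp f hf g hg
    refine ⟨h, hh, hident _ _ (hdiff_comp f hf g hg) (hdiff h hh) fun z hz => ?_⟩
    rw [hX_comp f hf g hg z hz, (hX h hh).eqOn hz, hhfg z hz]
  have hleft : ∀ f ∈ H, ∀ g ∈ H, (∀ z ∈ D, g (f z) = z) →
      ∀ z ∈ thickening ε₁ D, X g (X f z) = z := fun f hf g hg hgf =>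
    hident _ id (hdiff_comp g hg f hf) differentiableOn_id fun z hz =>
      (hX_comp g hg f hf z hz).trans (hgf z hz)
  have hone : ∀ z ∈ thickening ε₁ D, X e z = z :=
    hident _ id (hdiff e heH) differentiableOn_id fun z hz => ((hX e heH).eqOn hz).trans (he z hz)
  have hε₂ε₁ : thickening ε₂ D ⊆ thickening ε₁ D := thickening_mono (min_le_right _ _) D
  let U : Set (CSpace n) := ⋃ f ∈ H, X f '' thickening ε₂ D
  have hUsub : U ⊆ thickening ε₁ D := iUnion₂_subset fun f hf => (h₂ f hf).image_subset
  have hUmaps : ∀ f ∈ H, MapsTo (X f) U U := by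
    intro f hf z hz
    obtain ⟨g, hg, w, hw, rfl⟩ := mem_iUnion₂.1 hz
    obtain ⟨h, hh, hhfg⟩ := hmul f hf g hg
    exact mem_iUnion₂.2 ⟨h, hh, w, hw, (hhfg w (hε₂ε₁ hw)).symm⟩
  have hDimage : ∀ f ∈ H, D ⊆ X f '' thickening ε₂ D := by
    intro f hf z hz
    obtain ⟨g, hg, -, hfg⟩ := hinv f hf
    exact ⟨g z, self_subset_thickening hε₂ D (hmaps g hg hz), by
      rw [(hX f hf).eqOn (hmaps g hg hz), hfg z hz]⟩
  refine ⟨U, isOpen_biUnion fun f hf => ?_, ⟨?_, ?_⟩, ?_, fun f hf => ?_⟩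
  · obtain ⟨g, hg, hgf, hfg⟩ := hinv f hf
    have himage : X f '' thickening ε₂ D = thickening ε₁ D ∩ X g ⁻¹' thickening ε₂ D := by
      ext w
      constructor
      · rintro ⟨z, hz, rfl⟩
        exact ⟨h₂ f hf hz, by rwa [mem_preimage, hleft f hf g hg hgf z (hε₂ε₁ hz)]⟩
      · rintro ⟨hw, hgw⟩
        exact ⟨X g w, hgw, hleft g hg f hf hfg w hw⟩
    rw [himage]
    exact (hdiff g hg).continuousOn.isOpen_inter_preimage isOpen_thickening isOpen_thickening
  · obtain ⟨z, hz⟩ := hDconn.nonempty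
    exact ⟨z, mem_iUnion₂.2 ⟨e, heH, hDimage e heH hz⟩⟩
  · obtain ⟨z, hz⟩ := hDconn.nonempty
    refine isPreconnected_of_forall z fun y hy => ?_
    obtain ⟨f, hf, hyf⟩ := mem_iUnion₂.1 hy
    exact ⟨_, subset_biUnion_of_mem (u := fun f => X f '' thickening ε₂ D) hf, hDimage f hf hz,
      hyf, (hDconn.thickening hε₂).isPreconnected.image _ ((hdiff f hf).continuousOn.mono hε₂ε₁)⟩
  · intro z hz
    have hz₂ := closure_subset_thickening hε₂ D hz
    exact mem_iUnion₂.2 ⟨e, heH, z, hz₂, hone z (hε₂ε₁ hz₂)⟩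
  · obtain ⟨g, hg, hgf, hfg⟩ := hinv f hf
    have hGF : ∀ z ∈ U, X g (X f z) = z := fun z hz => hleft f hf g hg hgf z (hUsub hz)
    have hFG : ∀ z ∈ U, X f (X g z) = z := fun z hz => hleft g hg f hf hfg z (hUsub hz)
    exact ⟨X f, (hdiff f hf).mono hUsub,
      InvOn.bijOn ⟨hGF, hFG⟩ (hUmaps f hf) (hUmaps g hg), (hX f hf).eqOn,
      X g, (hdiff g hg).mono hUsub, hGF, hFG⟩
end
end

section
/- For every integer n ≥ 1 there exists ε > 0, depending only on n, such that for all real numbers v_1, …, v_n, none of which is an integer, there exists a positive integer k with ‖k·v_j‖ ≥ ε for every j = 1, …, n, where ‖x‖ denotes the distance from the real number x to the nearest integer. -/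
/-- If no multiple `t * w` with `1 ≤ t ≤ 2 * L` is an integer, then some multiple `g * w` has its
first `L - 1` multiples at distance at least `1 / (2 * L)` from the integers. -/
theorem exists_nat_mul_separated {L : ℕ} (hL : 0 < L) {w : ℝ}
    (hw : ∀ t : ℕ, 0 < t → t ≤ 2 * L → ∀ m : ℤ, (t : ℝ) * w ≠ m) :
    ∃ g : ℕ, ∀ a : ℕ, 0 < a → a < L → ∀ m : ℤ, 1 / (2 * L : ℝ) ≤ |(a : ℝ) * (g * w) - m| := by
  obtain ⟨d, hd0, hdL, hd⟩ := Real.exists_nat_abs_mul_sub_round_le w (n := 2 * L) (by omega)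
  set p := round ((d : ℝ) * w)
  set δ := (d : ℝ) * w - p with hδ
  have hδ0 : 0 < |δ| := abs_pos.2 (sub_ne_zero.2 (hw d hd0 hdL p))
  have hL' : (0 : ℝ) < L := by exact_mod_cast hL
  have hδL : |δ| ≤ 1 / (2 * L : ℝ) := by
    refine hd.trans ?_
    push_cast
    gcongr
    linarith
  have hhalf : 1 / (L : ℝ) = 1 / (2 * L) + 1 / (2 * L) := by field_simp; norm_num
  set s := ⌊1 / (L : ℝ) / |δ|⌋₊
  have hs₁ : s * |δ| ≤ 1 / (L : ℝ) :=
    (le_div_iff₀ hδ0).1 (Nat.floor_le (by positivity))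
  have hs₂ : 1 / (2 * L : ℝ) ≤ s * |δ| := by
    have := (div_lt_iff₀ hδ0).1 (Nat.lt_floor_add_one (1 / (L : ℝ) / |δ|))
    linarith
  refine ⟨s * d, fun a ha haL m => ?_⟩
  have ha' : (1 : ℝ) ≤ a := by exact_mod_cast ha
  have haL' : (a : ℝ) + 1 ≤ L := by exact_mod_cast haL
  have hsplit : (a : ℝ) * ((s * d : ℕ) * w) - m = a * s * δ - (m - a * s * p : ℤ) := by
    rw [hδ]
    push_cast
    ring
  have habs : |a * s * δ| = a * (s * |δ|) := by
    rw [abs_mul, abs_mul, Nat.abs_cast, Nat.abs_cast, mul_assoc]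
  rw [hsplit]
  generalize m - a * s * p = q
  rcases eq_or_ne q 0 with rfl | hq
  · rw [Int.cast_zero, sub_zero, habs]
    nlinarith [hs₂, show 0 < 1 / (2 * L : ℝ) by positivity]
  · have hq' : (1 : ℝ) ≤ |(q : ℝ)| := by exact_mod_cast Int.one_le_abs hq
    have hle : a * (s * |δ|) ≤ 1 - 1 / (L : ℝ) := by
      calc a * (s * |δ|) ≤ (L - 1) * (1 / (L : ℝ)) := by
            exact mul_le_mul (by linarith) hs₁ (by positivity) (by linarith)
        _ = 1 - 1 / (L : ℝ) := by field_simp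
    have htri := abs_sub_abs_le_abs_sub (q : ℝ) (a * s * δ)
    rw [abs_sub_comm, habs] at htri
    have : 0 < 1 / (2 * L : ℝ) := by positivity
    linarith

/-- A union bound: if on each line parallel to the `j`-th axis of the cube `[L]ⁿ` at most one point
is bad for `j`, and `n < L`, then some point is bad for no `j`. -/
theorem exists_forall_not_of_unique_on_lines {n L : ℕ} (hn : n < L)
    (bad : Fin n → (Fin n → Fin L) → Prop)
    (h : ∀ j a b, (∀ i, i ≠ j → a i = b i) → bad j a → bad j b → a = b) :
    ∃ a, ∀ j, ¬ bad j a := by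
  classical
  rcases Nat.eq_zero_or_pos n with rfl | hpos
  · exact ⟨fun i => i.elim0, fun j => j.elim0⟩
  by_contra! hcon
  have hcard : ∀ j, (Finset.univ.filter (bad j)).card ≤ L ^ (n - 1) := by
    intro j
    have hinj := Finset.card_le_card_of_injOn (s := Finset.univ.filter (bad j))
      (t := (Finset.univ : Finset ({i // i ≠ j} → Fin L))) (fun a i => a i)
      (fun _ _ => Finset.mem_univ _) (fun a ha b hb hab =>
        h j a b (fun i hi => congrFun hab ⟨i, hi⟩) (by simpa using ha) (by simpa using hb))
    simpa [Fintype.card_subtype_compl] using hinj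
  have hcover : (Finset.univ : Finset (Fin n → Fin L)) ⊆
      Finset.univ.biUnion fun j => Finset.univ.filter (bad j) := by
    intro a _
    obtain ⟨j, hj⟩ := hcon a
    simp only [Finset.mem_biUnion, Finset.mem_filter, Finset.mem_univ, true_and]
    exact ⟨j, hj⟩
  have hle := (Finset.card_le_card hcover).trans
    (Finset.card_biUnion_le_card_mul _ _ _ fun j _ => hcard j)
  simp only [Finset.card_univ, Fintype.card_fun, Fintype.card_fin] at hle
  have hpow : L ^ n = L * L ^ (n - 1) := by
    rw [← pow_succ', Nat.sub_add_cancel hpos]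
  have : 0 < L ^ (n - 1) := pow_pos (by omega) _
  nlinarith

/-- An increasing sequence of subsets of an `n`-element set is stationary at some step `i ≤ n`. -/
theorem exists_eq_succ_of_monotone_finset {n : ℕ} {S : ℕ → Finset (Fin n)} (hS : Monotone S) :
    ∃ i ≤ n, S i = S (i + 1) := by
  by_contra! hne
  have hcard : ∀ i ≤ n + 1, i ≤ (S i).card := by
    intro i
    induction i with
    | zero => simp
    | succ i ih =>
      intro hi
      have := Finset.card_lt_card ((hS (Nat.le_add_right i 1)).lt_of_ne (hne i (by omega)))
      have := ih (by omega)
      omega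
  have := hcard (n + 1) le_rfl
  have := Finset.card_le_univ (S (n + 1))
  simp only [Fintype.card_fin] at this
  omega

/-- A rapidly growing sequence of moduli, in which `t * rabbitModulus L i` divides the next term
for every `1 ≤ t ≤ 2 * L`. -/
def rabbitModulus (L : ℕ) : ℕ → ℕ
  | 0 => 1
  | i + 1 => (2 * L * rabbitModulus L i).factorial

theorem rabbitModulus_pos (L : ℕ) : ∀ i, 0 < rabbitModulus L i
  | 0 => Nat.one_pos
  | _ + 1 => Nat.factorial_pos _

theorem mul_rabbitModulus_dvd_succ {L t : ℕ} (ht : 0 < t) (htL : t ≤ 2 * L) (i : ℕ) :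
    t * rabbitModulus L i ∣ rabbitModulus L (i + 1) :=
  Nat.dvd_factorial (Nat.mul_pos ht (rabbitModulus_pos L i)) (Nat.mul_le_mul_right _ htL)

theorem rabbitModulus_dvd {L : ℕ} (hL : 0 < L) {i j : ℕ} (h : i ≤ j) :
    rabbitModulus L i ∣ rabbitModulus L j := by
  induction j, h using Nat.le_induction with
  | base => exact dvd_rfl
  | succ j _ ih =>
    exact ih.trans (by simpa using mul_rabbitModulus_dvd_succ Nat.one_pos (by omega : 1 ≤ 2 * L) j)

theorem exists_int_mul_eq_of_dvd {M N : ℕ} (h : M ∣ N) {x : ℝ} (hx : ∃ z : ℤ, (M : ℝ) * x = z) :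
    ∃ z : ℤ, (N : ℝ) * x = z := by
  obtain ⟨c, rfl⟩ := h
  obtain ⟨z, hz⟩ := hx
  exact ⟨c * z, by push_cast; rw [← hz]; ring⟩

/-- A non-integer `x` with `M * x` an integer is at distance at least `1 / M` from the integers. -/
theorem one_div_le_abs_sub_int {M : ℕ} (hM : 0 < M) {x : ℝ} (hx : ∀ m : ℤ, x ≠ m)
    {z : ℤ} (hz : (M : ℝ) * x = z) (m : ℤ) : 1 / (M : ℝ) ≤ |x - m| := by
  have hM' : (0 : ℝ) < M := by exact_mod_cast hM
  have hmul : (M : ℝ) * (x - m) = (z - M * m : ℤ) := by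
    push_cast
    rw [← hz]
    ring
  have hne : z - M * m ≠ 0 := by
    intro h
    rw [h, Int.cast_zero, mul_eq_zero] at hmul
    exact hx m (sub_eq_zero.1 (hmul.resolve_left hM'.ne'))
  have hone : (1 : ℝ) ≤ |((z - M * m : ℤ) : ℝ)| := by exact_mod_cast Int.one_le_abs hne
  rw [← hmul, abs_mul, Nat.abs_cast] at hone
  rwa [div_le_iff₀' hM']

/-- Simultaneous avoidance along an arithmetic progression: if no `w j` has a small multiple that is
an integer, then some common multiple pushes every `u j + m * w j` away from the integers. -/
theorem exists_nat_forall_le_abs_add_mul_sub {n L : ℕ} (hn : n < L) (J : Finset (Fin n))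
    (u w : Fin n → ℝ)
    (hw : ∀ j ∈ J, ∀ t : ℕ, 0 < t → t ≤ 2 * L → ∀ m : ℤ, (t : ℝ) * w j ≠ m) :
    ∃ m : ℕ, ∀ j ∈ J, ∀ q : ℤ, 1 / (4 * L : ℝ) ≤ |u j + m * w j - q| := by
  have hsep : ∀ j, ∃ g : ℕ, j ∈ J → ∀ a : ℕ, 0 < a → a < L → ∀ m : ℤ,
      1 / (2 * L : ℝ) ≤ |(a : ℝ) * (g * w j) - m| := by
    intro j
    by_cases hj : j ∈ J
    · obtain ⟨g, hg⟩ := exists_nat_mul_separated (by omega) (hw j hj)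
      exact ⟨g, fun _ => hg⟩
    · exact ⟨0, fun h => absurd h hj⟩
  choose g hg using hsep
  let c : (Fin n → Fin L) → ℕ := fun a => ∑ i, (a i : ℕ) * g i
  obtain ⟨a, ha⟩ := exists_forall_not_of_unique_on_lines hn
    (fun j a => j ∈ J ∧ ∃ q : ℤ, |u j + c a * w j - q| < 1 / (4 * L : ℝ)) (by
      rintro j a b hab ⟨hj, q, hq⟩ ⟨-, r, hr⟩
      by_contra hne
      wlog hlt : (b j : ℕ) < a j generalizing a b q r
      · refine this b a (fun i hi => (hab i hi).symm) r hr q hq (Ne.symm hne) ?_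
        refine lt_of_le_of_ne (not_lt.1 hlt) fun h => hne (funext fun i => ?_)
        by_cases hi : i = j
        · subst hi
          exact Fin.ext h
        · exact hab i hi
      have hc : (c a : ℝ) - c b = ((a j - b j : ℕ) : ℝ) * g j := by
        simp only [c]
        push_cast [Nat.cast_sub hlt.le]
        rw [← Finset.sum_sub_distrib, Finset.sum_eq_single j]
        · ring
        · intro i _ hi
          rw [hab i hi, sub_self]
        · simp
      have hfar := hg j hj (a j - b j) (by omega) (by omega) (q - r)
      have heq : ((a j - b j : ℕ) : ℝ) * (g j * w j) - (q - r : ℤ) =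
          (u j + c a * w j - q) - (u j + c b * w j - r) := by
        rw [← mul_assoc, ← hc]
        push_cast
        ring
      rw [heq] at hfar
      have htri := abs_sub (u j + c a * w j - q) (u j + c b * w j - r)
      have hhalf : 1 / (2 * L : ℝ) = 1 / (4 * L) + 1 / (4 * L) := by
        have : (0 : ℝ) < L := by exact_mod_cast (by omega : 0 < L)
        field_simp
        norm_num
      linarith)
  refine ⟨c a, fun j hj q => ?_⟩
  by_contra! hlt
  exact ha j ⟨hj, q, hlt⟩

/-- Positivity of the Rabbit value: for every `n ≥ 1` there is `ε > 0` such that for all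
real numbers `v₁, …, vₙ`, none of which is an integer, some positive integer multiple
pushes every `vⱼ` at distance at least `ε` from the integers. Here the distance of `x`
to the nearest integer is `|x - round x|`. -/
theorem rabbit_value_pos {n : ℕ} (hn : 1 ≤ n) :
    ∃ ε : ℝ, 0 < ε ∧ ∀ v : Fin n → ℝ,
      (∀ j, ∀ m : ℤ, v j ≠ (m : ℝ)) →
      ∃ k : ℕ, 0 < k ∧ ∀ j, ε ≤ |(k : ℝ) * v j - round ((k : ℝ) * v j)| := by
  classical
  set L := n + 1 with hL
  have hpos : ∀ i, (0 : ℝ) < rabbitModulus L i := fun i => by exact_mod_cast rabbitModulus_pos L i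
  refine ⟨min (1 / (rabbitModulus L n : ℝ)) (1 / (4 * L : ℝ)),
    lt_min (one_div_pos.2 (hpos n)) (by positivity), fun v hv => ?_⟩
  let S : ℕ → Finset (Fin n) := fun i =>
    Finset.univ.filter fun j => ∃ z : ℤ, (rabbitModulus L i : ℝ) * v j = z
  have hmem : ∀ i j, j ∈ S i ↔ ∃ z : ℤ, (rabbitModulus L i : ℝ) * v j = z := by simp [S]
  have hS : Monotone S := fun i i' hi j hj =>
    (hmem _ _).2 (exists_int_mul_eq_of_dvd (rabbitModulus_dvd (by omega) hi) ((hmem _ _).1 hj))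
  obtain ⟨i, hin, hi⟩ := exists_eq_succ_of_monotone_finset hS
  set M := rabbitModulus L i
  obtain ⟨m, hm⟩ := exists_nat_forall_le_abs_add_mul_sub (n := n) (L := L) (by omega) (S i)ᶜ v
    (fun j => M * v j) (by
      intro j hj t ht htL z hz
      rw [Finset.mem_compl, hi, hmem] at hj
      exact hj (exists_int_mul_eq_of_dvd (mul_rabbitModulus_dvd_succ ht htL i)
        ⟨z, by rw [← hz]; push_cast; ring⟩))
  refine ⟨1 + m * M, by omega, fun j => ?_⟩
  have hk : ((1 + m * M : ℕ) : ℝ) * v j = v j + m * (M * v j) := by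
    push_cast
    ring
  rw [hk]
  by_cases hj : j ∈ S i
  · obtain ⟨z, hz⟩ := (hmem _ _).1 hj
    have hMn : M ≤ rabbitModulus L n :=
      Nat.le_of_dvd (rabbitModulus_pos L n) (rabbitModulus_dvd (by omega) hin)
    set q := round (v j + m * (M * v j))
    have heq : v j + m * (M * v j) - q = v j - (q - m * z : ℤ) := by
      rw [hz]
      push_cast
      ring
    rw [heq]
    calc min (1 / (rabbitModulus L n : ℝ)) (1 / (4 * L : ℝ)) ≤ 1 / (rabbitModulus L n : ℝ) :=
          min_le_left _ _
      _ ≤ 1 / (M : ℝ) := one_div_le_one_div_of_le (hpos i) (by exact_mod_cast hMn)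
      _ ≤ _ := one_div_le_abs_sub_int (rabbitModulus_pos L i) (hv j) hz _
  · exact (min_le_right _ _).trans (hm j (Finset.mem_compl.2 hj) _)
end
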